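/- Let d ≥ 1 and let w be a doubling weight on the closed unit ball B^d (with respect to the metric ρ), normalized by w(B^d) = 1. Then there exists a constant K > 0, depending only on d and the doubling constant of w, such that for every positive integer n and every integer N ≥ K · max_{x ∈ B^d} 1/w(B_ρ(x, 1/n)), there exist N distinct points z_1, …, z_N in the open unit ball {x ∈ ℝ^d : ‖x‖ < 1} satisfying ∫_{B^d} P(x) w(x) dx = (1/N) · Σ_{j=1}^N P(z_j) for every polynomial P in d variables of total degree at most n. If, in addition, ess sup_{x ∈ B^d} w(x)·√(1−‖x‖²) < ∞, then the nodes can be chosen so that min_{1≤i≠j≤N} ρ(z_i, z_j) ≥ c_* · N^{-1/d} for a constant c_* > 0 depending only on d, the doubling constant of w, and this essential supremum. -/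

import Mathlib

open MeasureTheory Real Set

noncomputable section

variable {d : ℕ}

/-- The metric `ρ(x,y) = ‖x−y‖ + |√(1−‖x‖²) − √(1−‖y‖²)|` on the unit ball. -/
def rhoB (x y : EuclideanSpace ℝ (Fin d)) : ℝ :=
  ‖x - y‖ + |Real.sqrt (1 - ‖x‖ ^ 2) - Real.sqrt (1 - ‖y‖ ^ 2)|

/-- The ball `B_ρ(x,r) = {y ∈ B^d : ρ(x,y) ≤ r}`. -/
def ballRho (x : EuclideanSpace ℝ (Fin d)) (r : ℝ) : Set (EuclideanSpace ℝ (Fin d)) :=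
  {y | ‖y‖ ≤ 1 ∧ rhoB x y ≤ r}

/-- Lebesgue measure restricted to the closed unit ball `B^d`. -/
def ballVol (d : ℕ) : Measure (EuclideanSpace ℝ (Fin d)) :=
  volume.restrict (Metric.closedBall (0 : EuclideanSpace ℝ (Fin d)) 1)

/-- `w(A) = ∫_A w(x) dx`. -/
def wMassB (w : EuclideanSpace ℝ (Fin d) → ℝ) (A : Set (EuclideanSpace ℝ (Fin d))) : ℝ :=
  ∫ x in A, w x ∂(ballVol d)

/-- Evaluation of a `d`-variate real polynomial at a point of `ℝ^d`. -/
def pEval (P : MvPolynomial (Fin d) ℝ) (x : EuclideanSpace ℝ (Fin d)) : ℝ :=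
  MvPolynomial.eval (fun i => x i) P

/-- `f` is a real trigonometric polynomial of degree at most `n`. -/
def IsTrigPoly (n : ℕ) (f : ℝ → ℝ) : Prop :=
  ∃ p : Polynomial ℂ, p.natDegree ≤ 2 * n ∧
    ∀ t : ℝ, (f t : ℂ) * Complex.exp (Complex.I * t) ^ n = p.eval (Complex.exp (Complex.I * t))

namespace IsTrigPoly

theorem const (c : ℝ) : IsTrigPoly 0 fun _ => c :=
  ⟨Polynomial.C (c : ℂ), by simp, by simp⟩

theorem add {n : ℕ} {f g : ℝ → ℝ} (hf : IsTrigPoly n f) (hg : IsTrigPoly n g) :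
    IsTrigPoly n fun t => f t + g t := by
  obtain ⟨p, hp, hp'⟩ := hf
  obtain ⟨q, hq, hq'⟩ := hg
  refine ⟨p + q, (Polynomial.natDegree_add_le _ _).trans (max_le hp hq), fun t => ?_⟩
  rw [Polynomial.eval_add, ← hp', ← hq']
  push_cast
  ring

theorem mul {n m : ℕ} {f g : ℝ → ℝ} (hf : IsTrigPoly n f) (hg : IsTrigPoly m g) :
    IsTrigPoly (n + m) fun t => f t * g t := by
  obtain ⟨p, hp, hp'⟩ := hf
  obtain ⟨q, hq, hq'⟩ := hg
  refine ⟨p * q, Polynomial.natDegree_mul_le.trans (by omega), fun t => ?_⟩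
  rw [Polynomial.eval_mul, ← hp', ← hq']
  push_cast
  ring

theorem mono {n m : ℕ} {f : ℝ → ℝ} (hf : IsTrigPoly n f) (h : n ≤ m) : IsTrigPoly m f := by
  obtain ⟨p, hp, hp'⟩ := hf
  refine ⟨p * Polynomial.X ^ (m - n), Polynomial.natDegree_mul_le.trans ?_, fun t => ?_⟩
  · rw [Polynomial.natDegree_X_pow]
    omega
  · rw [Polynomial.eval_mul, ← hp', Polynomial.eval_pow, Polynomial.eval_X, mul_assoc, ← pow_add,
      Nat.add_sub_cancel' h]

theorem pow {n : ℕ} {f : ℝ → ℝ} (hf : IsTrigPoly n f) (k : ℕ) :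
    IsTrigPoly (k * n) fun t => f t ^ k := by
  induction k with
  | zero => simpa using const 1
  | succ k ih =>
    have := ih.mul hf
    simp only [pow_succ]
    rwa [add_mul, one_mul]

theorem finsetSum {ι : Type*} {n : ℕ} (s : Finset ι) (f : ι → ℝ → ℝ)
    (h : ∀ i ∈ s, IsTrigPoly n (f i)) : IsTrigPoly n fun t => ∑ i ∈ s, f i t := by
  classical
  induction s using Finset.induction_on with
  | empty => simpa using (const 0).mono (Nat.zero_le n)
  | insert a s ha ih =>
    simp only [Finset.sum_insert ha]
    exact (h a (by simp)).add (ih fun i hi => h i (by simp [hi]))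

theorem finsetProd {ι : Type*} (s : Finset ι) (n : ι → ℕ) (f : ι → ℝ → ℝ)
    (h : ∀ i ∈ s, IsTrigPoly (n i) (f i)) :
    IsTrigPoly (∑ i ∈ s, n i) fun t => ∏ i ∈ s, f i t := by
  classical
  induction s using Finset.induction_on with
  | empty => simpa using const 1
  | insert a s ha ih =>
    simp only [Finset.sum_insert ha, Finset.prod_insert ha]
    exact (h a (by simp)).mul (ih fun i hi => h i (by simp [hi]))

theorem cos_add_sin (a b c : ℝ) :
    IsTrigPoly 1 fun t => a * Real.cos t + b * Real.sin t + c := by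
  refine ⟨Polynomial.C ((a - b * Complex.I) / 2) * Polynomial.X ^ 2 +
    Polynomial.C (c : ℂ) * Polynomial.X + Polynomial.C ((a + b * Complex.I) / 2), ?_, fun t => ?_⟩
  · compute_degree
  · simp only [Polynomial.eval_add, Polynomial.eval_mul, Polynomial.eval_C, Polynomial.eval_pow,
      Polynomial.eval_X]
    have h1 : Complex.exp (Complex.I * t) = Complex.cos t + Complex.sin t * Complex.I := by
      rw [mul_comm, Complex.exp_mul_I]
    rw [h1]
    push_cast
    have h2 := Complex.sin_sq_add_cos_sq (t : ℂ)
    have h3 := Complex.I_sq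
    linear_combination (a + b * Complex.I) / 2 * h2 +
      (-a / 2 * Complex.sin t ^ 2 + b / 2 * Complex.sin t ^ 2 * Complex.I +
        b * Complex.cos t * Complex.sin t) * h3

end IsTrigPoly

/-- The kernel `‖n⁻¹ ∑_{k<n} e^{ikt}‖²`, a trigonometric polynomial peaked at the origin. -/
def fejerKernel (n : ℕ) (t : ℝ) : ℝ :=
  ‖(n : ℂ)⁻¹ * ∑ k ∈ Finset.range n, Complex.exp (Complex.I * t) ^ k‖ ^ 2

theorem isTrigPoly_fejerKernel (n : ℕ) : IsTrigPoly n (fejerKernel n) := by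
  rcases Nat.eq_zero_or_pos n with rfl | hn
  · convert IsTrigPoly.const 0 using 2
    simp [fejerKernel]
  refine IsTrigPoly.mono (n := n - 1)
    ⟨Polynomial.C ((n : ℂ)⁻¹ ^ 2) * (∑ k ∈ Finset.range n, Polynomial.X ^ k) ^ 2, ?_, fun t => ?_⟩
    (Nat.sub_le n 1)
  · refine (Polynomial.natDegree_C_mul_le _ _).trans (Polynomial.natDegree_pow_le.trans ?_)
    refine Nat.mul_le_mul_left 2 (Polynomial.natDegree_sum_le_of_forall_le _ _ fun k hk => ?_)
    rw [Polynomial.natDegree_X_pow]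
    have := Finset.mem_range.1 hk
    omega
  · simp only [Polynomial.eval_mul, Polynomial.eval_C, Polynomial.eval_pow,
      Polynomial.eval_finsetSum, Polynomial.eval_X]
    set z := Complex.exp (Complex.I * t) with hz
    have hzz : (starRingEnd ℂ) z * z = 1 := by
      rw [hz, ← Complex.exp_conj, ← Complex.exp_add]
      simp
    have h1 : (∑ k ∈ Finset.range n, (starRingEnd ℂ) z ^ k) * z ^ (n - 1) =
        ∑ k ∈ Finset.range n, z ^ k := by
      rw [Finset.sum_mul, ← Finset.sum_range_reflect]
      refine Finset.sum_congr rfl fun k hk => ?_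
      have hk := Finset.mem_range.1 hk
      have : z ^ (n - 1) = z ^ (n - 1 - k) * z ^ k := by rw [← pow_add]; congr 1; omega
      rw [this, ← mul_assoc, ← mul_pow, hzz, one_pow, one_mul]
    have h2 : ((fejerKernel n t : ℝ) : ℂ) = (n : ℂ)⁻¹ ^ 2 *
        ((∑ k ∈ Finset.range n, (starRingEnd ℂ) z ^ k) * ∑ k ∈ Finset.range n, z ^ k) := by
      rw [fejerKernel]
      push_cast
      rw [← Complex.conj_mul', map_mul, map_sum]
      simp only [map_pow, map_inv₀, Complex.conj_natCast]
      ring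
    rw [h2]
    linear_combination ((n : ℂ)⁻¹ ^ 2 * ∑ k ∈ Finset.range n, z ^ k) * h1

theorem fejerKernel_zero {n : ℕ} (hn : 0 < n) : fejerKernel n 0 = 1 := by
  have : (n : ℂ) ≠ 0 := by exact_mod_cast hn.ne'
  simp [fejerKernel, this]

theorem fejerKernel_nonneg (n : ℕ) (t : ℝ) : 0 ≤ fejerKernel n t := by
  unfold fejerKernel
  positivity

theorem fejerKernel_le_one (n : ℕ) (t : ℝ) : fejerKernel n t ≤ 1 := by
  rcases Nat.eq_zero_or_pos n with rfl | hn
  · simp [fejerKernel]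
  have h : ‖∑ k ∈ Finset.range n, Complex.exp (Complex.I * t) ^ k‖ ≤ n := by
    refine (norm_sum_le _ _).trans ?_
    simp [Complex.norm_exp]
  have hn' : (0 : ℝ) < n := by exact_mod_cast hn
  rw [fejerKernel, norm_mul, norm_inv, Complex.norm_natCast]
  refine pow_le_one₀ (by positivity) ?_
  rw [inv_mul_le_iff₀ hn']
  simpa using h

theorem fejerKernel_le {n : ℕ} (hn : 0 < n) {t : ℝ} (ht : |t| ≤ Real.pi) (ht0 : t ≠ 0) :
    fejerKernel n t ≤ (Real.pi / (n * |t|)) ^ 2 := by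
  have hn' : (0 : ℝ) < n := by exact_mod_cast hn
  have ht' := abs_pos.2 ht0
  have h1 : 2 / Real.pi * |t| ≤ ‖Complex.exp (Complex.I * t) - 1‖ := by
    rw [Complex.norm_exp_I_mul_ofReal_sub_one, norm_mul, Real.norm_eq_abs, Real.norm_eq_abs,
      abs_two]
    have := Real.mul_abs_le_abs_sin (x := t / 2) (by rw [abs_div, abs_two]; linarith)
    rw [abs_div, abs_two] at this
    linarith
  have h2 : ‖∑ k ∈ Finset.range n, Complex.exp (Complex.I * t) ^ k‖ *
      ‖Complex.exp (Complex.I * t) - 1‖ ≤ 2 := by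
    rw [← norm_mul, geom_sum_mul]
    refine (norm_sub_le _ _).trans ?_
    simp [Complex.norm_exp]
    norm_num
  rw [fejerKernel, norm_mul, norm_inv, Complex.norm_natCast]
  refine pow_le_pow_left₀ (by positivity) ?_ 2
  rw [inv_mul_le_iff₀ hn', mul_div_assoc', mul_div_mul_left _ _ hn'.ne', le_div_iff₀ ht']
  have hpi := Real.pi_pos
  have h3 := (mul_le_mul_of_nonneg_left h1 (norm_nonneg
    (∑ k ∈ Finset.range n, Complex.exp (Complex.I * t) ^ k))).trans h2
  calc _ = (‖∑ k ∈ Finset.range n, Complex.exp (Complex.I * t) ^ k‖ * (2 / Real.pi * |t|))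
        * (Real.pi / 2) := by field_simp
    _ ≤ 2 * (Real.pi / 2) := by gcongr
    _ = Real.pi := by ring

theorem IsTrigPoly.abs_deriv_zero_le {m : ℕ} {g : ℝ → ℝ} {g' : ℝ} (hg : IsTrigPoly m g)
    (hg' : HasDerivAt g g' 0) :
    |g'| ≤ m * ∑ j ∈ Finset.range (2 * m + 1),
      |g (2 * Real.pi * ((j : ℝ) - m) / (2 * m + 1))| := by
  obtain ⟨p, hp, hpg⟩ := hg
  set M : ℕ := 2 * m + 1 with hM
  have hMn : M ≠ 0 := by omega
  have hM0 : (M : ℂ) ≠ 0 := Nat.cast_ne_zero.2 hMn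
  set e : ℝ → ℂ := fun t => Complex.exp (Complex.I * t) with he
  have he1 : ∀ t, ‖e t‖ = 1 := fun t => by simp [he, Complex.norm_exp]
  have he0 : ∀ t, e t ≠ 0 := fun t => Complex.exp_ne_zero _
  set t : ℕ → ℝ := fun j => 2 * Real.pi * ((j : ℝ) - m) / (2 * m + 1) with ht
  have hev : ∀ z, p.eval z = ∑ k ∈ Finset.range M, p.coeff k * z ^ k := fun z =>
    Polynomial.eval_eq_sum_range' (by omega) z
  have hnorm : ∀ j, ‖p.eval (e (t j))‖ = |g (t j)| := fun j => by
    rw [← hpg, norm_mul, norm_pow, he1, one_pow, mul_one, Complex.norm_real, Real.norm_eq_abs]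
  have hζ : IsPrimitiveRoot (Complex.exp (2 * Real.pi * Complex.I / M)) M :=
    Complex.isPrimitiveRoot_exp M hMn
  set ζ := Complex.exp (2 * Real.pi * Complex.I / M) with hζd
  have hζ0 : ζ ≠ 0 := Complex.exp_ne_zero _
  have hej : ∀ j, e (t j) = e (t 0) * ζ ^ j := fun j => by
    simp only [he, ht, hζd, ← Complex.exp_nat_mul, ← Complex.exp_add]
    congr 1
    rw [hM] at hM0 ⊢
    push_cast at hM0 ⊢
    field_simp
    ring
  have horth : ∀ k ∈ Finset.range M,
      (M : ℂ) * p.coeff k = ∑ j ∈ Finset.range M, p.eval (e (t j)) * (e (t j) ^ k)⁻¹ := by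
    intro k hk
    simp only [hev, Finset.sum_mul]
    rw [Finset.sum_comm, Finset.sum_eq_single_of_mem k hk]
    · have : ∀ j, p.coeff k * e (t j) ^ k * (e (t j) ^ k)⁻¹ = p.coeff k := fun j =>
        mul_inv_cancel_right₀ (pow_ne_zero _ (he0 _)) _
      simp [this]
    · intro l hl hlk
      have h1 : ∀ j, p.coeff l * e (t j) ^ l * (e (t j) ^ k)⁻¹ =
          p.coeff l * (e (t 0) ^ l * (e (t 0) ^ k)⁻¹) * (ζ ^ l * (ζ ^ k)⁻¹) ^ j := fun j => by
        rw [hej, mul_pow, mul_pow, mul_pow, mul_inv, inv_pow, ← pow_mul, ← pow_mul, ← pow_mul,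
          ← pow_mul, mul_comm l j, mul_comm k j]
        ring
      simp only [h1, ← Finset.mul_sum]
      have h2 : ζ ^ l * (ζ ^ k)⁻¹ ≠ 1 := by
        rw [Ne, mul_inv_eq_one₀ (pow_ne_zero _ hζ0)]
        exact fun h => hlk (hζ.pow_inj (Finset.mem_range.1 hl) (Finset.mem_range.1 hk) h)
      have h3 : (ζ ^ l * (ζ ^ k)⁻¹) ^ M = 1 := by
        rw [mul_pow, inv_pow, ← pow_mul, ← pow_mul, mul_comm l, mul_comm k, pow_mul, pow_mul,
          hζ.pow_eq_one]
        simp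
      rw [geom_sum_eq h2, h3]
      simp
  have hcoeff : ∀ k ∈ Finset.range M,
      ‖p.coeff k‖ ≤ (∑ j ∈ Finset.range M, |g (t j)|) / M := by
    intro k hk
    have hM' : (0 : ℝ) < M := Nat.cast_pos.2 (Nat.pos_of_ne_zero hMn)
    rw [le_div_iff₀ hM', mul_comm, ← Complex.norm_natCast, ← norm_mul, horth k hk]
    refine (norm_sum_le _ _).trans (Finset.sum_le_sum fun j _ => ?_)
    rw [norm_mul, norm_inv, norm_pow, he1, hnorm]
    simp
  have hg2 : ∀ s : ℝ, (g s : ℂ) =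
      ∑ k ∈ Finset.range M, p.coeff k * Complex.exp (Complex.I * ((k : ℂ) - m) * s) := by
    intro s
    have h1 := hpg s
    rw [← eq_mul_inv_iff_mul_eq₀ (pow_ne_zero _ (he0 s)), hev, Finset.sum_mul] at h1
    rw [h1]
    refine Finset.sum_congr rfl fun k _ => ?_
    rw [mul_assoc, ← Complex.exp_nat_mul, ← Complex.exp_nat_mul, ← Complex.exp_neg,
      ← Complex.exp_add]
    congr 2
    ring
  have hd : HasDerivAt (fun s : ℝ => (g s : ℂ))
      (∑ k ∈ Finset.range M, p.coeff k * (Complex.I * ((k : ℂ) - m))) 0 := by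
    simp only [hg2]
    refine HasDerivAt.fun_sum fun k _ => HasDerivAt.const_mul _ ?_
    have := (((hasDerivAt_id (0 : ℝ)).ofReal_comp.const_mul (Complex.I * ((k : ℂ) - m)))).cexp
    simpa using this
  have hg'' : (g' : ℂ) = ∑ k ∈ Finset.range M, p.coeff k * (Complex.I * ((k : ℂ) - m)) :=
    hg'.ofReal_comp.unique hd
  have hM' : (0 : ℝ) < M := Nat.cast_pos.2 (Nat.pos_of_ne_zero hMn)
  calc |g'| = ‖(g' : ℂ)‖ := by simp
    _ ≤ ∑ k ∈ Finset.range M, ‖p.coeff k * (Complex.I * ((k : ℂ) - m))‖ := by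
        rw [hg'']; exact norm_sum_le _ _
    _ ≤ ∑ k ∈ Finset.range M, (∑ j ∈ Finset.range M, |g (t j)|) / M * m := by
        refine Finset.sum_le_sum fun k hk => ?_
        rw [norm_mul]
        refine mul_le_mul (hcoeff k hk) ?_ (norm_nonneg _) (by positivity)
        rw [norm_mul, Complex.norm_I, one_mul]
        have : ((k : ℂ) - m) = (((k : ℝ) - m : ℝ) : ℂ) := by push_cast; ring
        rw [this, Complex.norm_real, Real.norm_eq_abs, abs_le]
        have hk' : (k : ℝ) ≤ 2 * m := by
          have := Finset.mem_range.1 hk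
          exact_mod_cast (by omega : k ≤ 2 * m)
        constructor <;> linarith [(Nat.cast_nonneg k : (0 : ℝ) ≤ k)]
    _ = m * ∑ j ∈ Finset.range M, |g (t j)| := by
        rw [Finset.sum_const, Finset.card_range, nsmul_eq_mul]
        field_simp

/-- A Bernstein inequality for trigonometric polynomials with a rapidly decaying sum of values on
the right-hand side. -/
theorem IsTrigPoly.abs_deriv_zero_le_localized (q : ℕ) {n : ℕ} (hn : 0 < n) :
    ∃ (m : ℕ) (t : ℕ → ℝ), (∀ j < 2 * m + 1, |t j| ≤ 4 * |(j : ℝ) - m| / n) ∧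
      ∀ (T : ℝ → ℝ) (T' : ℝ), IsTrigPoly n T → HasDerivAt T T' 0 →
        |T'| ≤ ((q + 1) * n : ℝ) * ∑ j ∈ Finset.range (2 * m + 1),
          ((2 * q + 3) / (1 + |(j : ℝ) - m|)) ^ (2 * q) * |T (t j)| := by
  set m : ℕ := (q + 1) * n with hm
  have hm0 : 0 < m := by positivity
  have hn' : (1 : ℝ) ≤ n := by exact_mod_cast hn
  have hmR : (m : ℝ) = (q + 1) * n := by rw [hm]; push_cast; ring
  set t : ℕ → ℝ := fun j => 2 * Real.pi * ((j : ℝ) - m) / (2 * m + 1) with ht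
  have htj : ∀ j, |t j| = 2 * Real.pi * |(j : ℝ) - m| / (2 * m + 1) := fun j => by
    rw [ht]
    simp only
    rw [abs_div, abs_mul, abs_of_pos Real.two_pi_pos, abs_of_pos (a := 2 * (m : ℝ) + 1)
      (by positivity)]
  refine ⟨m, t, fun j _ => ?_, fun T T' hT hT' => ?_⟩
  · rw [htj, div_le_div_iff₀ (by positivity) (by positivity)]
    have h1 : Real.pi * n ≤ 2 * (2 * m + 1) := by
      have h2 : (n : ℝ) ≤ m := by rw [hmR]; nlinarith [(Nat.cast_nonneg q : (0 : ℝ) ≤ q)]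
      nlinarith [Real.pi_le_four, Real.pi_pos]
    nlinarith [abs_nonneg ((j : ℝ) - m)]
  · have hK : IsTrigPoly (q * n) fun s => fejerKernel n s ^ q := (isTrigPoly_fejerKernel n).pow q
    have hKd : DifferentiableAt ℝ (fejerKernel n) 0 := by
      refine DifferentiableAt.norm_sq ℝ (f := fun t : ℝ => (n : ℂ)⁻¹ *
        ∑ k ∈ Finset.range n, Complex.exp (Complex.I * t) ^ k) ?_
      have h1 : DifferentiableAt ℝ (fun t : ℝ => Complex.exp (Complex.I * t)) 0 :=
        (Complex.ofRealCLM.differentiableAt.const_mul Complex.I).cexp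
      exact (DifferentiableAt.fun_sum fun k _ => h1.pow k).const_mul _
    obtain ⟨K', hK'⟩ : ∃ K', HasDerivAt (fejerKernel n) K' 0 := ⟨_, hKd.hasDerivAt⟩
    have hK'0 : K' = 0 := by
      refine IsLocalMax.hasDerivAt_eq_zero (f := fejerKernel n) (a := 0) ?_ hK'
      exact Filter.Eventually.of_forall fun s => by
        rw [fejerKernel_zero hn]
        exact fejerKernel_le_one n s
    rw [hK'0] at hK'
    have hg : IsTrigPoly m fun s => T s * fejerKernel n s ^ q := by
      have := hT.mul hK
      rwa [show n + q * n = m by rw [hm]; ring] at this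
    have hg' : HasDerivAt (fun s => T s * fejerKernel n s ^ q) T' 0 := by
      have := hT'.fun_mul (hK'.fun_pow q)
      simpa [fejerKernel_zero hn] using this
    refine (hg.abs_deriv_zero_le hg').trans ?_
    rw [← hmR]
    refine mul_le_mul_of_nonneg_left (Finset.sum_le_sum fun j hj => ?_) (by positivity)
    change |T (t j) * fejerKernel n (t j) ^ q| ≤ _
    rw [abs_mul, mul_comm, abs_of_nonneg (pow_nonneg (fejerKernel_nonneg n _) q), pow_mul]
    refine mul_le_mul_of_nonneg_right
      (pow_le_pow_left₀ (fejerKernel_nonneg n _) ?_ q) (abs_nonneg _)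
    rcases eq_or_ne (j : ℝ) m with h0 | h0
    · rw [h0]
      refine (fejerKernel_le_one n _).trans (one_le_pow₀ ?_)
      simp only [sub_self, abs_zero, add_zero, div_one]
      linarith [(Nat.cast_nonneg q : (0 : ℝ) ≤ q)]
    · have hjm : (1 : ℝ) ≤ |(j : ℝ) - m| := by
        have : (j : ℤ) - m ≠ 0 := by
          intro h
          apply h0
          have h2 : (j : ℤ) = m := by linarith
          exact_mod_cast h2
        have := Int.one_le_abs this
        exact_mod_cast this
      have hjm2 : |(j : ℝ) - m| ≤ m := by
        have := Finset.mem_range.1 hj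
        have : (j : ℝ) ≤ 2 * m := by exact_mod_cast (by omega : j ≤ 2 * m)
        rw [abs_le]
        constructor <;> linarith [(Nat.cast_nonneg j : (0 : ℝ) ≤ j)]
      have ht0 : t j ≠ 0 := by
        rw [← abs_pos, htj]
        have := Real.pi_pos
        positivity
      have htpi : |t j| ≤ Real.pi := by
        rw [htj, div_le_iff₀ (by positivity)]
        nlinarith [Real.pi_pos]
      refine (fejerKernel_le hn htpi ht0).trans (pow_le_pow_left₀ (by positivity) ?_ 2)
      rw [htj, div_le_div_iff₀ (by have := Real.pi_pos; positivity) (by positivity)]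
      have hpi := Real.pi_pos
      rw [← sub_nonneg]
      have : (2 * q + 3) * (n * (2 * Real.pi * |(j : ℝ) - m| / (2 * m + 1))) -
          Real.pi * (1 + |(j : ℝ) - m|) = Real.pi / (2 * m + 1) *
          ((2 * q + 3) * n * (2 * |(j : ℝ) - m|) - (1 + |(j : ℝ) - m|) * (2 * m + 1)) := by
        field_simp
      rw [this]
      refine mul_nonneg (by positivity) (sub_nonneg.2 ?_)
      refine (mul_le_mul (by linarith : 1 + |(j : ℝ) - m| ≤ 2 * |(j : ℝ) - m|)
        (?_ : 2 * (m : ℝ) + 1 ≤ (2 * q + 3) * n) (by positivity) (by positivity)).trans_eq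
          (mul_comm _ _)
      rw [hmR]
      nlinarith

/-- The angular derivative `x_i ∂_j - x_j ∂_i`, as an operator on polynomials. -/
def angDeriv (i j : Fin d) (G : MvPolynomial (Fin d) ℝ) : MvPolynomial (Fin d) ℝ :=
  MvPolynomial.X i * MvPolynomial.pderiv j G - MvPolynomial.X j * MvPolynomial.pderiv i G

theorem totalDegree_X_mul_pderiv_le (i j : Fin d) (G : MvPolynomial (Fin d) ℝ) :
    (MvPolynomial.X i * MvPolynomial.pderiv j G).totalDegree ≤ G.totalDegree := by
  classical
  conv_lhs => rw [G.as_sum]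
  rw [map_sum, Finset.mul_sum]
  refine MvPolynomial.totalDegree_finsetSum_le fun s hs => ?_
  rw [MvPolynomial.pderiv_monomial, MvPolynomial.X, MvPolynomial.monomial_mul]
  by_cases hsj : s j = 0
  · simp [hsj]
  refine (MvPolynomial.totalDegree_monomial_le _ _).trans ?_
  refine le_trans ?_ (MvPolynomial.le_totalDegree hs)
  have h1 : s = (s - Finsupp.single j 1) + Finsupp.single j 1 := by
    ext k
    by_cases hk : k = j
    · subst hk
      simp
      omega
    · simp [Finsupp.single_eq_of_ne hk]
  have key : ∀ a b : Fin d →₀ ℕ, ((a + b).sum fun _ => id) =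
      (a.sum fun _ => id) + b.sum fun _ => id :=
    fun a b => Finsupp.sum_add_index' (fun _ => rfl) fun _ _ _ => rfl
  change ((Finsupp.single i 1 + (s - Finsupp.single j 1)).sum fun _ => id) ≤ s.sum fun _ => id
  conv_rhs => rw [h1]
  rw [key, key, Finsupp.sum_single_index rfl, Finsupp.sum_single_index rfl, add_comm]

theorem totalDegree_angDeriv_le (i j : Fin d) (G : MvPolynomial (Fin d) ℝ) :
    (angDeriv i j G).totalDegree ≤ G.totalDegree :=
  (MvPolynomial.totalDegree_sub _ _).trans
    (max_le (totalDegree_X_mul_pderiv_le i j G) (totalDegree_X_mul_pderiv_le j i G))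

theorem pEval_angDeriv (i j : Fin d) (G : MvPolynomial (Fin d) ℝ) (x : EuclideanSpace ℝ (Fin d)) :
    pEval (angDeriv i j G) x =
      x i * pEval (MvPolynomial.pderiv j G) x - x j * pEval (MvPolynomial.pderiv i G) x := by
  simp [pEval, angDeriv]

theorem continuous_pEval (G : MvPolynomial (Fin d) ℝ) : Continuous (pEval G) := by
  unfold pEval
  exact (MvPolynomial.continuous_eval G).comp (by fun_prop)

theorem hasDerivAt_pEval (G : MvPolynomial (Fin d) ℝ) {γ : ℝ → EuclideanSpace ℝ (Fin d)}
    {γ' : Fin d → ℝ} {t : ℝ} (h : ∀ k, HasDerivAt (fun s => γ s k) (γ' k) t) :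
    HasDerivAt (fun s => pEval G (γ s))
      (∑ k, γ' k * pEval (MvPolynomial.pderiv k G) (γ t)) t := by
  classical
  unfold pEval
  induction G using MvPolynomial.induction_on with
  | C a =>
    simp only [MvPolynomial.eval_C, MvPolynomial.pderiv_C, map_zero, mul_zero,
      Finset.sum_const_zero]
    exact hasDerivAt_const _ _
  | add p q hp hq =>
    simp only [map_add, mul_add, Finset.sum_add_distrib]
    exact hp.fun_add hq
  | mul_X p i hp =>
    have h1 := hp.fun_mul (h i)
    simp only [map_mul, MvPolynomial.eval_X]
    refine h1.congr_deriv (Eq.symm ?_)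
    simp only [Derivation.leibniz, smul_eq_mul, map_add, map_mul, MvPolynomial.eval_X, mul_add,
      Finset.sum_add_distrib, MvPolynomial.pderiv_X, Finset.sum_mul]
    rw [add_comm]
    congr 1
    · exact Finset.sum_congr rfl fun k _ => by ring
    · rw [Finset.sum_eq_single i]
      · simp [mul_comm]
      · intro k _ hk
        simp [Pi.single_eq_of_ne' hk]
      · simp

/-- Rotation by the angle `t` in the `(i, j)` coordinate plane. -/
def planeRot (i j : Fin d) (t : ℝ) (x : EuclideanSpace ℝ (Fin d)) : EuclideanSpace ℝ (Fin d) :=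
  WithLp.toLp 2 fun k => if k = i then Real.cos t * x i - Real.sin t * x j
    else if k = j then Real.sin t * x i + Real.cos t * x j else x k

theorem planeRot_apply (i j : Fin d) (t : ℝ) (x : EuclideanSpace ℝ (Fin d)) (k : Fin d) :
    planeRot i j t x k = if k = i then Real.cos t * x i - Real.sin t * x j
      else if k = j then Real.sin t * x i + Real.cos t * x j else x k := rfl

@[simp] theorem planeRot_zero (i j : Fin d) (x : EuclideanSpace ℝ (Fin d)) :
    planeRot i j 0 x = x := by
  ext k
  rw [planeRot_apply]
  split_ifs with h h' <;> simp [*]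

theorem planeRot_sub (i j : Fin d) (t : ℝ) (x y : EuclideanSpace ℝ (Fin d)) :
    planeRot i j t (x - y) = planeRot i j t x - planeRot i j t y := by
  ext k
  simp only [planeRot_apply, PiLp.sub_apply]
  split_ifs <;> ring

theorem sum_eq_add_add_sum_erase {i j : Fin d} (hij : i ≠ j) (f : Fin d → ℝ) :
    ∑ k, f k = f i + f j + ∑ k ∈ (Finset.univ.erase i).erase j, f k := by
  rw [add_assoc, Finset.add_sum_erase _ _ (by simp [hij.symm]), Finset.add_sum_erase _ _ (by simp)]

theorem norm_planeRot {i j : Fin d} (hij : i ≠ j) (t : ℝ) (x : EuclideanSpace ℝ (Fin d)) :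
    ‖planeRot i j t x‖ = ‖x‖ := by
  rw [← sq_eq_sq₀ (norm_nonneg _) (norm_nonneg _), EuclideanSpace.real_norm_sq_eq,
    EuclideanSpace.real_norm_sq_eq, sum_eq_add_add_sum_erase hij, sum_eq_add_add_sum_erase hij]
  congr 1
  · simp only [planeRot_apply, hij.symm, if_true, if_false]
    linear_combination (x i ^ 2 + x j ^ 2) * Real.sin_sq_add_cos_sq t
  · refine Finset.sum_congr rfl fun k hk => ?_
    simp only [Finset.mem_erase] at hk
    simp [planeRot_apply, hk.1, hk.2.1]

theorem dist_planeRot {i j : Fin d} (hij : i ≠ j) (t : ℝ) (x y : EuclideanSpace ℝ (Fin d)) :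
    dist (planeRot i j t x) (planeRot i j t y) = dist x y := by
  rw [dist_eq_norm, ← planeRot_sub, norm_planeRot hij, dist_eq_norm]

theorem dist_planeRot_self_le {i j : Fin d} (hij : i ≠ j) (t : ℝ) (x : EuclideanSpace ℝ (Fin d)) :
    dist (planeRot i j t x) x ≤ |t| * ‖x‖ := by
  rw [dist_eq_norm, ← sq_le_sq₀ (norm_nonneg _) (by positivity), mul_pow, sq_abs,
    EuclideanSpace.real_norm_sq_eq, EuclideanSpace.real_norm_sq_eq, sum_eq_add_add_sum_erase hij,
    sum_eq_add_add_sum_erase hij]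
  have h1 : ∑ k ∈ (Finset.univ.erase i).erase j, (planeRot i j t x - x) k ^ 2 = 0 := by
    refine Finset.sum_eq_zero fun k hk => ?_
    simp only [Finset.mem_erase] at hk
    simp [planeRot_apply, hk.1, hk.2.1]
  rw [h1, add_zero, mul_add]
  have h2 : 0 ≤ ∑ k ∈ (Finset.univ.erase i).erase j, x k ^ 2 :=
    Finset.sum_nonneg fun k _ => sq_nonneg _
  have h3 : 2 - 2 * Real.cos t ≤ t ^ 2 := by
    have := Real.one_sub_sq_div_two_le_cos (x := t)
    linarith
  refine le_trans ?_ (le_add_of_nonneg_right (mul_nonneg (sq_nonneg t) h2))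
  simp only [PiLp.sub_apply, planeRot_apply, hij.symm, if_true, if_false]
  calc _ = (2 - 2 * Real.cos t) * (x i ^ 2 + x j ^ 2) := by
        linear_combination (x i ^ 2 + x j ^ 2) * Real.sin_sq_add_cos_sq t
    _ ≤ _ := mul_le_mul_of_nonneg_right h3 (by positivity)

theorem hasDerivAt_pEval_planeRot {i j : Fin d} (hij : i ≠ j) (G : MvPolynomial (Fin d) ℝ)
    (x : EuclideanSpace ℝ (Fin d)) :
    HasDerivAt (fun t => pEval G (planeRot i j t x)) (pEval (angDeriv i j G) x) 0 := by
  have h := hasDerivAt_pEval G (γ := fun t => planeRot i j t x)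
    (γ' := fun k => if k = i then - x j else if k = j then x i else 0) (t := 0) ?_
  · refine h.congr_deriv ?_
    rw [planeRot_zero, sum_eq_add_add_sum_erase hij, pEval_angDeriv, Finset.sum_eq_zero]
    · simp only [if_true, hij.symm, if_false]
      ring
    · intro k hk
      simp only [Finset.mem_erase] at hk
      simp [hk.1, hk.2.1]
  · intro k
    simp only [planeRot_apply]
    split_ifs
    · have := ((Real.hasDerivAt_cos 0).mul_const (x i)).fun_sub
        ((Real.hasDerivAt_sin 0).mul_const (x j))
      simpa using this
    · have := ((Real.hasDerivAt_sin 0).mul_const (x i)).fun_add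
        ((Real.hasDerivAt_cos 0).mul_const (x j))
      simpa using this
    · exact hasDerivAt_const _ _

theorem isTrigPoly_pEval_planeRot (i j : Fin d) {G : MvPolynomial (Fin d) ℝ} {n : ℕ}
    (hG : G.totalDegree ≤ n) (x : EuclideanSpace ℝ (Fin d)) :
    IsTrigPoly n fun t => pEval G (planeRot i j t x) := by
  have h1 : ∀ k, IsTrigPoly 1 fun t => planeRot i j t x k := by
    intro k
    simp only [planeRot_apply]
    split_ifs
    · convert IsTrigPoly.cos_add_sin (x i) (-x j) 0 using 2
      ring
    · convert IsTrigPoly.cos_add_sin (x j) (x i) 0 using 2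
      ring
    · exact (IsTrigPoly.const _).mono zero_le_one
  simp only [pEval, MvPolynomial.eval_eq]
  refine IsTrigPoly.finsetSum _ _ fun s hs => ?_
  have h2 := (IsTrigPoly.const (G.coeff s)).mul
    (IsTrigPoly.finsetProd s.support (fun k => s k * 1) (fun k t => planeRot i j t x k ^ s k)
      fun k _ => (h1 k).pow (s k))
  refine h2.mono (le_trans ?_ ((MvPolynomial.le_totalDegree hs).trans hG))
  simp [Finsupp.sum]

/-- A localized Bernstein inequality on the sphere. -/
theorem abs_pEval_angDeriv_le (q : ℕ) {n : ℕ} (hn : 0 < n) :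
    ∃ (m : ℕ) (t : ℕ → ℝ), (∀ j < 2 * m + 1, |t j| ≤ 4 * |(j : ℝ) - m| / n) ∧
      ∀ (i k : Fin d), i ≠ k → ∀ G : MvPolynomial (Fin d) ℝ, G.totalDegree ≤ n → ∀ x,
        |pEval (angDeriv i k G) x| ≤ ((q + 1) * n : ℝ) * ∑ j ∈ Finset.range (2 * m + 1),
          ((2 * q + 3) / (1 + |(j : ℝ) - m|)) ^ (2 * q) * |pEval G (planeRot i k (t j) x)| := by
  obtain ⟨m, t, ht, h⟩ := IsTrigPoly.abs_deriv_zero_le_localized q hn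
  exact ⟨m, t, ht, fun i k hik G hG x => h _ _ (isTrigPoly_pEval_planeRot i k hG x)
    (hasDerivAt_pEval_planeRot hik G x)⟩

/-- The `ℓ¹` size of the angular gradient. -/
def angNorm (G : MvPolynomial (Fin d) ℝ) (x : EuclideanSpace ℝ (Fin d)) : ℝ :=
  ∑ p : Fin d × Fin d, |pEval (angDeriv p.1 p.2 G) x|

/-- The `ℓ¹` size of the second angular derivatives. -/
def angNormTwo (G : MvPolynomial (Fin d) ℝ) (x : EuclideanSpace ℝ (Fin d)) : ℝ :=
  ∑ p : Fin d × Fin d, angNorm (angDeriv p.1 p.2 G) x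

theorem angNorm_nonneg (G : MvPolynomial (Fin d) ℝ) (x : EuclideanSpace ℝ (Fin d)) :
    0 ≤ angNorm G x := Finset.sum_nonneg fun _ _ => abs_nonneg _

theorem angNormTwo_nonneg (G : MvPolynomial (Fin d) ℝ) (x : EuclideanSpace ℝ (Fin d)) :
    0 ≤ angNormTwo G x := Finset.sum_nonneg fun _ _ => angNorm_nonneg _ _

theorem continuous_angNorm (G : MvPolynomial (Fin d) ℝ) : Continuous (angNorm G) :=
  continuous_finsetSum _ fun _ _ => (continuous_pEval _).abs

theorem continuous_angNormTwo (G : MvPolynomial (Fin d) ℝ) : Continuous (angNormTwo G) :=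
  continuous_finsetSum _ fun _ _ => continuous_angNorm _

theorem angNorm_angDeriv_le_angNormTwo (i j : Fin d) (G : MvPolynomial (Fin d) ℝ)
    (x : EuclideanSpace ℝ (Fin d)) : angNorm (angDeriv i j G) x ≤ angNormTwo G x := by
  have h := Finset.single_le_sum (s := Finset.univ)
    (f := fun p : Fin d × Fin d => angNorm (angDeriv p.1 p.2 G) x)
    (fun _ _ => angNorm_nonneg _ _) (Finset.mem_univ (i, j))
  exact h

/-- The point at angle `t` on the great circle through `x` with direction `u`. -/
def greatCircle (x u : EuclideanSpace ℝ (Fin d)) (t : ℝ) : EuclideanSpace ℝ (Fin d) :=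
  Real.cos t • x + Real.sin t • u

@[simp] theorem greatCircle_zero (x u : EuclideanSpace ℝ (Fin d)) : greatCircle x u 0 = x := by
  simp [greatCircle]

theorem norm_greatCircle {x u : EuclideanSpace ℝ (Fin d)} (hx : ‖x‖ = 1) (hu : ‖u‖ = 1)
    (hxu : inner ℝ x u = 0) (t : ℝ) : ‖greatCircle x u t‖ = 1 := by
  rw [← sq_eq_sq₀ (norm_nonneg _) zero_le_one, greatCircle, norm_add_sq_real, norm_smul, norm_smul,
    inner_smul_left, inner_smul_right, hxu, hx, hu]
  simp

theorem norm_greatCircle_sub_le {x u : EuclideanSpace ℝ (Fin d)} (hx : ‖x‖ = 1) (hu : ‖u‖ = 1)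
    (hxu : inner ℝ x u = 0) (t : ℝ) : ‖greatCircle x u t - x‖ ≤ |t| := by
  rw [← sq_le_sq₀ (norm_nonneg _) (abs_nonneg _), sq_abs]
  have h1 : greatCircle x u t - x = (Real.cos t - 1) • x + Real.sin t • u := by
    rw [greatCircle, sub_smul, one_smul]; abel
  rw [h1, norm_add_sq_real, norm_smul, norm_smul, inner_smul_left, inner_smul_right, hxu, hx, hu]
  simp only [Real.norm_eq_abs, mul_one, sq_abs, mul_zero, add_zero]
  have := Real.one_sub_sq_div_two_le_cos (x := t)
  nlinarith [Real.sin_sq_add_cos_sq t]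

theorem hasDerivAt_pEval_greatCircle {x u : EuclideanSpace ℝ (Fin d)} (hx : ‖x‖ = 1)
    (hu : ‖u‖ = 1) (hxu : inner ℝ x u = 0) (G : MvPolynomial (Fin d) ℝ) (t : ℝ) :
    HasDerivAt (fun s => pEval G (greatCircle x u s))
      (∑ p : Fin d × Fin d, x p.1 * u p.2 * pEval (angDeriv p.1 p.2 G) (greatCircle x u t)) t := by
  have h := hasDerivAt_pEval G (γ := greatCircle x u)
    (γ' := fun k => - Real.sin t * x k + Real.cos t * u k) (t := t) fun k => by
      simp only [greatCircle, PiLp.add_apply, PiLp.smul_apply, smul_eq_mul]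
      exact ((Real.hasDerivAt_cos t).mul_const _).fun_add ((Real.hasDerivAt_sin t).mul_const _)
  refine h.congr_deriv ?_
  have e1 : ∑ k, x k * greatCircle x u t k = Real.cos t := by
    have : inner ℝ (greatCircle x u t) x = Real.cos t := by
      rw [greatCircle, inner_add_left, inner_smul_left, inner_smul_left, real_inner_self_eq_norm_sq,
        hx, real_inner_comm, hxu]
      simp
    rw [← this, PiLp.inner_apply]
    simp
  have e2 : ∑ k, u k * greatCircle x u t k = Real.sin t := by
    have : inner ℝ (greatCircle x u t) u = Real.sin t := by
      rw [greatCircle, inner_add_left, inner_smul_left, inner_smul_left, real_inner_self_eq_norm_sq,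
        hu, hxu]
      simp
    rw [← this, PiLp.inner_apply]
    simp
  set g := greatCircle x u t
  rw [Fintype.sum_prod_type]
  simp only [pEval_angDeriv, mul_sub, Finset.sum_sub_distrib]
  have h1 : ∑ i, ∑ j, x i * u j * (g i * pEval (MvPolynomial.pderiv j G) g) =
      Real.cos t * ∑ j, u j * pEval (MvPolynomial.pderiv j G) g := by
    rw [← e1, Finset.sum_mul_sum]
    exact Finset.sum_congr rfl fun i _ => Finset.sum_congr rfl fun j _ => by ring
  have h2 : ∑ i, ∑ j, x i * u j * (g j * pEval (MvPolynomial.pderiv i G) g) =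
      Real.sin t * ∑ i, x i * pEval (MvPolynomial.pderiv i G) g := by
    rw [← e2, Finset.sum_mul_sum, Finset.sum_comm]
    exact Finset.sum_congr rfl fun i _ => Finset.sum_congr rfl fun j _ => by ring
  rw [h1, h2, Finset.mul_sum, Finset.mul_sum, ← Finset.sum_sub_distrib]
  exact Finset.sum_congr rfl fun k _ => by ring

theorem abs_sum_mul_le_sum_abs {x u : EuclideanSpace ℝ (Fin d)} (hx : ‖x‖ = 1) (hu : ‖u‖ = 1)
    (f : Fin d × Fin d → ℝ) :
    |∑ p : Fin d × Fin d, x p.1 * u p.2 * f p| ≤ ∑ p : Fin d × Fin d, |f p| := by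
  refine (Finset.abs_sum_le_sum_abs _ _).trans (Finset.sum_le_sum fun p _ => ?_)
  rw [abs_mul, abs_mul]
  have h1 : |x p.1| ≤ 1 := hx ▸ PiLp.norm_apply_le x p.1
  have h2 : |u p.2| ≤ 1 := hu ▸ PiLp.norm_apply_le u p.2
  exact mul_le_of_le_one_left (abs_nonneg _) (mul_le_one₀ h1 (abs_nonneg _) h2)

theorem abs_pEval_greatCircle_sub_le {x u : EuclideanSpace ℝ (Fin d)} (hx : ‖x‖ = 1)
    (hu : ‖u‖ = 1) (hxu : inner ℝ x u = 0) (G : MvPolynomial (Fin d) ℝ) {T F : ℝ} (hT : 0 ≤ T)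
    (hF : ∀ y, ‖y‖ = 1 → ‖y - x‖ ≤ T → angNorm G y ≤ F) :
    |pEval G (greatCircle x u T) - pEval G x| ≤ F * T := by
  have h := norm_image_sub_le_of_norm_deriv_le_segment' (a := 0) (b := T) (C := F)
    (f := fun s => pEval G (greatCircle x u s))
    (fun t _ => (hasDerivAt_pEval_greatCircle hx hu hxu G t).hasDerivWithinAt) (fun t ht => by
      refine (abs_sum_mul_le_sum_abs hx hu _).trans (hF _ (norm_greatCircle hx hu hxu t) ?_)
      exact (norm_greatCircle_sub_le hx hu hxu t).trans ((abs_of_nonneg ht.1).trans_le ht.2.le))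
    T (right_mem_Icc.2 hT)
  simpa using h

theorem exists_greatCircle_eq {x y : EuclideanSpace ℝ (Fin d)} (hx : ‖x‖ = 1) (hy : ‖y‖ = 1)
    (hxy : x ≠ y) (h1 : ‖y - x‖ ≤ 1) :
    ∃ u T, ‖u‖ = 1 ∧ inner ℝ x u = 0 ∧ 0 ≤ T ∧ T ≤ 2 * ‖y - x‖ ∧ greatCircle x u T = y := by
  set c := inner ℝ x y with hc
  have e1 : ‖y - x‖ ^ 2 = 2 - 2 * c := by
    rw [norm_sub_sq_real, hx, hy, real_inner_comm]; ring
  have hpos : 0 < ‖y - x‖ := norm_pos_iff.2 (sub_ne_zero.2 hxy.symm)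
  have hc1 : c < 1 := by nlinarith
  have hc2 : 0 ≤ c := by nlinarith
  have hs : 0 < Real.sqrt (1 - c ^ 2) := Real.sqrt_pos.2 (by nlinarith)
  have hs2 : Real.sqrt (1 - c ^ 2) ^ 2 = 1 - c ^ 2 := Real.sq_sqrt (by nlinarith)
  refine ⟨(Real.sqrt (1 - c ^ 2))⁻¹ • (y - c • x), Real.arccos c, ?_, ?_,
    Real.arccos_nonneg c, ?_, ?_⟩
  · rw [← sq_eq_sq₀ (norm_nonneg _) zero_le_one, norm_smul, mul_pow, norm_sub_sq_real, norm_smul,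
      inner_smul_right, real_inner_comm, ← hc, hx, hy, norm_inv, inv_pow, Real.norm_eq_abs, sq_abs,
      hs2]
    have : 1 - c ^ 2 ≠ 0 := by nlinarith
    field_simp
    rw [Real.norm_eq_abs, sq_abs]
    ring
  · rw [inner_smul_right, inner_sub_right, inner_smul_right, real_inner_self_eq_norm_sq, hx, ← hc]
    ring
  · have h2 := Real.cos_le_one_sub_mul_cos_sq (x := Real.arccos c)
      (by rw [abs_of_nonneg (Real.arccos_nonneg c)]; exact Real.arccos_le_pi c)
    rw [Real.cos_arccos (by linarith) hc1.le] at h2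
    have h3 := Real.pi_pos
    have h4 := Real.pi_le_four
    have h5 : 2 / Real.pi ^ 2 ≥ 1 / 8 := by
      rw [ge_iff_le, div_le_div_iff₀ (by norm_num) (by positivity)]
      nlinarith
    have h6 := mul_le_mul_of_nonneg_right h5 (sq_nonneg (Real.arccos c))
    rw [← sq_le_sq₀ (Real.arccos_nonneg c) (by positivity)]
    nlinarith
  · rw [greatCircle, Real.cos_arccos (by linarith) hc1.le, Real.sin_arccos, smul_smul,
      mul_inv_cancel₀ hs.ne', one_smul]
    abel

/-- Oscillation of a polynomial on the sphere. -/
theorem abs_pEval_sub_le {x y : EuclideanSpace ℝ (Fin d)} (hx : ‖x‖ = 1) (hy : ‖y‖ = 1)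
    (G : MvPolynomial (Fin d) ℝ) {l F : ℝ} (hl : ‖y - x‖ ≤ l) (hl1 : l ≤ 1)
    (hF : ∀ z, ‖z‖ = 1 → ‖z - x‖ ≤ 2 * l → angNorm G z ≤ F) :
    |pEval G y - pEval G x| ≤ F * (2 * l) := by
  have hl0 : 0 ≤ l := (norm_nonneg _).trans hl
  have hF0 : 0 ≤ F := (angNorm_nonneg G x).trans (hF x hx (by simpa using hl0))
  rcases eq_or_ne x y with rfl | hxy
  · simp only [sub_self, abs_zero]; positivity
  obtain ⟨u, T, hu, hxu, hT, hT2, rfl⟩ := exists_greatCircle_eq hx hy hxy (hl.trans hl1)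
  exact (abs_pEval_greatCircle_sub_le hx hu hxu G hT fun z hz hzx =>
    hF z hz (by linarith)).trans (by gcongr; linarith)

/-- The exponential map of the unit sphere. -/
def sphExp (x U : EuclideanSpace ℝ (Fin d)) : EuclideanSpace ℝ (Fin d) :=
  greatCircle x (‖U‖⁻¹ • U) ‖U‖

theorem norm_sphExp {x U : EuclideanSpace ℝ (Fin d)} (hx : ‖x‖ = 1) (hxU : inner ℝ x U = 0) :
    ‖sphExp x U‖ = 1 := by
  rcases eq_or_ne U 0 with rfl | hU
  · simpa [sphExp] using hx
  · exact norm_greatCircle hx (norm_smul_inv_norm hU) (by rw [inner_smul_right, hxU, mul_zero]) _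

theorem norm_sphExp_sub_le {x U : EuclideanSpace ℝ (Fin d)} (hx : ‖x‖ = 1)
    (hxU : inner ℝ x U = 0) : ‖sphExp x U - x‖ ≤ ‖U‖ := by
  rcases eq_or_ne U 0 with rfl | hU
  · simp [sphExp]
  · exact (norm_greatCircle_sub_le hx (norm_smul_inv_norm hU)
      (by rw [inner_smul_right, hxU, mul_zero]) _).trans (abs_norm U).le

theorem norm_sphExp_sub_sub_le {x U : EuclideanSpace ℝ (Fin d)} (hx : ‖x‖ = 1) (hU1 : ‖U‖ ≤ 1) :
    ‖sphExp x U - x - U‖ ≤ ‖U‖ ^ 2 := by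
  rcases eq_or_ne U 0 with rfl | hU
  · simp [sphExp]
  have hU0 : 0 < ‖U‖ := norm_pos_iff.2 hU
  have h1 : sphExp x U - x - U = (Real.cos ‖U‖ - 1) • x +
      (Real.sin ‖U‖ - ‖U‖) • (‖U‖⁻¹ • U) := by
    rw [sphExp, greatCircle, sub_smul, sub_smul, smul_smul ‖U‖, mul_inv_cancel₀ hU0.ne', one_smul,
      one_smul]
    abel
  rw [h1]
  refine (norm_add_le _ _).trans ?_
  rw [norm_smul, norm_smul, hx, show ‖‖U‖⁻¹ • U‖ = 1 from norm_smul_inv_norm hU, mul_one, mul_one,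
    Real.norm_eq_abs, Real.norm_eq_abs, abs_sub_comm, abs_sub_comm (Real.sin _)]
  have h2 := Real.one_sub_sq_div_two_le_cos (x := ‖U‖)
  have h3 := Real.sin_gt_sub_cube hU0
  have h4 := Real.sin_le hU0.le
  have h5 := Real.cos_le_one ‖U‖
  rw [abs_of_nonneg (by linarith), abs_of_nonneg (by linarith)]
  nlinarith [mul_le_mul_of_nonneg_left hU1 (sq_nonneg ‖U‖)]

/-- Second order Taylor expansion of a polynomial along the sphere. -/
theorem abs_pEval_sphExp_sub_sub_le {x U : EuclideanSpace ℝ (Fin d)} (hx : ‖x‖ = 1)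
    (hxU : inner ℝ x U = 0) (G : MvPolynomial (Fin d) ℝ) {F : ℝ}
    (hF : ∀ y, ‖y‖ = 1 → ‖y - x‖ ≤ ‖U‖ → angNormTwo G y ≤ F) :
    |pEval G (sphExp x U) - pEval G x - ∑ k, U k * pEval (MvPolynomial.pderiv k G) x| ≤
      F * ‖U‖ ^ 2 := by
  rcases eq_or_ne U 0 with rfl | hU
  · simp [sphExp]
  have hU0 : 0 < ‖U‖ := norm_pos_iff.2 hU
  set u := ‖U‖⁻¹ • U with hu'
  set T := ‖U‖ with hT
  have hu : ‖u‖ = 1 := norm_smul_inv_norm hU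
  have hxu : inner ℝ x u = 0 := by rw [inner_smul_right, hxU, mul_zero]
  set g' : ℝ → ℝ := fun t =>
    ∑ p : Fin d × Fin d, x p.1 * u p.2 * pEval (angDeriv p.1 p.2 G) (greatCircle x u t) with hg'
  have hg : ∀ t, HasDerivAt (fun s => pEval G (greatCircle x u s)) (g' t) t :=
    hasDerivAt_pEval_greatCircle hx hu hxu G
  have hmem : ∀ t ∈ Icc 0 T, ‖greatCircle x u t - x‖ ≤ T := fun t ht =>
    (norm_greatCircle_sub_le hx hu hxu t).trans ((abs_of_nonneg ht.1).trans_le ht.2)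
  have hF0 : 0 ≤ F := (angNormTwo_nonneg G x).trans (hF x hx (by simp [hU0.le]))
  have h2 : ∀ t ∈ Icc 0 T, |g' t - g' 0| ≤ F * T := by
    intro t ht
    have h := norm_image_sub_le_of_norm_deriv_le_segment' (a := 0) (b := T) (C := F) (f := g')
      (f' := fun t => ∑ p : Fin d × Fin d, x p.1 * u p.2 * ∑ p' : Fin d × Fin d,
        x p'.1 * u p'.2 * pEval (angDeriv p'.1 p'.2 (angDeriv p.1 p.2 G)) (greatCircle x u t))
      (fun t _ => (HasDerivAt.fun_sum fun p _ =>
        (hasDerivAt_pEval_greatCircle hx hu hxu _ t).const_mul _).hasDerivWithinAt)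
      (fun t ht => by
        refine (abs_sum_mul_le_sum_abs hx hu _).trans (le_trans ?_
          (hF _ (norm_greatCircle hx hu hxu t) (hmem t ⟨ht.1, ht.2.le⟩)))
        exact Finset.sum_le_sum fun p _ => abs_sum_mul_le_sum_abs hx hu _)
      t ht
    refine (h.trans ?_)
    gcongr
    linarith [ht.2]
  have h3 := norm_image_sub_le_of_norm_deriv_le_segment' (a := 0) (b := T) (C := F * T)
    (f := fun s => pEval G (greatCircle x u s) - s * g' 0) (f' := fun t => g' t - g' 0)
    (fun t _ => by
      have := (hg t).fun_sub ((hasDerivAt_id t).mul_const (g' 0))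
      simpa using this.hasDerivWithinAt)
    (fun t ht => h2 t ⟨ht.1, ht.2.le⟩) T (right_mem_Icc.2 hU0.le)
  have h4 : T * g' 0 = ∑ k, U k * pEval (MvPolynomial.pderiv k G) x := by
    have h5 := hasDerivAt_pEval G (γ := greatCircle x u) (γ' := fun k => u k) (t := 0) fun k => by
      have := ((Real.hasDerivAt_cos 0).mul_const (x k)).fun_add
        ((Real.hasDerivAt_sin 0).mul_const (u k))
      simpa [greatCircle] using this
    rw [(hg 0).unique h5, Finset.mul_sum, greatCircle_zero]
    refine Finset.sum_congr rfl fun k _ => ?_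
    rw [hu', PiLp.smul_apply, smul_eq_mul]
    field_simp
  rw [← h4]
  simp only [greatCircle_zero, zero_mul, sub_zero, Real.norm_eq_abs] at h3
  calc _ = |pEval G (greatCircle x u T) - T * g' 0 - pEval G x| := by
        rw [sphExp, ← hu', ← hT, sub_right_comm]
    _ ≤ F * T * T := h3
    _ = _ := by ring

/-- The rotational vector field `x_i e_k - x_k e_i`. -/
def rotField (i k : Fin d) (x : EuclideanSpace ℝ (Fin d)) : EuclideanSpace ℝ (Fin d) :=
  x i • EuclideanSpace.single k 1 - x k • EuclideanSpace.single i 1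

theorem inner_rotField (i k : Fin d) (x : EuclideanSpace ℝ (Fin d)) :
    inner ℝ x (rotField i k x) = 0 := by
  rw [rotField, inner_sub_right, inner_smul_right, inner_smul_right]
  simp [EuclideanSpace.inner_single_right]
  ring

theorem norm_rotField_le (i k : Fin d) (x : EuclideanSpace ℝ (Fin d)) :
    ‖rotField i k x‖ ≤ 2 * ‖x‖ := by
  refine (norm_sub_le _ _).trans ?_
  rw [norm_smul, norm_smul]
  have h1 := PiLp.norm_apply_le x i
  have h2 := PiLp.norm_apply_le x k
  simp
  simp at h1 h2
  linarith

theorem rotField_sub (i k : Fin d) (x y : EuclideanSpace ℝ (Fin d)) :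
    rotField i k (x - y) = rotField i k x - rotField i k y := by
  simp only [rotField, PiLp.sub_apply, sub_smul]
  abel

theorem sum_rotField_mul_pEval (i k : Fin d) (G : MvPolynomial (Fin d) ℝ)
    (x : EuclideanSpace ℝ (Fin d)) :
    ∑ l, rotField i k x l * pEval (MvPolynomial.pderiv l G) x = pEval (angDeriv i k G) x := by
  rw [pEval_angDeriv]
  simp [rotField, sub_mul, Finset.sum_sub_distrib]

theorem card_le_of_separated {V : Finset (EuclideanSpace ℝ (Fin d))} {x : EuclideanSpace ℝ (Fin d)}
    {R s : ℝ} (hs : 0 < s) (hR : 0 ≤ R) (hV : ∀ v ∈ V, dist v x ≤ R)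
    (hsep : ∀ v ∈ V, ∀ w ∈ V, v ≠ w → s ≤ dist v w) : (V.card : ℝ) ≤ (1 + 2 * R / s) ^ d := by
  have h1 : ∑ v ∈ V, volume (Metric.ball v (s / 2)) ≤ volume (Metric.ball x (R + s / 2)) := by
    rw [← measure_biUnion_finset]
    · refine measure_mono (iUnion₂_subset fun v hv => ?_)
      exact Metric.ball_subset_ball' (by linarith [hV v hv])
    · intro v hv w hw hvw
      exact Metric.ball_disjoint_ball (by linarith [hsep v hv w hw hvw])
    · exact fun v _ => measurableSet_ball
  have h2 : ∀ v : EuclideanSpace ℝ (Fin d), ∀ ρ : ℝ, 0 < ρ → volume (Metric.ball v ρ) =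
      ENNReal.ofReal (ρ ^ d) * volume (Metric.ball (0 : EuclideanSpace ℝ (Fin d)) 1) := by
    intro v ρ hρ
    rw [Measure.addHaar_ball_of_pos _ _ hρ, finrank_euclideanSpace_fin]
  rw [h2 x _ (by positivity), Finset.sum_congr rfl fun v _ => h2 v _ (by positivity),
    Finset.sum_const, nsmul_eq_mul, ← mul_assoc] at h1
  have h3 : volume (Metric.ball (0 : EuclideanSpace ℝ (Fin d)) 1) ≠ 0 :=
    (Metric.measure_ball_pos _ _ one_pos).ne'
  have h4 : volume (Metric.ball (0 : EuclideanSpace ℝ (Fin d)) 1) ≠ ⊤ := measure_ball_lt_top.ne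
  rw [ENNReal.mul_le_mul_iff_left h3 h4, ← ENNReal.ofReal_natCast, ← ENNReal.ofReal_mul (by simp),
    ENNReal.ofReal_le_ofReal_iff (by positivity)] at h1
  have h5 : 1 + 2 * R / s = (R + s / 2) / (s / 2) := by field_simp; ring
  rw [h5, div_pow, le_div_iff₀ (by positivity)]
  exact h1

theorem exists_maximal_separated {A : Set (EuclideanSpace ℝ (Fin d))}
    (hA : A ⊆ Metric.closedBall 0 1) {s : ℝ} (hs : 0 < s) :
    ∃ V : Finset (EuclideanSpace ℝ (Fin d)), (∀ v ∈ V, v ∈ A) ∧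
      (∀ v ∈ V, ∀ w ∈ V, v ≠ w → s ≤ dist v w) ∧ ∀ x ∈ A, ∃ v ∈ V, dist x v < s := by
  classical
  let p : ℕ → Prop := fun k => ∃ V : Finset (EuclideanSpace ℝ (Fin d)), V.card = k ∧
    (∀ v ∈ V, v ∈ A) ∧ (∀ v ∈ V, ∀ w ∈ V, v ≠ w → s ≤ dist v w)
  have hb : ∀ k, p k → k ≤ ⌈(1 + 2 * 1 / s) ^ d⌉₊ := by
    rintro k ⟨V, rfl, hVA, hsep⟩
    have := card_le_of_separated (x := 0) hs zero_le_one (fun v hv => hA (hVA v hv)) hsep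
    exact_mod_cast this.trans (Nat.le_ceil _)
  have h0 : p 0 := ⟨∅, rfl, by simp, by simp⟩
  obtain ⟨V, hk, hVA, hsep⟩ := Nat.findGreatest_spec (P := p) (Nat.zero_le _) h0
  refine ⟨V, hVA, hsep, fun x hx => ?_⟩
  by_contra! hcon
  have hxV : x ∉ V := fun h => by
    have := hcon x h
    rw [dist_self] at this
    linarith
  have h1 : p (V.card + 1) := by
    refine ⟨insert x V, Finset.card_insert_of_notMem hxV, ?_, ?_⟩
    · intro v hv
      rcases Finset.mem_insert.1 hv with rfl | hv
      · exact hx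
      · exact hVA v hv
    · intro v hv w hw hvw
      rcases Finset.mem_insert.1 hv with hv | hv <;> rcases Finset.mem_insert.1 hw with hw | hw
      · exact absurd (hv.trans hw.symm) hvw
      · exact hv ▸ hcon w hw
      · rw [dist_comm]
        exact hw ▸ hcon v hv
      · exact hsep v hv w hw hvw
  have h2 := Nat.le_findGreatest (hb _ h1) h1
  rw [← hk] at h2
  omega

/-- The closed upper half of the unit sphere. -/
def upSphere (d : ℕ) : Set (EuclideanSpace ℝ (Fin (d + 1))) :=
  {x | ‖x‖ = 1 ∧ 0 ≤ x (Fin.last d)}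

/-- Reflection of the lower half space onto the upper one. -/
def foldLast (x : EuclideanSpace ℝ (Fin (d + 1))) : EuclideanSpace ℝ (Fin (d + 1)) :=
  WithLp.toLp 2 (Fin.lastCases |x (Fin.last d)| fun i => x i.castSucc)

@[simp] theorem foldLast_last (x : EuclideanSpace ℝ (Fin (d + 1))) :
    foldLast x (Fin.last d) = |x (Fin.last d)| := by simp [foldLast]

@[simp] theorem foldLast_castSucc (x : EuclideanSpace ℝ (Fin (d + 1))) (i : Fin d) :
    foldLast x i.castSucc = x i.castSucc := by simp [foldLast]

theorem norm_foldLast (x : EuclideanSpace ℝ (Fin (d + 1))) : ‖foldLast x‖ = ‖x‖ := by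
  rw [← sq_eq_sq₀ (norm_nonneg _) (norm_nonneg _), EuclideanSpace.real_norm_sq_eq,
    EuclideanSpace.real_norm_sq_eq, Fin.sum_univ_castSucc, Fin.sum_univ_castSucc]
  simp

theorem foldLast_mem {x : EuclideanSpace ℝ (Fin (d + 1))} (hx : ‖x‖ = 1) :
    foldLast x ∈ upSphere d := ⟨by rw [norm_foldLast, hx], by simp⟩

theorem sq_dist_eq (x y : EuclideanSpace ℝ (Fin (d + 1))) : dist x y ^ 2 =
    ∑ i : Fin d, (x i.castSucc - y i.castSucc) ^ 2 + (x (Fin.last d) - y (Fin.last d)) ^ 2 := by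
  rw [dist_eq_norm, EuclideanSpace.real_norm_sq_eq, Fin.sum_univ_castSucc]
  simp

theorem dist_foldLast_le (x : EuclideanSpace ℝ (Fin (d + 1))) {y : EuclideanSpace ℝ (Fin (d + 1))}
    (hy : 0 ≤ y (Fin.last d)) : dist (foldLast x) y ≤ dist x y := by
  rw [← sq_le_sq₀ dist_nonneg dist_nonneg, sq_dist_eq, sq_dist_eq]
  simp only [foldLast_castSucc, foldLast_last]
  refine add_le_add_right ?_ _
  rw [sq_le_sq]
  simpa [abs_of_nonneg hy] using abs_abs_sub_abs_le (x (Fin.last d)) (y (Fin.last d))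

theorem dist_foldLast_foldLast {x y : EuclideanSpace ℝ (Fin (d + 1))}
    (hxy : 0 ≤ x (Fin.last d) ↔ 0 ≤ y (Fin.last d)) :
    dist (foldLast x) (foldLast y) = dist x y := by
  rw [← sq_eq_sq₀ dist_nonneg dist_nonneg, sq_dist_eq, sq_dist_eq]
  simp only [foldLast_castSucc, foldLast_last]
  congr 1
  rcases le_or_gt 0 (x (Fin.last d)) with h | h
  · rw [abs_of_nonneg h, abs_of_nonneg (hxy.1 h)]
  · have h' : y (Fin.last d) < 0 := not_le.1 fun h' => not_le.2 h (hxy.2 h')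
    rw [abs_of_neg h, abs_of_neg h']
    ring

/-- Regard a polynomial in `d` variables as one in `d + 1` variables. -/
def liftPoly (P : MvPolynomial (Fin d) ℝ) : MvPolynomial (Fin (d + 1)) ℝ :=
  MvPolynomial.rename Fin.castSucc P

theorem totalDegree_liftPoly_le (P : MvPolynomial (Fin d) ℝ) :
    (liftPoly P).totalDegree ≤ P.totalDegree := MvPolynomial.totalDegree_rename_le _ _

/-- Forget the last coordinate. -/
def projInit (x : EuclideanSpace ℝ (Fin (d + 1))) : EuclideanSpace ℝ (Fin d) :=
  WithLp.toLp 2 fun i => x i.castSucc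

@[simp] theorem projInit_apply (x : EuclideanSpace ℝ (Fin (d + 1))) (i : Fin d) :
    projInit x i = x i.castSucc := rfl

theorem pEval_liftPoly (P : MvPolynomial (Fin d) ℝ) (x : EuclideanSpace ℝ (Fin (d + 1))) :
    pEval (liftPoly P) x = pEval P (projInit x) := by
  rw [pEval, liftPoly, MvPolynomial.eval_rename]
  rfl

theorem pderiv_castSucc_liftPoly (P : MvPolynomial (Fin d) ℝ) (i : Fin d) :
    MvPolynomial.pderiv i.castSucc (liftPoly P) = liftPoly (MvPolynomial.pderiv i P) :=
  MvPolynomial.pderiv_rename (Fin.castSucc_injective d) i P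

theorem pderiv_last_liftPoly (P : MvPolynomial (Fin d) ℝ) :
    MvPolynomial.pderiv (Fin.last d) (liftPoly P) = 0 := by
  classical
  refine MvPolynomial.pderiv_eq_zero_of_notMem_vars fun h => ?_
  obtain ⟨i, -, hi⟩ := Finset.mem_image.1 (MvPolynomial.vars_rename _ _ h)
  exact (Fin.castSucc_lt_last i).ne hi

theorem projInit_foldLast (x : EuclideanSpace ℝ (Fin (d + 1))) :
    projInit (foldLast x) = projInit x := by
  ext i
  simp

theorem angNorm_liftPoly_foldLast (P : MvPolynomial (Fin d) ℝ)
    (x : EuclideanSpace ℝ (Fin (d + 1))) :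
    angNorm (liftPoly P) (foldLast x) = angNorm (liftPoly P) x := by
  refine Finset.sum_congr rfl fun p _ => ?_
  obtain ⟨i, j⟩ := p
  have h0 : ∀ y : EuclideanSpace ℝ (Fin (d + 1)), pEval 0 y = 0 := fun y => by simp [pEval]
  simp only [pEval_angDeriv]
  refine Fin.lastCases ?_ (fun i => ?_) i <;> refine Fin.lastCases ?_ (fun j => ?_) j <;>
    simp [pderiv_castSucc_liftPoly, pderiv_last_liftPoly, pEval_liftPoly, projInit_foldLast, h0,
      abs_mul]

/-- A finite `2 r`-separated subset of the half sphere away from the equator, `10 r`-dense in it. -/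
structure IsNet (V : Finset (EuclideanSpace ℝ (Fin (d + 1)))) (r : ℝ) : Prop where
  norm_eq : ∀ v ∈ V, ‖v‖ = 1
  le_last : ∀ v ∈ V, 2 * r ≤ v (Fin.last d)
  sep : ∀ v ∈ V, ∀ w ∈ V, v ≠ w → 2 * r ≤ dist v w
  cover : ∀ x ∈ upSphere d, ∃ v ∈ V, dist x v ≤ 10 * r

theorem IsNet.mem {V : Finset (EuclideanSpace ℝ (Fin (d + 1)))} {r : ℝ} (h : IsNet V r)
    (hr : 0 ≤ r) {v : EuclideanSpace ℝ (Fin (d + 1))} (hv : v ∈ V) : v ∈ upSphere d :=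
  ⟨h.norm_eq v hv, by linarith [h.le_last v hv]⟩

theorem exists_isNet {r : ℝ} (hr : 0 < r) (hr1 : r ≤ 1 / 4) :
    ∃ V : Finset (EuclideanSpace ℝ (Fin (d + 1))), IsNet V r := by
  obtain ⟨V, hVA, hsep, hcov⟩ := exists_maximal_separated
    (A := {x : EuclideanSpace ℝ (Fin (d + 1)) | ‖x‖ = 1 ∧ 2 * r ≤ x (Fin.last d)})
    (fun x hx => by simp [hx.1]) (s := 2 * r) (by positivity)
  refine ⟨V, fun v hv => (hVA v hv).1, fun v hv => (hVA v hv).2, hsep, fun x hx => ?_⟩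
  set e : EuclideanSpace ℝ (Fin (d + 1)) := EuclideanSpace.single (Fin.last d) 1 with he
  have he1 : ‖e‖ = 1 := by simp [e]
  set u := x + (4 * r) • e with hu
  have hu2 : 1 ≤ ‖u‖ ^ 2 := by
    rw [hu, norm_add_sq_real, hx.1, inner_smul_right, he]
    simp only [EuclideanSpace.inner_single_right]
    have := hx.2
    simp only [conj_trivial, one_mul, ge_iff_le]
    nlinarith [mul_nonneg hr.le this, sq_nonneg ‖(4 * r) • e‖]
  have hu1 : 1 ≤ ‖u‖ := by nlinarith [norm_nonneg u]
  have hu3 : ‖u‖ ≤ 1 + 4 * r := by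
    refine (norm_add_le _ _).trans ?_
    rw [norm_smul, he1, hx.1, Real.norm_eq_abs, abs_of_pos (by positivity), mul_one]
  have hu0 : u ≠ 0 := fun h => by rw [h, norm_zero] at hu1; linarith
  obtain ⟨v, hv, hvd⟩ := hcov (‖u‖⁻¹ • u) ⟨norm_smul_inv_norm hu0, by
    rw [PiLp.smul_apply, smul_eq_mul, ← div_eq_inv_mul, le_div_iff₀ (by linarith), hu]
    have h1 : (x + (4 * r) • e) (Fin.last d) = x (Fin.last d) + 4 * r := by simp [e]
    rw [h1]
    nlinarith [hx.2]⟩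
  refine ⟨v, hv, ?_⟩
  have h2 : dist x u ≤ 4 * r := by
    rw [dist_eq_norm, hu, sub_add_cancel_left, norm_neg, norm_smul, he1, Real.norm_eq_abs,
      abs_of_pos (by positivity), mul_one]
  have h3 : dist u (‖u‖⁻¹ • u) ≤ 4 * r := by
    have h4 : u - ‖u‖⁻¹ • u = (‖u‖ - 1) • (‖u‖⁻¹ • u) := by
      rw [sub_smul, smul_smul, mul_inv_cancel₀ (by linarith), one_smul, one_smul]
    rw [dist_eq_norm, h4, norm_smul, show ‖‖u‖⁻¹ • u‖ = 1 from norm_smul_inv_norm hu0, mul_one,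
      Real.norm_eq_abs,
      abs_of_nonneg (by linarith)]
    linarith
  have h5 := dist_triangle4 x u (‖u‖⁻¹ • u) v
  linarith

/-- A probability measure on the upper half sphere with doubling constant `2 ^ s`. -/
structure HalfDoubling (s : ℕ) (ω : Measure (EuclideanSpace ℝ (Fin (d + 1)))) : Prop where
  prob : IsProbabilityMeasure ω
  supp : ω (upSphere d)ᶜ = 0
  doub : ∀ x ∈ upSphere d, ∀ r : ℝ, 0 < r →
    ω.real (Metric.closedBall x (2 * r)) ≤ 2 ^ s * ω.real (Metric.closedBall x r)

namespace HalfDoubling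

variable {s : ℕ} {ω : Measure (EuclideanSpace ℝ (Fin (d + 1)))}

theorem real_mono (h : HalfDoubling s ω)
    {A B : Set (EuclideanSpace ℝ (Fin (d + 1)))} (hAB : A ⊆ B) :
    ω.real A ≤ ω.real B :=
  have := h.prob
  measureReal_mono hAB

theorem mass_le (h : HalfDoubling s ω) {x : EuclideanSpace ℝ (Fin (d + 1))} (hx : x ∈ upSphere d)
    {r R : ℝ} (hr : 0 < r) (hrR : r ≤ R) :
    ω.real (Metric.closedBall x R) ≤ (2 * R / r) ^ s * ω.real (Metric.closedBall x r) := by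
  have h1 : ∀ k : ℕ, ω.real (Metric.closedBall x (2 ^ k * r)) ≤
      (2 ^ k) ^ s * ω.real (Metric.closedBall x r) := by
    intro k
    induction k with
    | zero => simp
    | succ k ih =>
      have h2 := h.doub x hx (2 ^ k * r) (by positivity)
      calc ω.real (Metric.closedBall x (2 ^ (k + 1) * r))
          = ω.real (Metric.closedBall x (2 * (2 ^ k * r))) := by ring_nf
        _ ≤ 2 ^ s * ((2 ^ k) ^ s * ω.real (Metric.closedBall x r)) := h2.trans (by gcongr)
        _ = _ := by rw [← mul_assoc, ← mul_pow, pow_succ' 2 k]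
  obtain ⟨k, hk1, hk2⟩ := exists_nat_pow_near (x := R / r) (y := 2)
    ((one_le_div hr).2 hrR) one_lt_two
  refine (h.real_mono (Metric.closedBall_subset_closedBall ?_)).trans ((h1 (k + 1)).trans ?_)
  · exact ((div_lt_iff₀ hr).1 hk2).le
  · gcongr
    rw [pow_succ', mul_div_assoc]
    gcongr

theorem mass_le_of_dist_le (h : HalfDoubling s ω) {x y : EuclideanSpace ℝ (Fin (d + 1))}
    (hy : y ∈ upSphere d) {r R T : ℝ} (hr : 0 < r) (hxy : dist x y + R ≤ T) (hrT : r ≤ T) :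
    ω.real (Metric.closedBall x R) ≤ (2 * T / r) ^ s * ω.real (Metric.closedBall y r) :=
  (h.real_mono (Metric.closedBall_subset_closedBall' (by linarith))).trans (h.mass_le hy hr hrT)

theorem real_eq_one (h : HalfDoubling s ω) {A : Set (EuclideanSpace ℝ (Fin (d + 1)))}
    (hA : upSphere d ⊆ A) : ω.real A = 1 := by
  have := h.prob
  have h1 : ω Aᶜ = 0 := measure_mono_null (compl_subset_compl.2 hA) h.supp
  have h2 : ω A = 1 := le_antisymm prob_le_one (by
    have h3 := measure_union_le (μ := ω) A Aᶜ
    rwa [union_compl_self, measure_univ, h1, add_zero] at h3)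
  rw [measureReal_def, h2, ENNReal.toReal_one]

theorem mass_pos (h : HalfDoubling s ω) {x : EuclideanSpace ℝ (Fin (d + 1))} (hx : x ∈ upSphere d)
    {r : ℝ} (hr : 0 < r) : 0 < ω.real (Metric.closedBall x r) := by
  have h1 : ω.real (Metric.closedBall x (max r 2)) = 1 := h.real_eq_one fun y hy => by
    rw [Metric.mem_closedBall, dist_eq_norm]
    refine ((norm_sub_le _ _).trans ?_).trans (le_max_right _ _)
    rw [hx.1, hy.1]
    norm_num
  have h2 := h.mass_le hx hr (le_max_left r 2)
  rw [h1] at h2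
  by_contra! h3
  have h4 : ω.real (Metric.closedBall x r) = 0 := le_antisymm h3 measureReal_nonneg
  rw [h4, mul_zero] at h2
  linarith

end HalfDoubling

/-- Supremum of `f` over a spherical cap. -/
def sphSup (f : EuclideanSpace ℝ (Fin d) → ℝ) (x : EuclideanSpace ℝ (Fin d)) (r : ℝ) : ℝ :=
  sSup (f '' (Metric.sphere 0 1 ∩ Metric.closedBall x r))

theorem isCompact_cap (x : EuclideanSpace ℝ (Fin d)) (r : ℝ) :
    IsCompact (Metric.sphere 0 1 ∩ Metric.closedBall x r) :=
  (isCompact_sphere _ _).inter_right Metric.isClosed_closedBall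

theorem le_sphSup {f : EuclideanSpace ℝ (Fin d) → ℝ} (hf : Continuous f)
    {x y : EuclideanSpace ℝ (Fin d)} {r : ℝ} (hy : ‖y‖ = 1) (hyx : dist y x ≤ r) :
    f y ≤ sphSup f x r :=
  le_csSup ((isCompact_cap x r).bddAbove_image hf.continuousOn)
    (mem_image_of_mem f ⟨by simpa using hy, hyx⟩)

theorem exists_eq_sphSup {f : EuclideanSpace ℝ (Fin d) → ℝ} (hf : Continuous f)
    {x : EuclideanSpace ℝ (Fin d)} {r : ℝ} (hx : ‖x‖ = 1) (hr : 0 ≤ r) :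
    ∃ y, ‖y‖ = 1 ∧ dist y x ≤ r ∧ f y = sphSup f x r := by
  have h1 := (isCompact_cap x r).image_of_continuousOn hf.continuousOn
  obtain ⟨y, hy, hy2⟩ := h1.sSup_mem ⟨f x, mem_image_of_mem f ⟨by simpa using hx, by simpa⟩⟩
  exact ⟨y, by simpa using hy.1, hy.2, hy2⟩

theorem sum_comp_le_card_mul_sum {α β : Type*} [DecidableEq β] {A : Finset α} {B : Finset β}
    {g : α → β} {f : β → ℝ} {M : ℝ} (hg : ∀ a ∈ A, g a ∈ B) (hf : ∀ b ∈ B, 0 ≤ f b)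
    (hM : ∀ b ∈ B, ((A.filter fun a => g a = b).card : ℝ) ≤ M) :
    ∑ a ∈ A, f (g a) ≤ M * ∑ b ∈ B, f b := by
  rw [← Finset.sum_fiberwise_of_maps_to' hg, Finset.mul_sum]
  refine Finset.sum_le_sum fun b hb => ?_
  rw [Finset.sum_const, nsmul_eq_mul]
  exact mul_le_mul_of_nonneg_right (hM b hb) (hf b hb)

theorem IsNet.card_le_of_dist_le {V A : Finset (EuclideanSpace ℝ (Fin (d + 1)))} {r R : ℝ}
    (h : IsNet V r) (hr : 0 < r) (hR : 0 ≤ R) (hA : A ⊆ V)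
    (hAR : ∀ v ∈ A, ∀ w ∈ A, dist v w ≤ R) : (A.card : ℝ) ≤ (1 + R / r) ^ (d + 1) := by
  rcases A.eq_empty_or_nonempty with rfl | ⟨x, hx⟩
  · simp only [Finset.card_empty, CharP.cast_eq_zero]
    positivity
  have h1 := card_le_of_separated (V := A) (x := x) (s := 2 * r) (by positivity) hR
    (fun v hv => hAR v hv x hx) fun v hv w hw hvw => h.sep v (hA hv) w (hA hw) hvw
  rwa [mul_div_mul_left _ _ (two_ne_zero' ℝ)] at h1

theorem sum_inv_sq_le_two (k : ℕ) : ∑ j ∈ Finset.range k, (1 / (1 + (j : ℝ))) ^ 2 ≤ 2 := by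
  suffices h : ∑ j ∈ Finset.range k, (1 / (1 + (j : ℝ))) ^ 2 ≤ 2 - 1 / (k : ℝ) by
    refine h.trans ?_
    rw [sub_le_self_iff]
    positivity
  induction k with
  | zero => norm_num
  | succ k ih =>
    rw [Finset.sum_range_succ]
    rcases k.eq_zero_or_pos with rfl | hk
    · norm_num
    have hk' : (0 : ℝ) < k := by exact_mod_cast hk
    have h2 : (1 / (1 + (k : ℝ))) ^ 2 ≤ 1 / k - 1 / ((k + 1 : ℕ) : ℝ) := by
      push_cast
      rw [div_sub_div _ _ hk'.ne' (by positivity), div_pow, div_le_div_iff₀ (by positivity)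
        (by positivity)]
      nlinarith
    linarith

theorem sum_inv_sq_le_four (m : ℕ) :
    ∑ j ∈ Finset.range (2 * m + 1), (1 / (1 + |(j : ℝ) - m|)) ^ 2 ≤ 4 := by
  rw [show 2 * m + 1 = m + (m + 1) by ring, Finset.sum_range_add]
  have h1 : ∑ j ∈ Finset.range m, (1 / (1 + |(j : ℝ) - m|)) ^ 2 ≤ 2 := by
    rw [← Finset.sum_range_reflect]
    refine (Finset.sum_le_sum fun j hj => ?_).trans (sum_inv_sq_le_two m)
    have hj := Finset.mem_range.1 hj
    rw [show m - 1 - j = m - (j + 1) by omega, Nat.cast_sub (by omega)]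
    gcongr
    push_cast
    rw [show (m : ℝ) - (j + 1) - m = -(j + 1) by ring, abs_neg, abs_of_pos (by positivity)]
    linarith
  have h2 : ∑ j ∈ Finset.range (m + 1), (1 / (1 + |((m + j : ℕ) : ℝ) - m|)) ^ 2 ≤ 2 := by
    refine (Finset.sum_le_sum fun j hj => ?_).trans (sum_inv_sq_le_two (m + 1))
    push_cast
    rw [add_sub_cancel_left, abs_of_nonneg (by positivity)]
  linarith

/-- A weighted `ℓ¹` Bernstein inequality for second angular derivatives. -/
theorem exists_bernstein_sum (d s : ℕ) : ∃ C : ℝ, 1 ≤ C ∧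
    ∀ ω : Measure (EuclideanSpace ℝ (Fin (d + 1))), HalfDoubling s ω → ∀ n : ℕ, 0 < n →
    ∀ V : Finset (EuclideanSpace ℝ (Fin (d + 1))), IsNet V (1 / (20 * n)) →
    ∀ P : MvPolynomial (Fin d) ℝ, P.totalDegree ≤ n →
      ∑ v ∈ V, ω.real (Metric.closedBall v (1 / n)) * sphSup (angNormTwo (liftPoly P)) v (3 / n) ≤
      C * n * ∑ v ∈ V, ω.real (Metric.closedBall v (1 / n)) *
        sphSup (angNorm (liftPoly P)) v (2 / n) := by
  classical
  set q := s + 1 with hq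
  set M : ℝ := 2 * 141 ^ (d + 1) with hM
  set c : ℝ := (q + 1) * ((2 * q + 3) ^ (2 * q) * 12 ^ s) * (4 * M) with hc
  refine ⟨max 1 (((d + 1) * (d + 1) : ℕ) * c), le_max_left _ _, fun ω hω n hn V hV P hP => ?_⟩
  have hn' : (0 : ℝ) < n := by exact_mod_cast hn
  set G := liftPoly P with hG
  have hGn : G.totalDegree ≤ n := (totalDegree_liftPoly_le P).trans hP
  obtain ⟨m, t, ht, hB⟩ := abs_pEval_angDeriv_le (d := d + 1) q hn
  have hVmem : ∀ v ∈ V, v ∈ upSphere d := fun v hv => hV.mem (by positivity) hv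
  choose! X hX1 hX2 hX3 using fun v (hv : v ∈ V) =>
    exists_eq_sphSup (continuous_angNormTwo G) (hV.norm_eq v hv) (r := 3 / n) (by positivity)
  choose! ν hν1 hν2 using hV.cover
  set μ : EuclideanSpace ℝ (Fin (d + 1)) → ℝ :=
    fun v => ω.real (Metric.closedBall v (1 / n)) with hμ
  set F : EuclideanSpace ℝ (Fin (d + 1)) → ℝ := fun v => sphSup (angNorm G) v (2 / n) with hF
  have hF0 : ∀ v ∈ V, 0 ≤ F v := fun v hv =>
    (angNorm_nonneg G v).trans (le_sphSup (continuous_angNorm G) (hV.norm_eq v hv)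
      (by rw [dist_self]; positivity))
  have hμ0 : ∀ v, 0 ≤ μ v := fun v => measureReal_nonneg
  set Y : Fin (d + 1) × Fin (d + 1) → ℕ → EuclideanSpace ℝ (Fin (d + 1)) →
    EuclideanSpace ℝ (Fin (d + 1)) := fun p j v => planeRot p.1 p.2 (t j) (X v) with hY
  have hYu : ∀ p : Fin (d + 1) × Fin (d + 1), p.1 ≠ p.2 → ∀ j, ∀ v ∈ V,
      foldLast (Y p j v) ∈ upSphere d := fun p hp j v hv =>
    foldLast_mem (by rw [hY, norm_planeRot hp, hX1 v hv])
  -- the derivatives at the rotated points are controlled at the nearby net points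
  have h1 : ∀ v ∈ V, sphSup (angNormTwo G) v (3 / n) ≤
      ∑ p : Fin (d + 1) × Fin (d + 1), if p.1 = p.2 then 0 else
        ((q + 1) * n : ℝ) * ∑ j ∈ Finset.range (2 * m + 1),
          ((2 * q + 3) / (1 + |(j : ℝ) - m|)) ^ (2 * q) * F (ν (foldLast (Y p j v))) := by
    intro v hv
    rw [← hX3 v hv, angNormTwo]
    simp only [angNorm]
    rw [Finset.sum_comm]
    refine Finset.sum_le_sum fun p _ => ?_
    split_ifs with hp
    · refine (Finset.sum_eq_zero fun p' _ => ?_).le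
      rw [pEval_angDeriv, hp, sub_self, abs_zero]
    refine (Finset.sum_le_sum fun p' _ => hB p.1 p.2 hp _
      ((totalDegree_angDeriv_le p'.1 p'.2 G).trans hGn) (X v)).trans ?_
    rw [← Finset.mul_sum, Finset.sum_comm]
    gcongr with j hj
    rw [← Finset.mul_sum]
    gcongr
    change angNorm G (Y p j v) ≤ _
    rw [hG, ← angNorm_liftPoly_foldLast]
    refine le_sphSup (continuous_angNorm _) (hYu p hp j v hv).1
      ((hν2 _ (hYu p hp j v hv)).trans ?_)
    rw [← mul_div_assoc, div_le_div_iff₀ (by positivity) (by positivity)]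
    nlinarith
  have h2 : ∀ p : Fin (d + 1) × Fin (d + 1), p.1 ≠ p.2 → ∀ j ∈ Finset.range (2 * m + 1), ∀ v ∈ V,
      μ v ≤ (12 * (1 + |(j : ℝ) - m|)) ^ s * μ (ν (foldLast (Y p j v))) := by
    intro p hp j hj v hv
    have hu := hYu p hp j v hv
    have e1 : dist v (ν (foldLast (Y p j v))) ≤ 3 / n + 4 * |(j : ℝ) - m| / n + 1 / n := by
      have e2 := dist_triangle4 v (X v) (Y p j v) (foldLast (Y p j v))
      have e2' := dist_triangle v (foldLast (Y p j v)) (ν (foldLast (Y p j v)))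
      have e3 := dist_foldLast_le (Y p j v) (hVmem v hv).2
      have e4 := dist_triangle (Y p j v) (X v) v
      have e5 := hX2 v hv
      have e6 := dist_planeRot_self_le hp (t j) (X v)
      rw [hX1 v hv, mul_one] at e6
      have e7 := ht j (Finset.mem_range.1 hj)
      have e8 := hν2 _ hu
      have e9 : 10 * (1 / (20 * n)) ≤ 1 / (n : ℝ) := by
        rw [← mul_div_assoc, div_le_div_iff₀ (by positivity) (by positivity)]
        nlinarith
      rw [dist_comm v (foldLast _)] at e2'
      linarith
    have e3 := hω.mass_le_of_dist_le (x := v) (y := ν (foldLast (Y p j v)))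
      (hVmem _ (hν1 _ hu)) (r := 1 / n) (R := 1 / n)
      (T := (5 + 4 * |(j : ℝ) - m|) / n) (by positivity) (by
        have : (5 + 4 * |(j : ℝ) - m|) / n = 3 / n + 4 * |(j : ℝ) - m| / n + 1 / n + 1 / n := by
          ring
        rw [this]
        linarith) (by gcongr; linarith [abs_nonneg ((j : ℝ) - m)])
    refine e3.trans ?_
    refine mul_le_mul_of_nonneg_right ?_ (hμ0 _)
    gcongr
    rw [← mul_div_assoc, div_div_div_cancel_right₀ hn'.ne', div_one]
    linarith [abs_nonneg ((j : ℝ) - m)]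
  -- bounded overlap
  have h3 : ∀ p : Fin (d + 1) × Fin (d + 1), p.1 ≠ p.2 → ∀ j,
      ∑ v ∈ V, μ (ν (foldLast (Y p j v))) * F (ν (foldLast (Y p j v))) ≤
        M * ∑ v ∈ V, μ v * F v := by
    intro p hp j
    refine sum_comp_le_card_mul_sum (g := fun v => ν (foldLast (Y p j v))) (f := fun v => μ v * F v)
      (fun v hv => hν1 _ (hYu p hp j v hv)) (fun v hv => mul_nonneg (hμ0 v) (hF0 v hv))
      fun b hb => ?_
    have key : ∀ A : Finset (EuclideanSpace ℝ (Fin (d + 1))), A ⊆ V →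
        (∀ v ∈ A, ν (foldLast (Y p j v)) = b) →
        (∀ v ∈ A, ∀ w ∈ A, 0 ≤ Y p j v (Fin.last d) ↔ 0 ≤ Y p j w (Fin.last d)) →
        (A.card : ℝ) ≤ 141 ^ (d + 1) := by
      intro A hAV hAb hAs
      have := hV.card_le_of_dist_le (A := A) (R := 7 / n) (by positivity) (by positivity) hAV
        fun v hv w hw => by
          have e1 := dist_triangle4 v (X v) (X w) w
          have e2 := hX2 v (hAV hv)
          have e3 := hX2 w (hAV hw)
          have e4 : dist (X v) (X w) ≤ 1 / n := by
            rw [← dist_planeRot hp (t j)]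
            change dist (Y p j v) (Y p j w) ≤ _
            rw [← dist_foldLast_foldLast (hAs v hv w hw)]
            have e5 := hν2 _ (hYu p hp j v (hAV hv))
            have e6 := hν2 _ (hYu p hp j w (hAV hw))
            rw [hAb v hv] at e5
            rw [hAb w hw] at e6
            have e7 := dist_triangle_right (foldLast (Y p j v)) (foldLast (Y p j w)) b
            have e9 : 10 * (1 / (20 * n)) + 10 * (1 / (20 * n)) = 1 / (n : ℝ) := by
              field_simp; norm_num
            linarith
          rw [dist_comm v (X v)] at e1
          have : (7 : ℝ) / n = 3 / n + 1 / n + 3 / n := by ring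
          linarith
      refine this.trans (le_of_eq ?_)
      congr 1
      field_simp
      norm_num
    rw [← Finset.card_filter_add_card_filter_not (fun v => 0 ≤ Y p j v (Fin.last d))]
    push_cast
    rw [hM, two_mul]
    refine add_le_add (key _ ?_ ?_ ?_) (key _ ?_ ?_ ?_)
    · exact (Finset.filter_subset _ _).trans (Finset.filter_subset _ _)
    · intro v hv
      simp only [Finset.mem_filter] at hv
      exact hv.1.2
    · intro v hv w hw
      simp only [Finset.mem_filter] at hv hw
      exact iff_of_true hv.2 hw.2
    · exact (Finset.filter_subset _ _).trans (Finset.filter_subset _ _)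
    · intro v hv
      simp only [Finset.mem_filter] at hv
      exact hv.1.2
    · intro v hv w hw
      simp only [Finset.mem_filter] at hv hw
      exact iff_of_false hv.2 hw.2
  set 𝒩 := ∑ v ∈ V, μ v * F v with h𝒩
  have h𝒩0 : 0 ≤ 𝒩 := Finset.sum_nonneg fun v hv => mul_nonneg (hμ0 v) (hF0 v hv)
  have h4 : ∀ p : Fin (d + 1) × Fin (d + 1), p.1 ≠ p.2 →
      ∑ v ∈ V, μ v * (((q + 1) * n : ℝ) * ∑ j ∈ Finset.range (2 * m + 1),
        ((2 * q + 3) / (1 + |(j : ℝ) - m|)) ^ (2 * q) * F (ν (foldLast (Y p j v)))) ≤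
      c * n * 𝒩 := by
    intro p hp
    calc _ = ((q + 1) * n : ℝ) * ∑ j ∈ Finset.range (2 * m + 1), ∑ v ∈ V,
          ((2 * q + 3) / (1 + |(j : ℝ) - m|)) ^ (2 * q) *
            (μ v * F (ν (foldLast (Y p j v)))) := by
          rw [Finset.sum_comm, Finset.mul_sum]
          refine Finset.sum_congr rfl fun v _ => ?_
          rw [Finset.mul_sum, Finset.mul_sum, Finset.mul_sum]
          exact Finset.sum_congr rfl fun j _ => by ring
      _ ≤ ((q + 1) * n : ℝ) * ∑ j ∈ Finset.range (2 * m + 1),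
          ((2 * q + 3) ^ (2 * q) * 12 ^ s) * (1 / (1 + |(j : ℝ) - m|)) ^ 2 * (M * 𝒩) := by
          gcongr with j hj
          refine le_trans ?_ (mul_le_mul_of_nonneg_left (h3 p hp j) (by positivity))
          rw [Finset.mul_sum]
          refine Finset.sum_le_sum fun v hv => ?_
          have e1 := h2 p hp j hj v hv
          have e2 := hF0 _ (hν1 _ (hYu p hp j v hv))
          have e3 : 0 < 1 + |(j : ℝ) - m| := by positivity
          calc _ ≤ ((2 * q + 3) / (1 + |(j : ℝ) - m|)) ^ (2 * q) *
                ((12 * (1 + |(j : ℝ) - m|)) ^ s * μ (ν (foldLast (Y p j v))) *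
                  F (ν (foldLast (Y p j v)))) := by gcongr
            _ = ((2 * q + 3) ^ (2 * q) * 12 ^ s) * (1 / (1 + |(j : ℝ) - m|)) ^ 2 *
                (1 / (1 + |(j : ℝ) - m|)) ^ s *
                (μ (ν (foldLast (Y p j v))) * F (ν (foldLast (Y p j v)))) := by
                have : 2 * q = 2 + s + s := by omega
                rw [div_pow, mul_pow, this, pow_add (1 + |(j : ℝ) - m|),
                  pow_add (1 + |(j : ℝ) - m|), div_pow 1, div_pow 1, one_pow, one_pow]
                field_simp
            _ ≤ _ := by
                refine mul_le_mul_of_nonneg_right (mul_le_of_le_one_right (by positivity) ?_)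
                  (mul_nonneg (hμ0 _) e2)
                refine pow_le_one₀ (by positivity) ?_
                rw [div_le_one e3]
                linarith [abs_nonneg ((j : ℝ) - m)]
      _ = ((q + 1) * n : ℝ) * (((2 * q + 3) ^ (2 * q) * 12 ^ s) * (M * 𝒩) *
          ∑ j ∈ Finset.range (2 * m + 1), (1 / (1 + |(j : ℝ) - m|)) ^ 2) := by
          rw [Finset.mul_sum _ _ ((2 * q + 3 : ℝ) ^ (2 * q) * 12 ^ s * (M * 𝒩))]
          congr 1
          exact Finset.sum_congr rfl fun j _ => by ring
      _ ≤ ((q + 1) * n : ℝ) * (((2 * q + 3) ^ (2 * q) * 12 ^ s) * (M * 𝒩) * 4) := by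
          gcongr
          exact sum_inv_sq_le_four m
      _ = _ := by rw [hc]; ring
  calc _ ≤ ∑ v ∈ V, μ v * ∑ p : Fin (d + 1) × Fin (d + 1), if p.1 = p.2 then 0 else
        ((q + 1) * n : ℝ) * ∑ j ∈ Finset.range (2 * m + 1),
          ((2 * q + 3) / (1 + |(j : ℝ) - m|)) ^ (2 * q) * F (ν (foldLast (Y p j v))) :=
        Finset.sum_le_sum fun v hv => mul_le_mul_of_nonneg_left (h1 v hv) (hμ0 v)
    _ = ∑ p : Fin (d + 1) × Fin (d + 1), ∑ v ∈ V, μ v * if p.1 = p.2 then 0 else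
        ((q + 1) * n : ℝ) * ∑ j ∈ Finset.range (2 * m + 1),
          ((2 * q + 3) / (1 + |(j : ℝ) - m|)) ^ (2 * q) * F (ν (foldLast (Y p j v))) := by
        rw [Finset.sum_comm]
        exact Finset.sum_congr rfl fun v _ => Finset.mul_sum _ _ _
    _ ≤ ∑ p : Fin (d + 1) × Fin (d + 1), c * n * 𝒩 := by
        refine Finset.sum_le_sum fun p _ => ?_
        split_ifs with hp
        · simp only [mul_zero, Finset.sum_const_zero]
          positivity
        · exact h4 p hp
    _ = ((d + 1) * (d + 1) : ℕ) * c * n * 𝒩 := by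
        rw [Finset.sum_const, nsmul_eq_mul, Finset.card_univ, Fintype.card_prod, Fintype.card_fin]
        ring
    _ ≤ _ := by
        gcongr
        exact le_max_right _ _

/-- The tent function of height one on the ball of radius `R` around `y`. -/
def tent (y : EuclideanSpace ℝ (Fin d)) (R : ℝ) (x : EuclideanSpace ℝ (Fin d)) : ℝ :=
  max 0 (1 - dist x y / R)

theorem tent_nonneg (y : EuclideanSpace ℝ (Fin d)) (R : ℝ) (x : EuclideanSpace ℝ (Fin d)) :
    0 ≤ tent y R x := le_max_left _ _

theorem tent_le_one (y : EuclideanSpace ℝ (Fin d)) {R : ℝ} (hR : 0 < R)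
    (x : EuclideanSpace ℝ (Fin d)) : tent y R x ≤ 1 :=
  max_le zero_le_one (by
    have : 0 ≤ dist x y / R := by positivity
    linarith)

theorem tent_eq_zero {x y : EuclideanSpace ℝ (Fin d)} {R : ℝ} (hR : 0 < R) (h : R ≤ dist x y) :
    tent y R x = 0 := max_eq_left (by linarith [(one_le_div hR).2 h])

theorem abs_tent_sub_le (y : EuclideanSpace ℝ (Fin d)) {R : ℝ} (hR : 0 < R)
    (x x' : EuclideanSpace ℝ (Fin d)) : |tent y R x - tent y R x'| ≤ dist x x' / R := by
  refine (abs_max_sub_max_le_max _ _ _ _).trans (max_le (by simp; positivity) ?_)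
  rw [sub_sub_sub_cancel_left, ← sub_div, abs_div, abs_of_pos hR]
  gcongr
  rw [dist_comm x x']
  exact abs_dist_sub_le _ _ _

/-- The weighted gradient norm of a polynomial attached to a net. -/
def netNorm (ω : Measure (EuclideanSpace ℝ (Fin (d + 1))))
    (V : Finset (EuclideanSpace ℝ (Fin (d + 1)))) (n : ℕ) (P : MvPolynomial (Fin d) ℝ) : ℝ :=
  ∑ v ∈ V, ω.real (Metric.closedBall v (1 / n)) * sphSup (angNorm (liftPoly P)) v (2 / n)

set_option maxHeartbeats 1000000 in
/-- The localized first order functionals at the nodes `X` dominate the weighted gradient norm. -/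
theorem exists_lower_bound (d s : ℕ) : ∃ c C : ℝ, 0 < c ∧ c ≤ 1 / 100 ∧ 0 < C ∧
    ∀ ω : Measure (EuclideanSpace ℝ (Fin (d + 1))), HalfDoubling s ω → ∀ n : ℕ, 0 < n →
    ∀ V W : Finset (EuclideanSpace ℝ (Fin (d + 1))), IsNet V (1 / (20 * n)) → IsNet W (c / n) →
    ∀ P : MvPolynomial (Fin d) ℝ, P.totalDegree ≤ n → ∀ (N : ℕ) (κ : ℝ), 0 < κ →
    ∀ X X₀ : Fin N → EuclideanSpace ℝ (Fin (d + 1)), (∀ j, ‖X j‖ = 1) →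
      (∀ j, dist (X j) (X₀ j) ≤ c / n / 12) →
      (∀ y ∈ W, N * ω.real (Metric.closedBall y (c / n)) ≤
        κ * (Finset.univ.filter fun j => dist (X₀ j) y ≤ c / n / 2).card) →
      N * netNorm ω V n P ≤ C * κ * ∑ y ∈ W, ∑ p : Fin (d + 1) × Fin (d + 1),
        |∑ j, tent y (c / n) (X j) * pEval (angDeriv p.1 p.2 (liftPoly P)) (X j)| := by
  classical
  obtain ⟨C₁, hC₁, hB⟩ := exists_bernstein_sum d s
  set I : ℝ := (d + 1) * (d + 1) with hI
  have hI1 : 1 ≤ I := by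
    rw [hI]
    have : (0 : ℝ) ≤ d := Nat.cast_nonneg d
    nlinarith
  have hI0 : 0 < I := by linarith
  set c : ℝ := 1 / (100 * C₁ * I) with hc
  have hc0 : 0 < c := by positivity
  have hc1 : c ≤ 1 / 100 := by
    rw [hc]
    gcongr
    nlinarith
  refine ⟨c, 2 * 121 ^ (d + 1) * ((8 / c) ^ s * (8 * I)), hc0, hc1, by positivity, ?_⟩
  intro ω hω n hn V W hV hW P hP N κ hκ X X₀ hX hXX hcount
  have hn' : (0 : ℝ) < n := by exact_mod_cast hn
  have hn1 : (1 : ℝ) ≤ n := by exact_mod_cast hn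
  set G := liftPoly P with hG
  set R := c / n with hR
  have hR0 : 0 < R := by positivity
  have hR1 : R ≤ 1 / 100 / n := by rw [hR]; gcongr
  set μ : EuclideanSpace ℝ (Fin (d + 1)) → ℝ :=
    fun v => ω.real (Metric.closedBall v (1 / n)) with hμ
  set F : EuclideanSpace ℝ (Fin (d + 1)) → ℝ := fun v => sphSup (angNorm G) v (2 / n) with hF
  set F₂ : EuclideanSpace ℝ (Fin (d + 1)) → ℝ := fun v => sphSup (angNormTwo G) v (3 / n) with hF₂
  have hμ0 : ∀ v, 0 ≤ μ v := fun v => measureReal_nonneg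
  have hF0 : ∀ v ∈ V, 0 ≤ F v := fun v hv =>
    (angNorm_nonneg G v).trans (le_sphSup (continuous_angNorm G) (hV.norm_eq v hv)
      (by rw [dist_self]; positivity))
  set T : EuclideanSpace ℝ (Fin (d + 1)) → ℝ := fun y => ∑ p : Fin (d + 1) × Fin (d + 1),
    |∑ j, tent y R (X j) * pEval (angDeriv p.1 p.2 G) (X j)| with hT
  have hT0 : ∀ y, 0 ≤ T y := fun y => Finset.sum_nonneg fun _ _ => abs_nonneg _
  set A := V.filter fun v => F₂ v ≤ 2 * C₁ * n * F v with hA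
  have hgood : netNorm ω V n P ≤ 2 * ∑ v ∈ A, μ v * F v := by
    have h1 := hB ω hω n hn V hV P hP
    change _ ≤ C₁ * n * netNorm ω V n P at h1
    have h2 : netNorm ω V n P = ∑ v ∈ A, μ v * F v +
        ∑ v ∈ V.filter (fun v => ¬ F₂ v ≤ 2 * C₁ * n * F v), μ v * F v :=
      (Finset.sum_filter_add_sum_filter_not _ _ _).symm
    have h3 : ∑ v ∈ V.filter (fun v => ¬ F₂ v ≤ 2 * C₁ * n * F v), 2 * C₁ * n * (μ v * F v) ≤
        C₁ * n * netNorm ω V n P := by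
      refine le_trans ?_ h1
      refine (Finset.sum_le_sum fun v hv => ?_).trans
        (Finset.sum_le_sum_of_subset_of_nonneg (Finset.filter_subset _ _) fun v hv _ =>
          mul_nonneg (hμ0 v) ((angNormTwo_nonneg G v).trans (le_sphSup (continuous_angNormTwo G)
            (hV.norm_eq v hv) (by rw [dist_self]; positivity))))
      have := (not_le.1 (Finset.mem_filter.1 hv).2).le
      calc _ = μ v * (2 * C₁ * n * F v) := by ring
        _ ≤ _ := mul_le_mul_of_nonneg_left this (hμ0 v)
    rw [← Finset.mul_sum] at h3
    have h4 : 0 < C₁ * n := by positivity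
    have h5 : 2 * ∑ v ∈ V.filter (fun v => ¬ F₂ v ≤ 2 * C₁ * n * F v), μ v * F v ≤
        netNorm ω V n P := by
      refine le_of_mul_le_mul_left ?_ h4
      linarith
    linarith
  have key : ∀ v ∈ A, ∃ y ∈ W, dist y v ≤ 3 / n ∧
      N * (μ v * F v) ≤ (8 / c) ^ s * (8 * I) * κ * T y := by
    intro v hv
    obtain ⟨hvV, hvF⟩ := Finset.mem_filter.1 hv
    have hvu := hV.mem (by positivity) hvV
    obtain ⟨x', hx'1, hx'2, hx'3⟩ := exists_eq_sphSup (continuous_angNorm G) (hV.norm_eq v hvV)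
      (r := 2 / n) (by positivity)
    set x := foldLast x' with hx
    have hxu : x ∈ upSphere d := foldLast_mem hx'1
    have hxv : dist x v ≤ 2 / n := (dist_foldLast_le x' hvu.2).trans hx'2
    have hxF : angNorm G x = F v := by rw [hx, hG, angNorm_liftPoly_foldLast]; exact hx'3
    obtain ⟨p, hp⟩ : ∃ p : Fin (d + 1) × Fin (d + 1), F v ≤ I * |pEval (angDeriv p.1 p.2 G) x| := by
      by_contra! hcon
      have h1 := Finset.sum_lt_sum_of_nonempty (s := Finset.univ)
        ⟨((0 : Fin (d + 1)), (0 : Fin (d + 1))), Finset.mem_univ _⟩ fun p _ => hcon p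
      rw [← Finset.mul_sum, Finset.sum_const, Finset.card_univ, Fintype.card_prod, Fintype.card_fin,
        nsmul_eq_mul] at h1
      change I * angNorm G x < _ at h1
      rw [hxF, hI] at h1
      push_cast at h1
      exact lt_irrefl _ h1
    obtain ⟨y, hy, hxy⟩ := hW.cover x hxu
    have hRn : 10 * R ≤ 1 / n := by
      calc 10 * R ≤ 10 * (1 / 100 / n) := by gcongr
        _ ≤ 1 / n := by rw [div_div, ← mul_div_assoc, div_le_div_iff₀ (by positivity) hn']; nlinarith
    have hyv : dist y v ≤ 3 / n := by
      have := dist_triangle_left y v x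
      have e : (3 : ℝ) / n = 2 / n + 1 / n := by ring
      linarith
    refine ⟨y, hy, hyv, ?_⟩
    set h : EuclideanSpace ℝ (Fin (d + 1)) → ℝ := fun z => pEval (angDeriv p.1 p.2 G) z with hh
    have hosc : ∀ z, ‖z‖ = 1 → dist z y ≤ R → |h z - h x| ≤ F v / (2 * I) := by
      intro z hz hzy
      have e1 : ‖z - x‖ ≤ 11 * R := by
        rw [← dist_eq_norm]
        have := dist_triangle_right z x y
        linarith
      have e2 : 11 * R ≤ 1 := by
        have : 1 / 100 / (n : ℝ) ≤ 1 / 100 := div_le_self (by norm_num) hn1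
        linarith
      have e3 := abs_pEval_sub_le hxu.1 hz (angDeriv p.1 p.2 G) e1 e2 (F := 2 * C₁ * n * F v)
        fun z' hz' hz'x => by
          refine (angNorm_angDeriv_le_angNormTwo _ _ _ _).trans (le_trans ?_ hvF)
          refine le_sphSup (continuous_angNormTwo G) hz' ?_
          rw [← dist_eq_norm] at hz'x
          have e4 := dist_triangle z' x v
          have e5 : (3 : ℝ) / n = 2 / n + 1 / n := by ring
          have e6 : 22 * R ≤ 1 / n := by
            calc 22 * R ≤ 22 * (1 / 100 / n) := by gcongr
              _ ≤ 1 / n := by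
                rw [div_div, ← mul_div_assoc, div_le_div_iff₀ (by positivity) hn']; nlinarith
          linarith
      refine e3.trans ?_
      have e7 : 2 * C₁ * n * F v * (2 * (11 * R)) = 44 * (F v / (100 * I)) := by
        rw [hR, hc]
        field_simp
        ring
      rw [e7, ← mul_div_assoc, div_le_div_iff₀ (by positivity) (by positivity)]
      nlinarith [mul_nonneg (hF0 v hvV) hI0.le]
    obtain ⟨σ, hσ1, hσ2⟩ : ∃ σ : ℝ, |σ| = 1 ∧ σ * h x = |h x| := by
      rcases le_total 0 (h x) with h0 | h0
      · exact ⟨1, by simp, by rw [one_mul, abs_of_nonneg h0]⟩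
      · exact ⟨-1, by simp, by rw [abs_of_nonpos h0]; ring⟩
    have hσ3 : ∀ z, ‖z‖ = 1 → dist z y ≤ R → F v / (2 * I) ≤ σ * h z := by
      intro z hz hzy
      have e1 := hosc z hz hzy
      have e2 : |σ * (h z - h x)| ≤ F v / (2 * I) := by rwa [abs_mul, hσ1, one_mul]
      have e3 : F v / I ≤ |h x| := (div_le_iff₀' hI0).2 hp
      have e4 : F v / I = F v / (2 * I) + F v / (2 * I) := by field_simp; norm_num
      have e5 := (abs_le.1 e2).1
      rw [mul_sub, hσ2] at e5
      linarith
    set J := Finset.univ.filter fun j => dist (X₀ j) y ≤ R / 2 with hJ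
    have hTy : (J.card : ℝ) * (1 / 4 * (F v / (2 * I))) ≤ T y := by
      have e1 : σ * ∑ j, tent y R (X j) * h (X j) ≤ T y := by
        refine (le_abs_self _).trans ?_
        rw [abs_mul, hσ1, one_mul]
        exact Finset.single_le_sum (s := Finset.univ) (f := fun p : Fin (d + 1) × Fin (d + 1) =>
          |∑ j, tent y R (X j) * pEval (angDeriv p.1 p.2 G) (X j)|) (fun _ _ => abs_nonneg _)
          (Finset.mem_univ p)
      refine le_trans ?_ e1
      rw [Finset.mul_sum, ← nsmul_eq_mul, ← Finset.sum_const]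
      refine (Finset.sum_le_sum fun j hj => ?_).trans
        (Finset.sum_le_sum_of_subset_of_nonneg (Finset.subset_univ J) fun j _ _ => ?_)
      · have e2 := (Finset.mem_filter.1 hj).2
        have e3 := hXX j
        have e4 := dist_triangle (X j) (X₀ j) y
        have e5 := hσ3 (X j) (hX j) (by linarith)
        have e6 : 1 / 4 ≤ tent y R (X j) := by
          refine le_max_of_le_right ?_
          have : dist (X j) y / R ≤ 3 / 4 := by
            rw [div_le_iff₀ hR0]
            linarith
          linarith
        calc 1 / 4 * (F v / (2 * I)) ≤ tent y R (X j) * (σ * h (X j)) :=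
              mul_le_mul e6 e5 (div_nonneg (hF0 v hvV) (by positivity)) (tent_nonneg _ _ _)
          _ = _ := by ring
      · rcases le_or_gt R (dist (X j) y) with h1 | h1
        · rw [tent_eq_zero hR0 h1, zero_mul, mul_zero]
        · have e5 := hσ3 (X j) (hX j) h1.le
          have e6 : 0 ≤ F v / (2 * I) := div_nonneg (hF0 v hvV) (by positivity)
          calc 0 ≤ tent y R (X j) * (σ * h (X j)) :=
              mul_nonneg (tent_nonneg _ _ _) (e6.trans e5)
            _ = _ := by ring
    have hμy : μ v ≤ (8 / c) ^ s * ω.real (Metric.closedBall y R) := by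
      have e1 := hω.mass_le_of_dist_le (x := v) (y := y) (hW.mem hR0.le hy) (r := R) (R := 1 / n)
        (T := 4 / n) hR0 (by
          have e : (4 : ℝ) / n = 3 / n + 1 / n := by ring
          rw [dist_comm]
          linarith) (hR1.trans (by gcongr; norm_num))
      refine e1.trans (le_of_eq ?_)
      congr 2
      rw [hR]
      field_simp
      norm_num
    calc N * (μ v * F v) ≤ N * ((8 / c) ^ s * ω.real (Metric.closedBall y R) * F v) := by
          have := hF0 v hvV
          gcongr
      _ = (8 / c) ^ s * F v * (N * ω.real (Metric.closedBall y R)) := by ring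
      _ ≤ (8 / c) ^ s * F v * (κ * J.card) := by
          have := hF0 v hvV
          have := hcount y hy
          gcongr
      _ = (8 / c) ^ s * (8 * I) * κ * ((J.card : ℝ) * (1 / 4 * (F v / (2 * I)))) := by
          have e8 : F v = 8 * I * (1 / 4 * (F v / (2 * I))) := by
            clear_value F
            clear * - hI0
            field_simp
            ring
          nth_rewrite 1 [e8]
          ring
      _ ≤ _ := by gcongr
  choose! y hy1 hy2 hy3 using key
  have hfib : ∑ v ∈ A, T (y v) ≤ 121 ^ (d + 1) * ∑ y ∈ W, T y := by
    refine sum_comp_le_card_mul_sum hy1 (fun y _ => hT0 y) fun b hb => ?_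
    have := hV.card_le_of_dist_le (A := A.filter fun v => y v = b) (R := 6 / n) (by positivity)
      (by positivity) ((Finset.filter_subset _ _).trans (Finset.filter_subset _ _))
      fun v hv w hw => by
        obtain ⟨hv1, hv2⟩ := Finset.mem_filter.1 hv
        obtain ⟨hw1, hw2⟩ := Finset.mem_filter.1 hw
        have e1 := hy2 v hv1
        have e2 := hy2 w hw1
        rw [hv2] at e1
        rw [hw2] at e2
        have e3 := dist_triangle_left v w b
        have e4 : (6 : ℝ) / n = 3 / n + 3 / n := by ring
        linarith
    refine this.trans (le_of_eq ?_)
    congr 1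
    field_simp
    norm_num
  calc N * netNorm ω V n P ≤ N * (2 * ∑ v ∈ A, μ v * F v) := by gcongr
    _ = 2 * ∑ v ∈ A, N * (μ v * F v) := by
        rw [← Finset.mul_sum A]
        ring
    _ ≤ 2 * ∑ v ∈ A, (8 / c) ^ s * (8 * I) * κ * T (y v) := by
        refine mul_le_mul_of_nonneg_left (Finset.sum_le_sum fun v hv => hy3 v hv) zero_le_two
    _ = 2 * ((8 / c) ^ s * (8 * I) * κ * ∑ v ∈ A, T (y v)) := by rw [← Finset.mul_sum A]
    _ ≤ 2 * ((8 / c) ^ s * (8 * I) * κ * (121 ^ (d + 1) * ∑ y ∈ W, T y)) := by gcongr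
    _ = _ := by rw [hT]; ring

/-- A linear functional dominated by a finite sum of absolute values of linear functionals is a
linear combination of these with bounded coefficients. -/
theorem exists_eq_sum_of_abs_le {F ι : Type*} [AddCommGroup F] [Module ℝ F] [Fintype ι]
    (T : ι → F →ₗ[ℝ] ℝ) (v : F →ₗ[ℝ] ℝ) {a : ℝ} (ha : 0 ≤ a)
    (h : ∀ P, |v P| ≤ a * ∑ i, |T i P|) :
    ∃ θ : ι → ℝ, (∀ i, |θ i| ≤ a) ∧ ∀ P, v P = ∑ i, θ i * T i P := by
  classical
  set S : F →ₗ[ℝ] (ι → ℝ) := LinearMap.pi T with hS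
  obtain ⟨σ, hσ⟩ := S.rangeRestrict.exists_rightInverse_of_surjective S.range_rangeRestrict
  have hσ' : ∀ z : LinearMap.range S, S (σ z) = z := fun z => by
    have := LinearMap.congr_fun hσ z
    exact congrArg Subtype.val this
  obtain ⟨g, hg1, hg2⟩ := exists_extension_of_le_sublinear
    (⟨LinearMap.range S, v ∘ₗ σ⟩ : (ι → ℝ) →ₗ.[ℝ] ℝ) (fun z => a * ∑ i, |z i|)
    (fun c hc z => by
      simp only [Pi.smul_apply, smul_eq_mul, abs_mul, abs_of_pos hc, ← Finset.mul_sum]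
      ring)
    (fun x y => by
      rw [← mul_add, ← Finset.sum_add_distrib]
      exact mul_le_mul_of_nonneg_left (Finset.sum_le_sum fun i _ => abs_add_le _ _) ha)
    (fun z => by
      refine (le_abs_self _).trans ((h (σ z)).trans_eq ?_)
      have := hσ' z
      rw [← this]
      rfl)
  have hv : ∀ P, v P = g (S P) := by
    intro P
    have h1 := hg1 ⟨S P, LinearMap.mem_range_self S P⟩
    rw [h1]
    have h2 : ∀ Q, S Q = 0 → v Q = 0 := fun Q hQ => by
      have h3 := h Q
      have h4 : ∀ i, T i Q = 0 := fun i => congrFun hQ i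
      simpa [h4] using h3
    have h3 := h2 (P - σ ⟨S P, LinearMap.mem_range_self S P⟩) (by
      rw [map_sub, hσ', sub_self])
    rw [map_sub, sub_eq_zero] at h3
    exact h3
  refine ⟨fun i => g (Pi.single i 1), fun i => ?_, fun P => ?_⟩
  · have h1 : ∀ t : ℝ, a * ∑ k, |(Pi.single i t : ι → ℝ) k| = a * |t| := fun t => by
      rw [Finset.sum_eq_single i (fun k _ hk => by rw [Pi.single_eq_of_ne hk, abs_zero])
        (fun hi => absurd (Finset.mem_univ i) hi), Pi.single_eq_same]
    refine abs_le'.2 ⟨?_, ?_⟩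
    · have h2 := hg2 (Pi.single i 1)
      rwa [h1, abs_one, mul_one] at h2
    · have h2 := hg2 (Pi.single i (-1))
      rw [h1, abs_neg, abs_one, mul_one, Pi.single_neg, map_neg] at h2
      exact h2
  · rw [hv P]
    conv_lhs => rw [← Finset.univ_sum_single (S P), map_sum]
    refine Finset.sum_congr rfl fun i _ => ?_
    rw [show (Pi.single i (S P i) : ι → ℝ) = T i P • Pi.single i 1 by
      rw [← Pi.single_smul, smul_eq_mul, mul_one]; rfl, map_smul, smul_eq_mul, mul_comm]

/-- A tangential field localized near the points of `W`. -/
def tentField (W : Finset (EuclideanSpace ℝ (Fin d))) (R : ℝ)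
    (θ : EuclideanSpace ℝ (Fin d) → Fin d × Fin d → ℝ) (x : EuclideanSpace ℝ (Fin d)) :
    EuclideanSpace ℝ (Fin d) :=
  ∑ p : Fin d × Fin d, (∑ y ∈ W, θ y p * tent y R x) • rotField p.1 p.2 x

theorem inner_tentField (W : Finset (EuclideanSpace ℝ (Fin d))) (R : ℝ)
    (θ : EuclideanSpace ℝ (Fin d) → Fin d × Fin d → ℝ) (x : EuclideanSpace ℝ (Fin d)) :
    inner ℝ x (tentField W R θ x) = 0 := by
  rw [tentField, inner_sum]
  exact Finset.sum_eq_zero fun p _ => by rw [inner_smul_right, inner_rotField, mul_zero]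

theorem sum_tentField_mul_pEval (W : Finset (EuclideanSpace ℝ (Fin d))) (R : ℝ)
    (θ : EuclideanSpace ℝ (Fin d) → Fin d × Fin d → ℝ) (x : EuclideanSpace ℝ (Fin d))
    (G : MvPolynomial (Fin d) ℝ) :
    ∑ l, tentField W R θ x l * pEval (MvPolynomial.pderiv l G) x =
      ∑ y ∈ W, ∑ p : Fin d × Fin d, θ y p * (tent y R x * pEval (angDeriv p.1 p.2 G) x) := by
  rw [Finset.sum_comm]
  simp only [← mul_assoc]
  simp only [← Finset.sum_mul, ← sum_rotField_mul_pEval, tentField]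
  simp only [WithLp.ofLp_sum, Finset.sum_apply, PiLp.smul_apply, smul_eq_mul, Finset.sum_mul]
  rw [Finset.sum_comm]
  refine Finset.sum_congr rfl fun p _ => ?_
  rw [Finset.sum_comm]
  simp only [mul_assoc, Finset.mul_sum]

theorem tentField_eq_zero {W : Finset (EuclideanSpace ℝ (Fin d))} {R : ℝ} (hR : 0 < R)
    (θ : EuclideanSpace ℝ (Fin d) → Fin d × Fin d → ℝ) {x : EuclideanSpace ℝ (Fin d)}
    (h : ∀ y ∈ W, R ≤ dist x y) : tentField W R θ x = 0 :=
  Finset.sum_eq_zero fun p _ => by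
    rw [Finset.sum_eq_zero fun y hy => by rw [tent_eq_zero hR (h y hy), mul_zero], zero_smul]

theorem card_near_le_one {W : Finset (EuclideanSpace ℝ (Fin d))} {R : ℝ}
    (hW : ∀ y ∈ W, ∀ z ∈ W, y ≠ z → 2 * R ≤ dist y z) (x : EuclideanSpace ℝ (Fin d)) :
    (W.filter fun y => dist x y < R).card ≤ 1 := by
  refine Finset.card_le_one.2 fun y hy z hz => ?_
  rw [Finset.mem_filter] at hy hz
  by_contra hyz
  linarith [hW y hy.1 z hz.1 hyz, dist_triangle_left y z x]

theorem abs_sum_mul_tent_le {W : Finset (EuclideanSpace ℝ (Fin d))} {R A : ℝ} (hR : 0 < R)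
    (hW : ∀ y ∈ W, ∀ z ∈ W, y ≠ z → 2 * R ≤ dist y z) (hA : 0 ≤ A)
    {f : EuclideanSpace ℝ (Fin d) → ℝ} (hf : ∀ y ∈ W, |f y| ≤ A) (x : EuclideanSpace ℝ (Fin d)) :
    |∑ y ∈ W, f y * tent y R x| ≤ A := by
  rw [← Finset.sum_filter_of_ne (p := fun y => dist x y < R) (fun y _ h => by
    by_contra! h2
    exact h (by rw [tent_eq_zero hR h2, mul_zero]))]
  refine (Finset.abs_sum_le_sum_abs _ _).trans
    ((Finset.sum_le_card_nsmul _ _ A fun y hy => ?_).trans ?_)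
  · rw [abs_mul, abs_of_nonneg (tent_nonneg _ _ _)]
    exact (mul_le_of_le_one_right (abs_nonneg _) (tent_le_one y hR x)).trans
      (hf y (Finset.mem_filter.1 hy).1)
  · rw [nsmul_eq_mul]
    have : ((W.filter fun y => dist x y < R).card : ℝ) ≤ 1 := by
      exact_mod_cast card_near_le_one hW x
    exact mul_le_of_le_one_left hA this

theorem abs_sum_mul_tent_sub_le {W : Finset (EuclideanSpace ℝ (Fin d))} {R A : ℝ} (hR : 0 < R)
    (hW : ∀ y ∈ W, ∀ z ∈ W, y ≠ z → 2 * R ≤ dist y z) (hA : 0 ≤ A)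
    {f : EuclideanSpace ℝ (Fin d) → ℝ} (hf : ∀ y ∈ W, |f y| ≤ A)
    (x x' : EuclideanSpace ℝ (Fin d)) :
    |∑ y ∈ W, f y * tent y R x - ∑ y ∈ W, f y * tent y R x'| ≤ 2 * A * dist x x' / R := by
  classical
  rw [← Finset.sum_sub_distrib]
  simp only [← mul_sub]
  rw [← Finset.sum_filter_of_ne (p := fun y => dist x y < R ∨ dist x' y < R) (fun y _ h => by
    by_contra! h2
    exact h (by rw [tent_eq_zero hR h2.1, tent_eq_zero hR h2.2, sub_self, mul_zero])),
    Finset.filter_or]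
  refine (Finset.abs_sum_le_sum_abs _ _).trans
    ((Finset.sum_le_card_nsmul _ _ (A * (dist x x' / R)) fun y hy => ?_).trans ?_)
  · rw [abs_mul]
    refine mul_le_mul (hf y ?_) (abs_tent_sub_le y hR x x') (abs_nonneg _) hA
    rw [← Finset.filter_or] at hy
    exact (Finset.mem_filter.1 hy).1
  · rw [nsmul_eq_mul, show 2 * A * dist x x' / R = 2 * (A * (dist x x' / R)) by ring]
    refine mul_le_mul_of_nonneg_right ?_ (mul_nonneg hA (div_nonneg dist_nonneg hR.le))
    have h1 := (Finset.card_union_le (W.filter fun y => dist x y < R)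
      (W.filter fun y => dist x' y < R)).trans
      (add_le_add (card_near_le_one hW x) (card_near_le_one hW x'))
    exact_mod_cast h1

theorem norm_tentField_le {W : Finset (EuclideanSpace ℝ (Fin d))} {R A : ℝ} (hR : 0 < R)
    (hW : ∀ y ∈ W, ∀ z ∈ W, y ≠ z → 2 * R ≤ dist y z) (hA : 0 ≤ A)
    {θ : EuclideanSpace ℝ (Fin d) → Fin d × Fin d → ℝ} (hθ : ∀ y ∈ W, ∀ p, |θ y p| ≤ A)
    {x : EuclideanSpace ℝ (Fin d)} (hx : ‖x‖ = 1) :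
    ‖tentField W R θ x‖ ≤ d ^ 2 * (2 * A) := by
  refine (norm_sum_le _ _).trans ((Finset.sum_le_card_nsmul _ _ (2 * A) fun p _ => ?_).trans_eq ?_)
  · rw [norm_smul, Real.norm_eq_abs, mul_comm]
    have h1 := norm_rotField_le p.1 p.2 x
    rw [hx, mul_one] at h1
    exact mul_le_mul h1 (abs_sum_mul_tent_le hR hW hA (fun y hy => hθ y hy p) x) (abs_nonneg _)
      zero_le_two
  · rw [Finset.card_univ, Fintype.card_prod, Fintype.card_fin, nsmul_eq_mul]
    push_cast
    ring

theorem norm_tentField_sub_le {W : Finset (EuclideanSpace ℝ (Fin d))} {R A : ℝ} (hR : 0 < R)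
    (hR1 : R ≤ 1) (hW : ∀ y ∈ W, ∀ z ∈ W, y ≠ z → 2 * R ≤ dist y z) (hA : 0 ≤ A)
    {θ : EuclideanSpace ℝ (Fin d) → Fin d × Fin d → ℝ} (hθ : ∀ y ∈ W, ∀ p, |θ y p| ≤ A)
    {x x' : EuclideanSpace ℝ (Fin d)} (hx : ‖x‖ = 1) :
    ‖tentField W R θ x - tentField W R θ x'‖ ≤ d ^ 2 * (6 * A / R) * dist x x' := by
  rw [tentField, tentField, ← Finset.sum_sub_distrib]
  refine (norm_sum_le _ _).trans ((Finset.sum_le_card_nsmul _ _ (6 * A / R * dist x x')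
    fun p _ => ?_).trans_eq ?_)
  · rw [show (∑ y ∈ W, θ y p * tent y R x) • rotField p.1 p.2 x -
        (∑ y ∈ W, θ y p * tent y R x') • rotField p.1 p.2 x' =
        (∑ y ∈ W, θ y p * tent y R x - ∑ y ∈ W, θ y p * tent y R x') • rotField p.1 p.2 x +
        (∑ y ∈ W, θ y p * tent y R x') • rotField p.1 p.2 (x - x') by
      rw [rotField_sub]; module]
    refine (norm_add_le _ _).trans ?_
    rw [norm_smul, norm_smul, Real.norm_eq_abs, Real.norm_eq_abs]
    have h1 := norm_rotField_le p.1 p.2 x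
    rw [hx, mul_one] at h1
    have h2 := norm_rotField_le p.1 p.2 (x - x')
    rw [← dist_eq_norm] at h2
    have h3 := abs_sum_mul_tent_le hR hW hA (fun y hy => hθ y hy p) x'
    have h4 := abs_sum_mul_tent_sub_le hR hW hA (fun y hy => hθ y hy p) x x'
    have h5 : A ≤ A / R := le_div_self hA hR hR1
    have h6 := mul_le_mul h4 h1 (norm_nonneg _) (by positivity)
    have h7 := mul_le_mul h3 h2 (norm_nonneg _) hA
    have h8 := mul_le_mul_of_nonneg_right h5 (dist_nonneg (x := x) (y := x'))
    calc _ ≤ 2 * A * dist x x' / R * 2 + A * (2 * dist x x') := add_le_add h6 h7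
      _ ≤ 2 * A * dist x x' / R * 2 + 2 * (A / R * dist x x') := by linarith
      _ = _ := by ring
  · rw [Finset.card_univ, Fintype.card_prod, Fintype.card_fin, nsmul_eq_mul]
    push_cast
    ring

theorem exists_tentField_repr {N : ℕ} (W : Finset (EuclideanSpace ℝ (Fin (d + 1)))) (R : ℝ)
    (X : Fin N → EuclideanSpace ℝ (Fin (d + 1))) (I : MvPolynomial (Fin d) ℝ →ₗ[ℝ] ℝ) (n : ℕ)
    {a c : ℝ} (ha : 0 ≤ a)
    (h : ∀ P : MvPolynomial (Fin d) ℝ, P.totalDegree ≤ n →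
      |c * (∑ j, pEval (liftPoly P) (X j) - I P)| ≤
        a * ∑ y ∈ W, ∑ p : Fin (d + 1) × Fin (d + 1),
          |∑ j, tent y R (X j) * pEval (angDeriv p.1 p.2 (liftPoly P)) (X j)|) :
    ∃ θ : EuclideanSpace ℝ (Fin (d + 1)) → Fin (d + 1) × Fin (d + 1) → ℝ,
      (∀ y ∈ W, ∀ p, |θ y p| ≤ a) ∧ ∀ P : MvPolynomial (Fin d) ℝ, P.totalDegree ≤ n →
        ∑ j, ∑ l, tentField W R θ (X j) l * pEval (MvPolynomial.pderiv l (liftPoly P)) (X j) =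
          c * (∑ j, pEval (liftPoly P) (X j) - I P) := by
  classical
  let v : MvPolynomial.restrictTotalDegree (Fin d) ℝ n →ₗ[ℝ] ℝ :=
    { toFun := fun P => c * (∑ j, pEval (liftPoly P.1) (X j) - I P.1)
      map_add' := fun P Q => by
        simp only [Submodule.coe_add, liftPoly, pEval, map_add, Finset.sum_add_distrib]
        ring
      map_smul' := fun t P => by
        simp only [Submodule.coe_smul, liftPoly, pEval, map_smul, MvPolynomial.smul_eval,
          ← Finset.mul_sum, smul_eq_mul, RingHom.id_apply]
        ring }
  let T : W × (Fin (d + 1) × Fin (d + 1)) →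
      MvPolynomial.restrictTotalDegree (Fin d) ℝ n →ₗ[ℝ] ℝ := fun i =>
    { toFun := fun P => ∑ j, tent i.1.1 R (X j) *
        pEval (angDeriv i.2.1 i.2.2 (liftPoly P.1)) (X j)
      map_add' := fun P Q => by
        rw [← Finset.sum_add_distrib]
        refine Finset.sum_congr rfl fun j _ => ?_
        simp only [pEval_angDeriv, Submodule.coe_add, liftPoly, map_add]
        simp only [pEval, map_add]
        ring
      map_smul' := fun t P => by
        rw [smul_eq_mul, Finset.mul_sum]
        refine Finset.sum_congr rfl fun j _ => ?_
        simp only [pEval_angDeriv, Submodule.coe_smul, liftPoly, map_smul, Derivation.map_smul]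
        simp only [pEval, MvPolynomial.smul_eval, RingHom.id_apply]
        ring }
  have hvT : ∀ P, |v P| ≤ a * ∑ i, |T i P| := fun P => by
    refine (h P.1 ((MvPolynomial.mem_restrictTotalDegree _ _ _).1 P.2)).trans_eq ?_
    rw [Fintype.sum_prod_type, ← Finset.sum_coe_sort W]
    rfl
  obtain ⟨θ, hθ1, hθ2⟩ := exists_eq_sum_of_abs_le T v ha hvT
  refine ⟨fun y p => if hy : y ∈ W then θ (⟨y, hy⟩, p) else 0, fun y hy p => ?_, fun P hP => ?_⟩
  · simp only [hy, dif_pos]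
    exact hθ1 _
  · have h1 := hθ2 ⟨P, (MvPolynomial.mem_restrictTotalDegree _ _ _).2 hP⟩
    rw [show c * (∑ j, pEval (liftPoly P) (X j) - I P) =
      v ⟨P, (MvPolynomial.mem_restrictTotalDegree _ _ _).2 hP⟩ from rfl, h1,
      Fintype.sum_prod_type]
    simp only [sum_tentField_mul_pEval]
    rw [Finset.sum_comm, ← Finset.sum_coe_sort W]
    refine Finset.sum_congr rfl fun y _ => ?_
    rw [Finset.sum_comm]
    refine Finset.sum_congr rfl fun p _ => ?_
    rw [← Finset.mul_sum]
    simp only [y.2, dif_pos]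
    rfl

/-- Intermediate configurations along the deformation of the initial nodes `X₀`. -/
structure NodeState {N : ℕ} (I : MvPolynomial (Fin d) ℝ →ₗ[ℝ] ℝ)
    (𝒩 : MvPolynomial (Fin d) ℝ → ℝ) (n : ℕ) (X₀ : Fin N → EuclideanSpace ℝ (Fin (d + 1)))
    (D η δ τ s : ℝ) (X : Fin N → EuclideanSpace ℝ (Fin (d + 1))) : Prop where
  norm_eq : ∀ j, ‖X j‖ = 1
  le_last : ∀ j, δ ≤ X j (Fin.last d)
  dist_le : ∀ j, dist (X j) (X₀ j) ≤ s * D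
  sep : ∀ i j, i ≠ j → (1 - s / 2) * η ≤ dist (X i) (X j)
  defect : ∀ P : MvPolynomial (Fin d) ℝ, P.totalDegree ≤ n →
    |∑ j, pEval (liftPoly P) (X j) - I P| ≤ (1 - s) * τ * 𝒩 P

theorem exists_pos_mul_le {ι : Type*} [Finite ι] (c e : ι → ℝ) (he : ∀ i, 0 < e i) :
    ∃ h : ℝ, 0 < h ∧ ∀ i, h * c i ≤ e i := by
  have h1 : ∀ i, ∀ᶠ h in nhdsWithin (0 : ℝ) (Ioi 0), h * c i ≤ e i := fun i => by
    have h2 : Filter.Tendsto (fun h : ℝ => h * c i) (nhds 0) (nhds (0 * c i)) :=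
      (continuous_id.mul continuous_const).tendsto 0
    rw [zero_mul] at h2
    exact (h2.mono_left nhdsWithin_le_nhds).eventually (eventually_le_nhds (he i))
  exact (eventually_mem_nhdsWithin.and (Filter.eventually_all.2 h1)).exists

set_option maxHeartbeats 1000000 in
theorem NodeState.exists_step {N n : ℕ} {I : MvPolynomial (Fin d) ℝ →ₗ[ℝ] ℝ}
    {𝒩 : MvPolynomial (Fin d) ℝ → ℝ} {X₀ X : Fin N → EuclideanSpace ℝ (Fin (d + 1))}
    {D η δ τ s b R M r₀ : ℝ} {W : Finset (EuclideanSpace ℝ (Fin (d + 1)))}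
    (hX : NodeState I 𝒩 n X₀ D η δ τ s X) (hs1 : s < 1)
    (hs0 : 0 ≤ s) (hR : 0 < R) (hR1 : R ≤ 1) (hW : IsNet W R) (hδ : δ ≤ R / 2)
    (hδ0 : 0 < δ) (hη : 0 < η) (hτ : 0 < τ) (hb : 0 ≤ b) (hr₀ : 0 < r₀) (h𝒩 : ∀ P, 0 ≤ 𝒩 P)
    (hlow : ∀ P : MvPolynomial (Fin d) ℝ, P.totalDegree ≤ n →
      τ * 𝒩 P ≤ b * ∑ y ∈ W, ∑ p : Fin (d + 1) × Fin (d + 1),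
        |∑ j, tent y R (X j) * pEval (angDeriv p.1 p.2 (liftPoly P)) (X j)|)
    (hD : D = ((d + 1 : ℕ) : ℝ) ^ 2 * (2 * (2 * b))) (hDR : D ≤ R / 12) (hM0 : 0 ≤ M)
    (hM : ∀ P : MvPolynomial (Fin d) ℝ, P.totalDegree ≤ n → ∀ x ∈ upSphere d, ∀ y, ‖y‖ = 1 →
      ‖y - x‖ ≤ r₀ → angNormTwo (liftPoly P) y ≤ M * 𝒩 P) :
    ∃ h : ℝ, 0 < h ∧ s + h ≤ 1 ∧ ∃ X', NodeState I 𝒩 n X₀ D η δ τ (s + h) X' := by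
  have hs : 0 < 1 - s := by linarith
  obtain ⟨θ, hθ, hθv⟩ := exists_tentField_repr W R X I n (a := 2 * b) (c := -(2 / (1 - s)))
    (by positivity) (fun P hP => by
      rw [abs_mul, abs_neg, abs_of_pos (by positivity)]
      have h1 := mul_le_mul_of_nonneg_left (hX.defect P hP) (by positivity : 0 ≤ 2 / (1 - s))
      refine h1.trans ?_
      rw [show 2 / (1 - s) * ((1 - s) * τ * 𝒩 P) = 2 * (τ * 𝒩 P) by
        field_simp]
      rw [mul_assoc]
      exact mul_le_mul_of_nonneg_left (hlow P hP) zero_le_two)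
  have hD0 : 0 ≤ D := by rw [hD]; positivity
  set U := fun j => tentField W R θ (X j) with hU
  have hUD : ∀ j, ‖U j‖ ≤ D := fun j => by
    rw [hD]
    exact norm_tentField_le hR hW.sep (by positivity) hθ (hX.norm_eq j)
  have hUL : ∀ i j, ‖U i - U j‖ ≤ 1 / 4 * dist (X i) (X j) := fun i j => by
    refine (norm_tentField_sub_le hR hR1 hW.sep (by positivity) hθ (hX.norm_eq i)).trans ?_
    refine mul_le_mul_of_nonneg_right ?_ dist_nonneg
    rw [show ((d + 1 : ℕ) : ℝ) ^ 2 * (6 * (2 * b) / R) = 3 * D / R by rw [hD]; ring,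
      div_le_iff₀ hR]
    linarith
  obtain ⟨h, h0, hh⟩ := exists_pos_mul_le ![2, 1, D, D, 16 * D ^ 2, N * (M * D ^ 2)]
    ![1 - s, 1, 1, r₀, η, τ] (by
      intro i
      fin_cases i <;> simp [hs, hr₀, hη, hτ])
  have hh0 : h * 2 ≤ 1 - s := hh 0
  have hh1 : h * 1 ≤ 1 := hh 1
  have hh2 : h * D ≤ 1 := hh 2
  have hh3 : h * D ≤ r₀ := hh 3
  have hh4 : h * (16 * D ^ 2) ≤ η := hh 4
  have hh5 : h * (N * (M * D ^ 2)) ≤ τ := hh 5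
  clear hh
  have hinner : ∀ j, inner ℝ (X j) (h • U j) = 0 := fun j => by
    rw [inner_smul_right, hU, inner_tentField, mul_zero]
  have hnorm : ∀ j, ‖h • U j‖ ≤ h * D := fun j => by
    rw [norm_smul, Real.norm_eq_abs, abs_of_pos h0]
    exact mul_le_mul_of_nonneg_left (hUD j) h0.le
  have hup : ∀ j, X j ∈ upSphere d := fun j => ⟨hX.norm_eq j, hδ0.le.trans (hX.le_last j)⟩
  have hmove : ∀ j, dist (sphExp (X j) (h • U j)) (X j) ≤ h * D := fun j => by
    rw [dist_eq_norm]
    exact (norm_sphExp_sub_le (hX.norm_eq j) (hinner j)).trans (hnorm j)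
  refine ⟨h, h0, by linarith, fun j => sphExp (X j) (h • U j), ?_, ?_, ?_, ?_, ?_⟩
  · exact fun j => norm_sphExp (hX.norm_eq j) (hinner j)
  · intro j
    by_cases hj : ∀ y ∈ W, R ≤ dist (X j) y
    · have h1 : U j = 0 := tentField_eq_zero hR θ hj
      have h2 : sphExp (X j) (h • U j) = X j := by simp [h1, sphExp, greatCircle]
      rw [h2]
      exact hX.le_last j
    · push Not at hj
      obtain ⟨y, hy, hyj⟩ := hj
      have h1 := hW.le_last y hy
      have h2 : |(sphExp (X j) (h • U j) - y) (Fin.last d)| ≤ h * D + R := by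
        refine (PiLp.norm_apply_le (sphExp (X j) (h • U j) - y) _).trans ?_
        rw [← dist_eq_norm]
        exact (dist_triangle _ (X j) _).trans (add_le_add (hmove j) hyj.le)
      rw [PiLp.sub_apply] at h2
      have h3 : h * D ≤ R / 12 := by nlinarith
      linarith [(abs_le.1 h2).1]
  · intro j
    refine (dist_triangle _ (X j) _).trans ?_
    linarith [hmove j, hX.dist_le j]
  · intro i j hij
    have h1 := hX.sep i j hij
    have he : ∀ j, ‖sphExp (X j) (h • U j) - X j - h • U j‖ ≤ (h * D) ^ 2 := fun j =>
      (norm_sphExp_sub_sub_le (hX.norm_eq j) ((hnorm j).trans hh2)).trans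
        (pow_le_pow_left₀ (norm_nonneg _) (hnorm j) 2)
    have h2 : dist (X i) (X j) ≤ dist (sphExp (X i) (h • U i)) (sphExp (X j) (h • U j)) +
        h * (1 / 4 * dist (X i) (X j)) + (h * D) ^ 2 + (h * D) ^ 2 := by
      rw [dist_eq_norm, dist_eq_norm, show X i - X j =
        (sphExp (X i) (h • U i) - sphExp (X j) (h • U j)) - h • (U i - U j) -
        (sphExp (X i) (h • U i) - X i - h • U i) + (sphExp (X j) (h • U j) - X j - h • U j) by
        module]
      refine (norm_add_le _ _).trans (add_le_add ((norm_sub_le _ _).trans (add_le_add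
        ((norm_sub_le _ _).trans (add_le_add le_rfl ?_)) (he i))) (he j))
      rw [norm_smul, Real.norm_eq_abs, abs_of_pos h0]
      refine mul_le_mul_of_nonneg_left ((hUL i j).trans_eq ?_) h0.le
      rw [dist_eq_norm]
      congr 2
      module
    have h3 : η / 2 ≤ dist (X i) (X j) := by nlinarith
    have h4 : 2 * (h * D) ^ 2 ≤ h * (1 / 4 * dist (X i) (X j)) := by nlinarith
    nlinarith
  · intro P hP
    have h1 := hX.defect P hP
    have h2 : ∀ j, |pEval (liftPoly P) (sphExp (X j) (h • U j)) - pEval (liftPoly P) (X j) -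
        ∑ k, (h • U j) k * pEval (MvPolynomial.pderiv k (liftPoly P)) (X j)| ≤
        M * 𝒩 P * (h * D) ^ 2 := fun j => by
      refine (abs_pEval_sphExp_sub_sub_le (hX.norm_eq j) (hinner j) _ fun y hy1 hy2 =>
        hM P hP (X j) (hup j) y hy1 (hy2.trans ((hnorm j).trans hh3))).trans ?_
      refine mul_le_mul_of_nonneg_left (pow_le_pow_left₀ (norm_nonneg _) (hnorm j) 2)
        (mul_nonneg hM0 (h𝒩 P))
    have h3 : |∑ j, (pEval (liftPoly P) (sphExp (X j) (h • U j)) - pEval (liftPoly P) (X j) -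
        ∑ k, (h • U j) k * pEval (MvPolynomial.pderiv k (liftPoly P)) (X j))| ≤
        N * (M * 𝒩 P * (h * D) ^ 2) := by
      refine (Finset.abs_sum_le_sum_abs _ _).trans
        ((Finset.sum_le_card_nsmul _ _ _ fun j _ => h2 j).trans_eq ?_)
      rw [Finset.card_univ, Fintype.card_fin, nsmul_eq_mul]
    have h4 : ∑ j, ∑ k, (h • U j) k * pEval (MvPolynomial.pderiv k (liftPoly P)) (X j) =
        h * (-(2 / (1 - s)) * (∑ j, pEval (liftPoly P) (X j) - I P)) := by
      rw [← hθv P hP, Finset.mul_sum]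
      refine Finset.sum_congr rfl fun j _ => ?_
      rw [Finset.mul_sum]
      refine Finset.sum_congr rfl fun k _ => ?_
      rw [PiLp.smul_apply, smul_eq_mul, mul_assoc]
    rw [Finset.sum_sub_distrib, Finset.sum_sub_distrib, h4] at h3
    set A := ∑ j, pEval (liftPoly P) (sphExp (X j) (h • U j))
    set B := ∑ j, pEval (liftPoly P) (X j)
    have h5 : N * (M * 𝒩 P * (h * D) ^ 2) ≤ h * τ * 𝒩 P := by
      have := mul_le_mul_of_nonneg_left hh5 (mul_nonneg h0.le (h𝒩 P))
      calc _ = h * 𝒩 P * (h * (N * (M * D ^ 2))) := by ring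
        _ ≤ _ := this
        _ = _ := by ring
    have h6 : A - I P = (A - B - h * (-(2 / (1 - s)) * (B - I P))) +
        (1 - 2 * h / (1 - s)) * (B - I P) := by ring
    have h7 : 0 ≤ 1 - 2 * h / (1 - s) := by
      rw [sub_nonneg, div_le_one hs]
      linarith
    rw [h6]
    refine (abs_add_le _ _).trans ?_
    rw [abs_mul, abs_of_nonneg h7]
    have h8 := mul_le_mul_of_nonneg_left h1 h7
    have h9 : (1 - 2 * h / (1 - s)) * ((1 - s) * τ * 𝒩 P) = (1 - s - 2 * h) * τ * 𝒩 P := by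
      field_simp
    have h10 := h3.trans h5
    rw [h9] at h8
    calc _ ≤ h * τ * 𝒩 P + (1 - s - 2 * h) * τ * 𝒩 P := add_le_add h10 h8
      _ = _ := by ring

theorem isCompact_setOf_nodeState {N n : ℕ} (I : MvPolynomial (Fin d) ℝ →ₗ[ℝ] ℝ)
    (𝒩 : MvPolynomial (Fin d) ℝ → ℝ) (X₀ : Fin N → EuclideanSpace ℝ (Fin (d + 1)))
    (D η δ τ : ℝ) :
    IsCompact {q : ℝ × (Fin N → EuclideanSpace ℝ (Fin (d + 1))) |
      q.1 ∈ Icc (0 : ℝ) 1 ∧ NodeState I 𝒩 n X₀ D η δ τ q.1 q.2} := by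
  have hK : IsCompact (Icc (0 : ℝ) 1 ×ˢ
      (univ.pi fun _ => Metric.closedBall 0 1 : Set (Fin N → EuclideanSpace ℝ (Fin (d + 1))))) :=
    isCompact_Icc.prod (isCompact_univ_pi fun _ => isCompact_closedBall _ _)
  refine hK.of_isClosed_subset ?_ fun q hq => ⟨hq.1, fun j _ => by
    simp [hq.2.norm_eq j]⟩
  have h1 : {q : ℝ × (Fin N → EuclideanSpace ℝ (Fin (d + 1))) |
      q.1 ∈ Icc (0 : ℝ) 1 ∧ NodeState I 𝒩 n X₀ D η δ τ q.1 q.2} =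
      {q | q.1 ∈ Icc (0 : ℝ) 1} ∩ ({q | ∀ j, ‖q.2 j‖ = 1} ∩ {q | ∀ j, δ ≤ q.2 j (Fin.last d)} ∩
        {q | ∀ j, dist (q.2 j) (X₀ j) ≤ q.1 * D} ∩
        {q | ∀ i j, i ≠ j → (1 - q.1 / 2) * η ≤ dist (q.2 i) (q.2 j)} ∩
        {q | ∀ P : MvPolynomial (Fin d) ℝ, P.totalDegree ≤ n →
          |∑ j, pEval (liftPoly P) (q.2 j) - I P| ≤ (1 - q.1) * τ * 𝒩 P}) := by
    ext q
    refine ⟨fun h => ⟨h.1, ⟨⟨⟨h.2.1, h.2.2⟩, h.2.3⟩, h.2.4⟩, h.2.5⟩,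
      fun h => ⟨h.1, h.2.1.1.1.1, h.2.1.1.1.2, h.2.1.1.2, h.2.1.2, h.2.2⟩⟩
  have hc : ∀ j : Fin N, Continuous
      fun q : ℝ × (Fin N → EuclideanSpace ℝ (Fin (d + 1))) => q.2 j :=
    fun j => (continuous_apply j).comp continuous_snd
  rw [h1]
  refine (isClosed_Icc.preimage continuous_fst).inter
    ((((IsClosed.inter ?_ ?_).inter ?_).inter ?_).inter ?_)
  · simp only [ofPred_forall]
    exact isClosed_iInter fun j => isClosed_eq (hc j).norm continuous_const
  · simp only [ofPred_forall]
    exact isClosed_iInter fun j => isClosed_le continuous_const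
      ((EuclideanSpace.proj (𝕜 := ℝ) (Fin.last d)).continuous.comp (hc j))
  · simp only [ofPred_forall]
    exact isClosed_iInter fun j => isClosed_le ((hc j).dist continuous_const)
      (continuous_fst.mul continuous_const)
  · simp only [ofPred_forall]
    exact isClosed_iInter fun i => isClosed_iInter fun j => isClosed_iInter fun _ =>
      isClosed_le (by fun_prop) ((hc i).dist (hc j))
  · simp only [ofPred_forall]
    refine isClosed_iInter fun P => isClosed_iInter fun _ => isClosed_le ?_ (by fun_prop)
    exact ((continuous_finsetSum _ fun j _ => (continuous_pEval _).comp (hc j)).sub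
      continuous_const).abs

theorem NodeState.exists_final {N n : ℕ} {I : MvPolynomial (Fin d) ℝ →ₗ[ℝ] ℝ}
    {𝒩 : MvPolynomial (Fin d) ℝ → ℝ} {X₀ : Fin N → EuclideanSpace ℝ (Fin (d + 1))}
    {D η δ τ b R M r₀ : ℝ} {W : Finset (EuclideanSpace ℝ (Fin (d + 1)))}
    (hX₀ : NodeState I 𝒩 n X₀ D η δ τ 0 X₀) (hR : 0 < R) (hR1 : R ≤ 1) (hW : IsNet W R)
    (hδ : δ ≤ R / 2) (hδ0 : 0 < δ) (hη : 0 < η) (hτ : 0 < τ) (hb : 0 ≤ b) (hr₀ : 0 < r₀)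
    (h𝒩 : ∀ P, 0 ≤ 𝒩 P)
    (hlow : ∀ X : Fin N → EuclideanSpace ℝ (Fin (d + 1)), (∀ j, ‖X j‖ = 1) →
      (∀ j, dist (X j) (X₀ j) ≤ R / 12) → ∀ P : MvPolynomial (Fin d) ℝ, P.totalDegree ≤ n →
      τ * 𝒩 P ≤ b * ∑ y ∈ W, ∑ p : Fin (d + 1) × Fin (d + 1),
        |∑ j, tent y R (X j) * pEval (angDeriv p.1 p.2 (liftPoly P)) (X j)|)
    (hD : D = ((d + 1 : ℕ) : ℝ) ^ 2 * (2 * (2 * b))) (hDR : D ≤ R / 12) (hM0 : 0 ≤ M)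
    (hM : ∀ P : MvPolynomial (Fin d) ℝ, P.totalDegree ≤ n → ∀ x ∈ upSphere d, ∀ y, ‖y‖ = 1 →
      ‖y - x‖ ≤ r₀ → angNormTwo (liftPoly P) y ≤ M * 𝒩 P) :
    ∃ X, NodeState I 𝒩 n X₀ D η δ τ 1 X := by
  have hD0 : 0 ≤ D := by rw [hD]; positivity
  have hcl := ((isCompact_setOf_nodeState (n := n) I 𝒩 X₀ D η δ τ).image
    continuous_fst).isClosed
  set S : Set ℝ := {s | ∃ X, NodeState I 𝒩 n X₀ D η δ τ s X} with hS
  have h1 : S ∩ Icc 0 1 = Prod.fst '' {q : ℝ × (Fin N → EuclideanSpace ℝ (Fin (d + 1))) |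
      q.1 ∈ Icc (0 : ℝ) 1 ∧ NodeState I 𝒩 n X₀ D η δ τ q.1 q.2} := by
    ext s
    constructor
    · rintro ⟨⟨X, hX⟩, hs⟩
      exact ⟨(s, X), ⟨hs, hX⟩, rfl⟩
    · rintro ⟨⟨s, X⟩, ⟨hs, hX⟩, rfl⟩
      exact ⟨⟨X, hX⟩, hs⟩
  change (1 : ℝ) ∈ S
  refine IsClosed.mem_of_ge_of_forall_exists_gt (h1 ▸ hcl : IsClosed (S ∩ Icc 0 1)) ⟨X₀, hX₀⟩
    zero_le_one ?_
  rintro s ⟨⟨X, hX⟩, hs0, hs1⟩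
  obtain ⟨h, hh, hsh, X', hX'⟩ := hX.exists_step hs1 hs0 hR hR1 hW hδ hδ0 hη hτ hb hr₀ h𝒩
    (hlow X hX.norm_eq fun j => (hX.dist_le j).trans (by nlinarith)) hD hDR hM0 hM
  exact ⟨s + h, ⟨X', hX'⟩, by linarith, hsh⟩

theorem sphSup_nonneg {f : EuclideanSpace ℝ (Fin d) → ℝ} (hf : ∀ x, 0 ≤ f x)
    (x : EuclideanSpace ℝ (Fin d)) (r : ℝ) : 0 ≤ sphSup f x r :=
  Real.sSup_nonneg (by rintro _ ⟨y, -, rfl⟩; exact hf y)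

theorem netNorm_nonneg (ω : Measure (EuclideanSpace ℝ (Fin (d + 1))))
    (V : Finset (EuclideanSpace ℝ (Fin (d + 1)))) (n : ℕ) (P : MvPolynomial (Fin d) ℝ) :
    0 ≤ netNorm ω V n P :=
  Finset.sum_nonneg fun _ _ => mul_nonneg measureReal_nonneg (sphSup_nonneg (angNorm_nonneg _) _ _)

/-- Approximate cubature nodes can be deformed into exact ones. -/
theorem exists_nodes_of_near (d s : ℕ) : ∃ c C : ℝ, 0 < c ∧ c ≤ 1 / 100 ∧ 0 < C ∧
    ∀ ω : Measure (EuclideanSpace ℝ (Fin (d + 1))), HalfDoubling s ω → ∀ n : ℕ, 0 < n →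
    ∀ V W : Finset (EuclideanSpace ℝ (Fin (d + 1))), IsNet V (1 / (20 * n)) → IsNet W (c / n) →
    ∀ (N : ℕ) (κ τ η : ℝ), 0 < N → 0 < κ → 0 < τ → 0 < η → C * κ * τ * n ≤ N →
    ∀ (I : MvPolynomial (Fin d) ℝ →ₗ[ℝ] ℝ) (X₀ : Fin N → EuclideanSpace ℝ (Fin (d + 1))),
      (∀ j, ‖X₀ j‖ = 1) → (∀ j, 0 < X₀ j (Fin.last d)) →
      (∀ i j, i ≠ j → η ≤ dist (X₀ i) (X₀ j)) →
      (∀ y ∈ W, N * ω.real (Metric.closedBall y (c / n)) ≤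
        κ * (Finset.univ.filter fun j => dist (X₀ j) y ≤ c / n / 2).card) →
      (∀ P : MvPolynomial (Fin d) ℝ, P.totalDegree ≤ n →
        |∑ j, pEval (liftPoly P) (X₀ j) - I P| ≤ τ * netNorm ω V n P) →
      ∃ X : Fin N → EuclideanSpace ℝ (Fin (d + 1)), (∀ j, ‖X j‖ = 1) ∧
        (∀ j, 0 < X j (Fin.last d)) ∧ (∀ i j, i ≠ j → η / 2 ≤ dist (X i) (X j)) ∧
        ∀ P : MvPolynomial (Fin d) ℝ, P.totalDegree ≤ n →
          ∑ j, pEval (liftPoly P) (X j) = I P := by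
  obtain ⟨c, C₁, hc, hc1, hC₁, hlow⟩ := exists_lower_bound d s
  obtain ⟨C₂, hC₂, hbern⟩ := exists_bernstein_sum d s
  refine ⟨c, 48 * (d + 1) ^ 2 * C₁ / c, hc, hc1, by positivity, ?_⟩
  intro ω hω n hn V W hV hW N κ τ η hN hκ hτ hη hsmall I X₀ hX1 hX2 hX3 hX4 hX5
  have hN' : (0 : ℝ) < N := by exact_mod_cast hN
  have hn' : (1 : ℝ) ≤ n := by exact_mod_cast hn
  have hn0 : (0 : ℝ) < n := by linarith
  have hR : 0 < c / n := by positivity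
  have hR1 : c / n ≤ 1 := by
    rw [div_le_one hn0]
    linarith
  obtain ⟨δ, hδ0, hδ⟩ := exists_pos_mul_le (fun _ : Option (Fin N) => 1)
    (fun o => o.elim (c / n / 2) fun j => X₀ j (Fin.last d)) (by
      rintro (_ | j)
      · exact half_pos hR
      · exact hX2 j)
  simp only [mul_one] at hδ
  obtain ⟨μ, hμ0, hμ⟩ := exists_pos_mul_le (fun _ : V => 1)
    (fun v => ω.real (Metric.closedBall (v : EuclideanSpace ℝ (Fin (d + 1))) (1 / n)))
    (fun v => hω.mass_pos (hV.mem (by positivity) v.2) (by positivity))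
  simp only [mul_one] at hμ
  have h0 : NodeState I (netNorm ω V n) n X₀
      (((d + 1 : ℕ) : ℝ) ^ 2 * (2 * (2 * (τ * (C₁ * κ) / N)))) η δ τ 0 X₀ :=
    ⟨hX1, fun j => hδ (some j), fun j => by simp, fun i j hij => by simpa using hX3 i j hij,
      fun P hP => by simpa using hX5 P hP⟩
  obtain ⟨X, hX⟩ := h0.exists_final (b := τ * (C₁ * κ) / N) (M := C₂ * n / μ) (r₀ := 1 / n)
    (W := W) hR hR1 hW (hδ none) hδ0 hη hτ (by positivity) (by positivity) (netNorm_nonneg ω V n)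
    (fun X h1 h2 P hP => by
      have h3 := hlow ω hω n hn V W hV hW P hP N κ hκ X X₀ h1 h2 hX4
      rw [div_mul_eq_mul_div, le_div_iff₀ hN', mul_assoc, mul_assoc]
      refine mul_le_mul_of_nonneg_left ?_ hτ.le
      rw [mul_comm (netNorm ω V n P)]
      exact h3) rfl (by
      rw [show ((d + 1 : ℕ) : ℝ) ^ 2 * (2 * (2 * (τ * (C₁ * κ) / N))) =
        48 * (d + 1) ^ 2 * C₁ / c * κ * τ * n / N * (c / n / 12) by
          push_cast
          field_simp
          ring]
      exact mul_le_of_le_one_left (by positivity) ((div_le_one hN').2 hsmall)) (by positivity)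
    (fun P hP x hx y hy hyx => by
      obtain ⟨v, hv, hxv⟩ := hV.cover x hx
      have h1 : dist y v ≤ 3 / n := by
        refine (dist_triangle _ x _).trans ?_
        rw [dist_eq_norm y x]
        calc _ ≤ 1 / (n : ℝ) + 10 * (1 / (20 * n)) := add_le_add hyx hxv
          _ = 3 / 2 / n := by field_simp; norm_num
          _ ≤ 3 / n := by gcongr; norm_num
      have h2 := le_sphSup (continuous_angNormTwo (liftPoly P)) hy h1
      have h3 := hbern ω hω n hn V hV P hP
      have h4 := Finset.single_le_sum (s := V) (f := fun v => ω.real (Metric.closedBall v (1 / n)) *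
        sphSup (angNormTwo (liftPoly P)) v (3 / n)) (fun v _ => mul_nonneg measureReal_nonneg
          (sphSup_nonneg (angNormTwo_nonneg _) _ _)) hv
      have h5 := mul_le_mul (hμ ⟨v, hv⟩) h2 (angNormTwo_nonneg _ _) measureReal_nonneg
      rw [div_mul_eq_mul_div, le_div_iff₀ hμ0, mul_comm]
      exact h5.trans (h4.trans h3))
  refine ⟨X, hX.norm_eq, fun j => hδ0.trans_le (hX.le_last j), fun i j hij => ?_, fun P hP => ?_⟩
  · have := hX.sep i j hij
    linarith
  · have := hX.defect P hP
    rw [sub_self, zero_mul, zero_mul] at this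
    exact sub_eq_zero.1 (abs_nonpos_iff.1 this)

/-- Rounding of real weights to integers, carrying the fractional parts towards the root of a
tree. -/
theorem exists_rounding {ι : Type*} [DecidableEq ι] (parent : ι → ι) (rank : ι → ℝ) (root : ι) :
    ∀ (k : ℕ) (A : Finset ι), A.card = k → root ∈ A →
      (∀ i ∈ A, i ≠ root → parent i ∈ A ∧ rank (parent i) < rank i) →
      ∀ (a : ι → ℝ) (N : ℤ), ∑ i ∈ A, a i = N →
      ∃ m : ι → ℤ, ∑ i ∈ A, m i = N ∧ (∀ i ∈ A, ⌊a i⌋ ≤ m i) ∧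
        (∀ i ∈ A, (m i : ℝ) ≤ a i + (A.filter fun j => j ≠ root ∧ parent j = i).card) ∧
        ∀ g : ι → ℝ, |∑ i ∈ A, ((m i : ℝ) - a i) * g i| ≤ ∑ i ∈ A, |g i - g (parent i)| := by
  intro k
  induction k with
  | zero =>
    intro A hA hroot
    rw [Finset.card_eq_zero.1 hA] at hroot
    simp at hroot
  | succ k ih =>
    intro A hA hroot hpar a N hN
    rcases (A.erase root).eq_empty_or_nonempty with h0 | h0
    · have h1 : A = {root} := by
        rw [← Finset.insert_erase hroot, h0]
        rfl
      subst h1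
      rw [Finset.sum_singleton] at hN
      refine ⟨fun _ => N, by simp, ?_, ?_, ?_⟩
      · simp [hN]
      · simp [hN]
      · intro g
        simp [hN]
    obtain ⟨l, hl, hmax⟩ := (A.erase root).exists_max_image rank h0
    obtain ⟨hlr, hlA⟩ := Finset.mem_erase.1 hl
    have hnl : ∀ i ∈ A, i ≠ root → parent i ≠ l := fun i hi hir h => by
      have h1 := (hpar i hi hir).2
      rw [h] at h1
      exact (hmax i (Finset.mem_erase.2 ⟨hir, hi⟩)).not_gt h1
    obtain ⟨hp, -⟩ := hpar l hlA hlr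
    set p := parent l with hpdef
    have hpl : p ≠ l := hnl l hlA hlr
    have hp' : p ∈ A.erase l := Finset.mem_erase.2 ⟨hpl, hp⟩
    obtain ⟨m, hm1, hm2, hm3, hm4⟩ := ih (A.erase l) (by rw [Finset.card_erase_of_mem hlA, hA]; rfl)
      (Finset.mem_erase.2 ⟨hlr.symm, hroot⟩)
      (fun i hi hir => by
        have hi := Finset.mem_of_mem_erase hi
        exact ⟨Finset.mem_erase.2 ⟨hnl i hi hir, (hpar i hi hir).1⟩, (hpar i hi hir).2⟩)
      (fun i => a i + if i = p then Int.fract (a l) else 0) (N - ⌊a l⌋) (by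
        rw [Finset.sum_add_distrib, Finset.sum_ite_eq' (A.erase l) p, if_pos hp',
          Finset.sum_erase_eq_sub hlA, hN, Int.fract]
        push_cast
        ring)
    have hne : ∀ i ∈ A.erase l, i ≠ l := fun i hi => Finset.ne_of_mem_erase hi
    refine ⟨fun i => if i = l then ⌊a l⌋ else m i, ?_, ?_, ?_, ?_⟩
    · rw [← Finset.add_sum_erase A _ hlA, if_pos rfl,
        Finset.sum_congr rfl fun i hi => if_neg (hne i hi), hm1]
      ring
    · intro i hi
      beta_reduce
      by_cases hil : i = l
      · rw [if_pos hil, hil]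
      rw [if_neg hil]
      refine le_trans (Int.floor_le_floor ?_) (hm2 i (Finset.mem_erase.2 ⟨hil, hi⟩))
      refine le_add_of_nonneg_right ?_
      split_ifs
      exacts [Int.fract_nonneg _, le_rfl]
    · intro i hi
      beta_reduce
      by_cases hil : i = l
      · rw [if_pos hil, hil]
        exact (Int.floor_le _).trans (le_add_of_nonneg_right (Nat.cast_nonneg _))
      rw [if_neg hil]
      refine (hm3 i (Finset.mem_erase.2 ⟨hil, hi⟩)).trans ?_
      rw [add_assoc]
      refine add_le_add_right ?_ _
      by_cases hip : i = p
      · rw [if_pos hip]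
        have h1 : ((A.erase l).filter fun j => j ≠ root ∧ parent j = i).card + 1 ≤
            (A.filter fun j => j ≠ root ∧ parent j = i).card := by
          rw [Finset.filter_erase, Finset.card_erase_add_one
            (Finset.mem_filter.2 ⟨hlA, hlr, hip.symm⟩)]
        have h2 : (((A.erase l).filter fun j => j ≠ root ∧ parent j = i).card : ℝ) + 1 ≤
            (A.filter fun j => j ≠ root ∧ parent j = i).card := by exact_mod_cast h1
        linarith [Int.fract_lt_one (a l)]
      · rw [if_neg hip, zero_add]
        exact_mod_cast Finset.card_le_card (Finset.filter_subset_filter _ (Finset.erase_subset _ _))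
    · intro g
      beta_reduce
      rw [← Finset.add_sum_erase A _ hlA, if_pos rfl,
        ← Finset.add_sum_erase A (fun i => |g i - g (parent i)|) hlA]
      have h1 : ∑ i ∈ A.erase l, (((if i = l then ⌊a l⌋ else m i : ℤ) : ℝ) - a i) * g i =
          ∑ i ∈ A.erase l, ((m i : ℝ) - (a i + if i = p then Int.fract (a l) else 0)) * g i +
          Int.fract (a l) * g p := by
        rw [show Int.fract (a l) * g p =
          ∑ i ∈ A.erase l, (if i = p then Int.fract (a l) * g i else 0) by
            rw [Finset.sum_ite_eq' (A.erase l) p, if_pos hp'], ← Finset.sum_add_distrib]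
        refine Finset.sum_congr rfl fun i hi => ?_
        rw [if_neg (hne i hi)]
        split_ifs <;> ring
      rw [h1]
      have h2 := hm4 g
      have h3 : ((⌊a l⌋ : ℝ) - a l) * g l + Int.fract (a l) * g p =
          -(Int.fract (a l) * (g l - g p)) := by
        rw [Int.fract]
        ring
      calc _ = |-(Int.fract (a l) * (g l - g p)) + ∑ i ∈ A.erase l,
            ((m i : ℝ) - (a i + if i = p then Int.fract (a l) else 0)) * g i| := by
              rw [← h3]
              congr 1
              ring
        _ ≤ _ := (abs_add_le _ _).trans (add_le_add ?_ h2)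
      rw [abs_neg, abs_mul, abs_of_nonneg (Int.fract_nonneg _)]
      exact mul_le_of_le_one_left (abs_nonneg _) (Int.fract_lt_one _).le

/-- Every net point away from the pole has a nearby net point closer to the pole. -/
theorem IsNet.exists_dist_lt {V : Finset (EuclideanSpace ℝ (Fin (d + 1)))} {r : ℝ}
    (hV : IsNet V r) (hr : 0 < r) (hr1 : r ≤ 1 / 220) {v : EuclideanSpace ℝ (Fin (d + 1))}
    (hv : v ∈ V) (hve : 110 * r ≤ dist v (EuclideanSpace.single (Fin.last d) 1)) :
    ∃ w ∈ V, dist v w ≤ 32 * r ∧ dist w (EuclideanSpace.single (Fin.last d) 1) <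
      dist v (EuclideanSpace.single (Fin.last d) 1) := by
  set e : EuclideanSpace ℝ (Fin (d + 1)) := EuclideanSpace.single (Fin.last d) 1 with he
  have hin : ∀ x : EuclideanSpace ℝ (Fin (d + 1)), inner ℝ x e = x (Fin.last d) := fun x => by
    simp [e, EuclideanSpace.inner_single_right]
  have he1 : ‖e‖ = 1 := by simp [e]
  have hsq : ∀ x : EuclideanSpace ℝ (Fin (d + 1)), ‖x‖ = 1 →
      dist x e ^ 2 = 2 - 2 * x (Fin.last d) := fun x hx => by
    rw [dist_eq_norm, norm_sub_sq_real, hx, he1, hin]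
    ring
  have hv1 := hV.norm_eq v hv
  have hy0 : 0 ≤ v (Fin.last d) := by linarith [hV.le_last v hv]
  set y := v (Fin.last d) with hy
  set D := dist v e with hD
  have hD2 : D ^ 2 = 2 - 2 * y := hsq v hv1
  set u := e - y • v with hu
  have hvu : inner ℝ v u = 0 := by
    rw [hu, inner_sub_right, hin, inner_smul_right, real_inner_self_eq_norm_sq, hv1]
    ring
  have hue : inner ℝ u e = 1 - y ^ 2 := by
    rw [hu, inner_sub_left, real_inner_smul_left, hin v, real_inner_self_eq_norm_sq, he1]
    ring
  have hu2 : ‖u‖ ^ 2 = 1 - y ^ 2 := by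
    rw [← real_inner_self_eq_norm_sq]
    nth_rw 2 [hu]
    rw [inner_sub_right, hue, inner_smul_right, real_inner_comm, hvu]
    ring
  have hD0 : 0 < D := lt_of_lt_of_le (by positivity) hve
  have hu3 : D ^ 2 / 2 ≤ ‖u‖ ^ 2 := by
    rw [hu2, hD2]
    nlinarith
  have hu0 : 0 < ‖u‖ := by
    by_contra! h
    have : ‖u‖ = 0 := le_antisymm h (norm_nonneg _)
    rw [this] at hu3
    nlinarith
  have hu4 : 7 / 10 * D ≤ ‖u‖ := by
    refine le_of_sq_le_sq ?_ hu0.le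
    nlinarith
  set U := (22 * r / ‖u‖) • u with hU
  have hUn : ‖U‖ = 22 * r := by
    rw [hU, norm_smul, Real.norm_eq_abs, abs_of_pos (by positivity)]
    field_simp
  have hvU : inner ℝ v U = 0 := by rw [hU, inner_smul_right, hvu, mul_zero]
  have hUe : inner ℝ U e = 22 * r * ‖u‖ := by
    rw [hU, real_inner_smul_left, hue, ← hu2]
    field_simp
  have h1 : ‖v - e + U‖ ≤ D - 66 / 5 * r := by
    refine le_of_sq_le_sq ?_ (by linarith)
    rw [norm_add_sq_real, ← dist_eq_norm, inner_sub_left, hvU, real_inner_comm, hUe, hUn]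
    nlinarith
  have h2 := norm_sphExp_sub_le hv1 hvU
  have h3 := norm_sphExp_sub_sub_le (x := v) (U := U) hv1 (by rw [hUn]; linarith)
  have h4 : dist (sphExp v U) e ≤ D - 11 * r := by
    rw [dist_eq_norm, show sphExp v U - e = (v - e + U) + (sphExp v U - v - U) by abel]
    refine (norm_add_le _ _).trans ?_
    rw [hUn] at h3
    nlinarith
  have h5 : sphExp v U ∈ upSphere d := by
    refine ⟨norm_sphExp hv1 hvU, ?_⟩
    have h6 := hsq _ (norm_sphExp hv1 hvU)
    have h7 : dist (sphExp v U) e ^ 2 ≤ D ^ 2 :=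
      pow_le_pow_left₀ dist_nonneg (by linarith) 2
    linarith
  obtain ⟨w, hw, hxw⟩ := hV.cover _ h5
  refine ⟨w, hw, ?_, ?_⟩
  · rw [hUn, ← dist_eq_norm, dist_comm] at h2
    linarith [dist_triangle v (sphExp v U) w]
  · linarith [dist_triangle_left w e (sphExp v U)]

/-- Separated points on a spherical cap. -/
theorem exists_separated_near {v : EuclideanSpace ℝ (Fin (d + 1))} (hv : ‖v‖ = 1) {r η : ℝ}
    (hr : 0 < r) (hr1 : r ≤ 1) (hη : 0 < η) {m : ℕ} (hm : m * (8 * η) ^ d ≤ r ^ d) :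
    ∃ A : Finset (EuclideanSpace ℝ (Fin (d + 1))), A.card = m ∧ (∀ x ∈ A, ‖x‖ = 1) ∧
      (∀ x ∈ A, dist x v ≤ r / 4) ∧ ∀ x ∈ A, ∀ y ∈ A, x ≠ y → η ≤ dist x y := by
  classical
  obtain ⟨B, hB1, hB2, hB3⟩ := exists_maximal_separated (d := d)
    (A := Metric.closedBall 0 (r / 8)) (Metric.closedBall_subset_closedBall (by linarith)) hη
  have hcard : m ≤ B.card := by
    have h1 : volume (Metric.closedBall (0 : EuclideanSpace ℝ (Fin d)) (r / 8)) ≤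
        ∑ b ∈ B, volume (Metric.closedBall b η) := by
      refine (measure_mono ?_).trans (measure_biUnion_finset_le B _)
      intro x hx
      obtain ⟨b, hb, hxb⟩ := hB3 x hx
      exact mem_biUnion hb hxb.le
    simp only [Measure.addHaar_closedBall _ _ (by positivity : 0 ≤ r / 8),
      Measure.addHaar_closedBall _ _ hη.le, Finset.sum_const, nsmul_eq_mul,
      finrank_euclideanSpace_fin, ← mul_assoc] at h1
    have h2 : volume (Metric.ball (0 : EuclideanSpace ℝ (Fin d)) 1) ≠ 0 :=
      (Metric.measure_ball_pos _ _ one_pos).ne'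
    rw [ENNReal.mul_le_mul_iff_left h2 measure_ball_lt_top.ne, ← ENNReal.ofReal_natCast,
      ← ENNReal.ofReal_mul (by positivity), ENNReal.ofReal_le_ofReal_iff (by positivity)] at h1
    have h3 : (m : ℝ) * η ^ d ≤ B.card * η ^ d := by
      refine le_trans ?_ h1
      rw [div_pow, le_div_iff₀ (by positivity)]
      calc _ = (m : ℝ) * (8 * η) ^ d := by rw [mul_pow]; ring
        _ ≤ _ := hm
    exact_mod_cast le_of_mul_le_mul_right h3 (by positivity)
  obtain ⟨B', hB', hB'm⟩ := Finset.exists_subset_card_eq hcard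
  have : Fact (Module.finrank ℝ (EuclideanSpace ℝ (Fin (d + 1))) = d + 1) :=
    ⟨finrank_euclideanSpace_fin⟩
  have hv0 : v ≠ 0 := by
    rintro rfl
    simp at hv
  let φ := (OrthonormalBasis.fromOrthogonalSpanSingleton (𝕜 := ℝ) d hv0).repr.symm
  let ψ : EuclideanSpace ℝ (Fin d) → EuclideanSpace ℝ (Fin (d + 1)) := fun u =>
    Real.sqrt (1 - ‖u‖ ^ 2) • v + (φ u : EuclideanSpace ℝ (Fin (d + 1)))
  have hφ : ∀ u, ‖(φ u : EuclideanSpace ℝ (Fin (d + 1)))‖ = ‖u‖ := fun u => φ.norm_map u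
  have hφv : ∀ u, inner ℝ v (φ u : EuclideanSpace ℝ (Fin (d + 1))) = 0 := fun u =>
    Submodule.mem_orthogonal_singleton_iff_inner_right.1 (φ u).2
  have hB8 : ∀ u ∈ B', ‖u‖ ≤ r / 8 := fun u hu => by simpa using hB1 u (hB' hu)
  have hψ1 : ∀ (a : ℝ) (u : EuclideanSpace ℝ (Fin d)),
      ‖a • v + (φ u : EuclideanSpace ℝ (Fin (d + 1)))‖ ^ 2 = a ^ 2 + ‖u‖ ^ 2 := fun a u => by
    rw [norm_add_sq_real, real_inner_smul_left, hφv, norm_smul, hv, hφ, Real.norm_eq_abs, mul_one,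
      sq_abs]
    ring
  have hψd : ∀ u w, dist u w ≤ dist (ψ u) (ψ w) := fun u w => by
    refine le_of_sq_le_sq ?_ dist_nonneg
    rw [dist_eq_norm, dist_eq_norm, show ψ u - ψ w =
      (Real.sqrt (1 - ‖u‖ ^ 2) - Real.sqrt (1 - ‖w‖ ^ 2)) • v +
      (φ (u - w) : EuclideanSpace ℝ (Fin (d + 1))) by
      rw [map_sub, Submodule.coe_sub]
      simp only [ψ]
      module, hψ1]
    nlinarith [sq_nonneg (Real.sqrt (1 - ‖u‖ ^ 2) - Real.sqrt (1 - ‖w‖ ^ 2))]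
  have hψinj : Function.Injective ψ := fun u w h => by
    have := hψd u w
    rw [h, dist_self] at this
    exact dist_le_zero.1 this
  refine ⟨B'.image ψ, by rw [Finset.card_image_of_injective _ hψinj, hB'm], ?_, ?_, ?_⟩
  · intro x hx
    obtain ⟨u, hu, rfl⟩ := Finset.mem_image.1 hx
    have h1 := hB8 u hu
    have h2 : ‖ψ u‖ ^ 2 = 1 := by
      rw [hψ1, Real.sq_sqrt (by nlinarith [norm_nonneg u])]
      ring
    exact (pow_eq_one_iff_of_nonneg (norm_nonneg _) two_ne_zero).1 h2
  · intro x hx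
    obtain ⟨u, hu, rfl⟩ := Finset.mem_image.1 hx
    have h1 := hB8 u hu
    have h0 := norm_nonneg u
    have h3 : 1 - ‖u‖ ^ 2 ≤ Real.sqrt (1 - ‖u‖ ^ 2) := by
      refine Real.le_sqrt_of_sq_le ?_
      have h5 : ‖u‖ ^ 2 ≤ 1 := by nlinarith
      nlinarith [sq_nonneg ‖u‖]
    have h4 : Real.sqrt (1 - ‖u‖ ^ 2) ≤ 1 := Real.sqrt_le_one.2 (by nlinarith)
    refine le_of_sq_le_sq ?_ (by linarith)
    rw [dist_eq_norm, show ψ u - v = (Real.sqrt (1 - ‖u‖ ^ 2) - 1) • v +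
      (φ u : EuclideanSpace ℝ (Fin (d + 1))) by simp only [ψ]; module, hψ1]
    have h5 : (Real.sqrt (1 - ‖u‖ ^ 2) - 1) ^ 2 ≤ ‖u‖ ^ 2 := by
      refine sq_le_sq' ?_ ?_ <;> nlinarith
    nlinarith
  · intro x hx y hy hxy
    obtain ⟨u, hu, rfl⟩ := Finset.mem_image.1 hx
    obtain ⟨w, hw, rfl⟩ := Finset.mem_image.1 hy
    exact (hB2 u (hB' hu) w (hB' hw) fun h => hxy (by rw [h])).trans (hψd u w)

theorem exists_measurable_nearest {V : Finset (EuclideanSpace ℝ (Fin d))} (hV : V.Nonempty) :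
    ∃ f : EuclideanSpace ℝ (Fin d) → EuclideanSpace ℝ (Fin d), Measurable f ∧ (∀ x, f x ∈ V) ∧
      ∀ x, ∀ v ∈ V, dist x (f x) ≤ dist x v := by
  classical
  obtain ⟨v₀, hv₀⟩ := hV
  let e : ℕ → EuclideanSpace ℝ (Fin d) := fun k =>
    if h : k < V.card then (V.equivFin.symm ⟨k, h⟩ : EuclideanSpace ℝ (Fin d)) else v₀
  refine ⟨SimpleFunc.nearestPt e V.card, (SimpleFunc.nearestPt e V.card).measurable, ?_, ?_⟩
  · intro x
    change e _ ∈ V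
    simp only [e]
    split_ifs with h
    · exact Finset.coe_mem _
    · exact hv₀
  · intro x v hv
    have h1 := SimpleFunc.edist_nearestPt_le e x (N := V.card) (V.equivFin ⟨v, hv⟩).2.le
    have h2 : e (V.equivFin ⟨v, hv⟩) = v := by simp [e]
    rw [h2, edist_dist, edist_dist, ENNReal.ofReal_le_ofReal_iff dist_nonneg] at h1
    rwa [dist_comm, dist_comm x v]

theorem HalfDoubling.integrable {s : ℕ} {ω : Measure (EuclideanSpace ℝ (Fin (d + 1)))}
    (hω : HalfDoubling s ω) {G : EuclideanSpace ℝ (Fin (d + 1)) → ℝ} (hG : Continuous G) :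
    Integrable G ω := by
  have := hω.prob
  obtain ⟨M, hM⟩ :=
    (isCompact_sphere (0 : EuclideanSpace ℝ (Fin (d + 1))) 1).exists_bound_of_continuousOn
    hG.continuousOn
  refine Integrable.of_bound hG.aestronglyMeasurable M ?_
  filter_upwards [measure_eq_zero_iff_ae_notMem.1 hω.supp] with x hx
  exact hM x (by simpa using (not_not.1 hx).1)

/-- Integer masses on a fine net approximating a doubling measure. -/
theorem exists_rounded_cells {s : ℕ} {ω : Measure (EuclideanSpace ℝ (Fin (d + 1)))}
    (hω : HalfDoubling s ω) {V : Finset (EuclideanSpace ℝ (Fin (d + 1)))} {r : ℝ}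
    (hV : IsNet V r) (hr : 0 < r) (hr1 : r ≤ 1 / 220) (N : ℕ)
    (hN : ∀ v ∈ V, 1 ≤ N * ω.real (Metric.closedBall v (r / 2))) :
    ∃ (a : EuclideanSpace ℝ (Fin (d + 1)) → ℝ) (m : EuclideanSpace ℝ (Fin (d + 1)) → ℕ),
      ∑ v ∈ V, m v = N ∧ (∀ v ∈ V, a v ≤ 2 * m v) ∧
      (∀ v ∈ V, (m v : ℝ) ≤ (1 + 241 ^ (d + 1)) * a v) ∧
      (∀ A ⊆ V, ∀ S, (∀ v ∈ A, Metric.closedBall v (10 * r) ⊆ S) →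
        ∑ v ∈ A, a v ≤ N * ω.real S) ∧
      (∀ A ⊆ V, ∀ S, (∀ x ∈ S, ∀ v ∈ V, dist x v ≤ 10 * r → v ∈ A) →
        N * ω.real S ≤ ∑ v ∈ A, a v) ∧
      ∀ G : EuclideanSpace ℝ (Fin (d + 1)) → ℝ, Continuous G →
      ∀ D : EuclideanSpace ℝ (Fin (d + 1)) → ℝ,
        (∀ v ∈ V, ∀ x, ‖x‖ = 1 → dist x v ≤ 120 * r → |G x - G v| ≤ D v) →
        |∑ v ∈ V, m v * G v - N * ∫ x, G x ∂ω| ≤ 2 * ∑ v ∈ V, a v * D v := by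
  classical
  have := hω.prob
  set e : EuclideanSpace ℝ (Fin (d + 1)) := EuclideanSpace.single (Fin.last d) 1 with he
  obtain ⟨root, hroot, hroot'⟩ := hV.cover e ⟨by simp [e], by simp [e]⟩
  obtain ⟨f, hfm, hfV, hfd⟩ := exists_measurable_nearest ⟨root, hroot⟩
  have hf10 : ∀ x ∈ upSphere d, dist x (f x) ≤ 10 * r := fun x hx => by
    obtain ⟨v, hv, hxv⟩ := hV.cover x hx
    exact (hfd x v hv).trans hxv
  have hsupp := measure_eq_zero_iff_ae_notMem.1 hω.supp
  have hmono : ∀ S T : Set (EuclideanSpace ℝ (Fin (d + 1))), (∀ x ∈ upSphere d, x ∈ S → x ∈ T) →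
      ω.real S ≤ ω.real T := fun S T hST => by
    refine ENNReal.toReal_mono (measure_ne_top _ _) (measure_mono_ae ?_)
    filter_upwards [hsupp] with x hx
    exact hST x (not_not.1 hx)
  have hSm : ∀ v, MeasurableSet (f ⁻¹' {v}) := fun v => hfm (measurableSet_singleton v)
  have hdisj : ∀ A : Finset (EuclideanSpace ℝ (Fin (d + 1))),
      (A : Set (EuclideanSpace ℝ (Fin (d + 1)))).PairwiseDisjoint fun v => f ⁻¹' {v} :=
    fun A v _ w _ hvw => Set.disjoint_left.2 fun x hx hx' => hvw (by
      rw [Set.mem_preimage, Set.mem_singleton_iff] at hx hx'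
      rw [← hx, ← hx'])
  set a : EuclideanSpace ℝ (Fin (d + 1)) → ℝ := fun v => N * ω.real (f ⁻¹' {v}) with ha
  have hsum : ∀ A : Finset (EuclideanSpace ℝ (Fin (d + 1))),
      ∑ v ∈ A, a v = N * ω.real (⋃ v ∈ A, f ⁻¹' {v}) := fun A => by
    rw [measureReal_biUnion_finset (hdisj A) fun v _ => hSm v, Finset.mul_sum]
  have ha1 : ∀ v ∈ V, 1 ≤ a v := fun v hv => by
    refine (hN v hv).trans (mul_le_mul_of_nonneg_left ?_ (Nat.cast_nonneg _))
    refine hω.real_mono fun x hx => ?_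
    by_contra hne
    rw [Set.mem_preimage, Set.mem_singleton_iff] at hne
    have h1 := hV.sep (f x) (hfV x) v hv hne
    have h2 := hfd x v hv
    have h3 := dist_triangle_left (f x) v x
    rw [Metric.mem_closedBall] at hx
    linarith
  have hunion : ⋃ v ∈ V, f ⁻¹' {v} = univ := by
    ext x
    simp [hfV x]
  have haN : ∑ v ∈ V, a v = ((N : ℤ) : ℝ) := by
    rw [hsum, hunion, probReal_univ]
    simp
  have hpar : ∀ v, ∃ w, v ∈ V → w ∈ V ∧ dist v w ≤ 120 * r ∧ (v ≠ root → w = root ∨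
      dist w e < dist v e) := fun v => by
    by_cases hv : v ∈ V
    swap
    · exact ⟨v, fun h => absurd h hv⟩
    by_cases h : 110 * r ≤ dist v e
    · obtain ⟨w, hw, h1, h2⟩ := hV.exists_dist_lt hr hr1 hv h
      exact ⟨w, fun _ => ⟨hw, by linarith, fun _ => Or.inr h2⟩⟩
    · exact ⟨root, fun _ => ⟨hroot, by linarith [dist_triangle v e root], fun _ => Or.inl rfl⟩⟩
  choose parent hparent using hpar
  obtain ⟨m, hmN, hma, hma', hmg⟩ := exists_rounding parent
    (fun v => if v = root then -1 else dist v e) root V.card V rfl hroot (fun i hi hir => by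
      obtain ⟨h1, -, h2⟩ := hparent i hi
      refine ⟨h1, ?_⟩
      beta_reduce
      rw [if_neg hir]
      split_ifs with h
      · linarith [dist_nonneg (x := i) (y := e)]
      · exact (h2 hir).resolve_left h) a N haN
  have hm0 : ∀ v ∈ V, 0 ≤ m v := fun v hv =>
    le_trans (Int.floor_nonneg.2 (by linarith [ha1 v hv])) (hma v hv)
  have hmcast : ∀ v ∈ V, ((m v).toNat : ℝ) = m v := fun v hv => by
    have : (((m v).toNat : ℤ) : ℝ) = m v := by rw [Int.toNat_of_nonneg (hm0 v hv)]
    exact_mod_cast this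
  refine ⟨a, fun v => (m v).toNat, ?_, ?_, ?_, ?_, ?_, ?_⟩
  · zify
    rw [← hmN]
    exact Finset.sum_congr rfl fun v hv => Int.toNat_of_nonneg (hm0 v hv)
  · intro v hv
    rw [hmcast v hv]
    have h1 : (1 : ℤ) ≤ m v := le_trans (Int.le_floor.2 (by simpa using ha1 v hv)) (hma v hv)
    have h2 : (1 : ℝ) ≤ m v := by exact_mod_cast h1
    have h3 : (⌊a v⌋ : ℝ) ≤ m v := by exact_mod_cast hma v hv
    linarith [Int.lt_floor_add_one (a v)]
  · intro v hv
    rw [hmcast v hv]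
    have h1 := hV.card_le_of_dist_le hr (R := 240 * r) (by positivity)
      (A := V.filter fun j => j ≠ root ∧ parent j = v) (Finset.filter_subset _ _) (by
        intro x hx y hy
        rw [Finset.mem_filter] at hx hy
        have h1 := (hparent x hx.1).2.1
        have h2 := (hparent y hy.1).2.1
        rw [hx.2.2] at h1
        rw [hy.2.2] at h2
        linarith [dist_triangle_right x y v])
    rw [mul_div_cancel_right₀ _ hr.ne'] at h1
    norm_num at h1
    have h2 := ha1 v hv
    have h3 := hma' v hv
    have h4 : (0 : ℝ) < 241 ^ (d + 1) := by positivity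
    norm_num at h3
    nlinarith
  · intro A hA S hS
    rw [hsum]
    refine mul_le_mul_of_nonneg_left (hmono _ _ ?_) (Nat.cast_nonneg _)
    intro x hx hxA
    simp only [Set.mem_iUnion, Set.mem_preimage, Set.mem_singleton_iff, exists_prop,
      exists_eq_right'] at hxA
    exact hS _ hxA (hf10 x hx)
  · intro A hA S hS
    rw [hsum]
    refine mul_le_mul_of_nonneg_left (hmono _ _ ?_) (Nat.cast_nonneg _)
    intro x hx hxS
    simp only [Set.mem_iUnion, Set.mem_preimage, Set.mem_singleton_iff, exists_prop,
      exists_eq_right']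
    exact hS x hxS _ (hfV x) (hf10 x hx)
  · intro G hG D hD
    have hint := hω.integrable hG
    have h1 : ∫ x, G x ∂ω = ∑ v ∈ V, ∫ x in f ⁻¹' {v}, G x ∂ω := by
      rw [← integral_biUnion_finset V (fun v _ => hSm v) (hdisj V) fun v _ => hint.integrableOn,
        hunion, setIntegral_univ]
    have h2 : ∀ v ∈ V, |N * ∫ x in f ⁻¹' {v}, G x ∂ω - a v * G v| ≤ a v * D v := fun v hv => by
      have h3 : ∫ x in f ⁻¹' {v}, G x ∂ω - ω.real (f ⁻¹' {v}) * G v =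
          ∫ x in f ⁻¹' {v}, (G x - G v) ∂ω := by
        rw [integral_sub hint.integrableOn (integrable_const _), setIntegral_const, smul_eq_mul]
      have h4 : ‖∫ x in f ⁻¹' {v}, (G x - G v) ∂ω‖ ≤ D v * ω.real (f ⁻¹' {v}) := by
        refine norm_setIntegral_le_of_norm_le_const_ae' (measure_lt_top _ _) ?_
        filter_upwards [hsupp] with x hx hxv
        have hx' := not_not.1 hx
        rw [Set.mem_preimage, Set.mem_singleton_iff] at hxv
        refine hD v hv x hx'.1 ?_
        have h5 := hf10 x hx'
        rw [hxv] at h5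
        linarith
      calc _ = N * ‖∫ x in f ⁻¹' {v}, (G x - G v) ∂ω‖ := by
            rw [← h3, Real.norm_eq_abs, ← abs_of_nonneg (Nat.cast_nonneg (α := ℝ) N), ← abs_mul,
              abs_of_nonneg (Nat.cast_nonneg (α := ℝ) N)]
            congr 1
            simp only [ha]
            ring
        _ ≤ N * (D v * ω.real (f ⁻¹' {v})) := by gcongr
        _ = _ := by simp only [ha]; ring
    have h5 := hmg G
    have h6 : ∑ v ∈ V, |G v - G (parent v)| ≤ ∑ v ∈ V, a v * D v := by
      refine Finset.sum_le_sum fun v hv => ?_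
      obtain ⟨h7, h8, -⟩ := hparent v hv
      rw [abs_sub_comm]
      refine (hD v hv _ (hV.norm_eq _ h7) (by rwa [dist_comm])).trans ?_
      have h9 : 0 ≤ D v := (abs_nonneg _).trans
        (hD v hv v (hV.norm_eq v hv) (by rw [dist_self]; positivity))
      exact le_mul_of_one_le_left h9 (ha1 v hv)
    have h7 : |N * ∫ x, G x ∂ω - ∑ v ∈ V, a v * G v| ≤ ∑ v ∈ V, a v * D v := by
      rw [h1, Finset.mul_sum, ← Finset.sum_sub_distrib]
      exact (Finset.abs_sum_le_sum_abs _ _).trans (Finset.sum_le_sum h2)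
    have h8 : ∑ v ∈ V, ((m v).toNat : ℝ) * G v - N * ∫ x, G x ∂ω =
        ∑ v ∈ V, ((m v : ℝ) - a v) * G v - (N * ∫ x, G x ∂ω - ∑ v ∈ V, a v * G v) := by
      rw [Finset.sum_congr rfl fun v hv => by rw [hmcast v hv]]
      simp only [sub_mul, Finset.sum_sub_distrib]
      ring
    rw [h8]
    linarith [abs_sub (∑ v ∈ V, ((m v : ℝ) - a v) * G v) (N * ∫ x, G x ∂ω - ∑ v ∈ V, a v * G v)]

/-- Placing a prescribed number of separated points next to each point of a net. -/
theorem IsNet.exists_points_near {V : Finset (EuclideanSpace ℝ (Fin (d + 1)))} {r η : ℝ}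
    (hV : IsNet V r) (hr : 0 < r) (hr1 : r ≤ 1) (hη : 0 < η) (hηr : η ≤ r) {N : ℕ}
    {m : EuclideanSpace ℝ (Fin (d + 1)) → ℕ} (hN : ∑ v ∈ V, m v = N)
    (hm : ∀ v ∈ V, m v * (8 * η) ^ d ≤ r ^ d) :
    ∃ X Q : Fin N → EuclideanSpace ℝ (Fin (d + 1)), (∀ j, ‖X j‖ = 1) ∧
      (∀ j, 0 < X j (Fin.last d)) ∧ (∀ i j, i ≠ j → η ≤ dist (X i) (X j)) ∧
      (∀ j, Q j ∈ V) ∧ (∀ j, dist (X j) (Q j) ≤ r / 4) ∧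
      ∀ g : EuclideanSpace ℝ (Fin (d + 1)) → ℝ, ∑ j, g (Q j) = ∑ v ∈ V, m v * g v := by
  classical
  have hA : ∀ v : V, ∃ x : Fin (m v) → EuclideanSpace ℝ (Fin (d + 1)), (∀ k, ‖x k‖ = 1) ∧
      (∀ k, dist (x k) v ≤ r / 4) ∧ ∀ k l, k ≠ l → η ≤ dist (x k) (x l) := fun v => by
    obtain ⟨A, hAm, hA1, hA2, hA3⟩ := exists_separated_near (hV.norm_eq v v.2) hr hr1 hη
      (hm v v.2)
    let e := A.equivFinOfCardEq hAm
    exact ⟨fun k => e.symm k, fun k => hA1 _ (e.symm k).2, fun k => hA2 _ (e.symm k).2,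
      fun k l hkl => hA3 _ (e.symm k).2 _ (e.symm l).2 fun h =>
        hkl (e.symm.injective (Subtype.ext h))⟩
  choose x hx1 hx2 hx3 using hA
  have hcard : Fintype.card (Σ v : V, Fin (m v)) = N := by
    rw [Fintype.card_sigma, ← hN]
    simp only [Fintype.card_fin]
    exact Finset.sum_coe_sort V m
  let e := Fintype.equivFinOfCardEq hcard
  refine ⟨fun j => x (e.symm j).1 (e.symm j).2, fun j => (e.symm j).1, fun j => hx1 _ _, ?_, ?_,
    fun j => (e.symm j).1.2, fun j => hx2 _ _, ?_⟩
  · intro j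
    have h1 := hV.le_last _ (e.symm j).1.2
    have h2 := hx2 (e.symm j).1 (e.symm j).2
    have h3 := PiLp.norm_apply_le (p := 2)
      (x (e.symm j).1 (e.symm j).2 - ((e.symm j).1 : EuclideanSpace ℝ (Fin (d + 1)))) (Fin.last d)
    rw [← dist_eq_norm, Real.norm_eq_abs, PiLp.sub_apply] at h3
    linarith [(abs_le.1 h3).1]
  · intro i j hij
    change η ≤ dist (x (e.symm i).1 (e.symm i).2) (x (e.symm j).1 (e.symm j).2)
    have hne : e.symm i ≠ e.symm j := fun h => hij (e.symm.injective h)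
    revert hne
    generalize e.symm i = p
    generalize e.symm j = q
    obtain ⟨v, k⟩ := p
    obtain ⟨w, l⟩ := q
    intro hne
    by_cases hvw : v = w
    · subst hvw
      exact hx3 v k l fun h => hne (by rw [h])
    · have h1 := hV.sep v v.2 w w.2 fun h => hvw (Subtype.ext h)
      have h2 := hx2 v k
      have h3 := hx2 w l
      have h4 := dist_triangle4 (v : EuclideanSpace ℝ (Fin (d + 1))) (x v k) (x w l) w
      rw [dist_comm (v : EuclideanSpace ℝ (Fin (d + 1))) (x v k)] at h4
      dsimp only
      linarith
  · intro g
    rw [Equiv.sum_comp e.symm (fun p => g (p.1 : EuclideanSpace ℝ (Fin (d + 1)))),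
      Fintype.sum_sigma]
    simp only [Finset.sum_const, Finset.card_univ, Fintype.card_fin, nsmul_eq_mul]
    exact Finset.sum_coe_sort V fun v => (m v : ℝ) * g v

set_option maxHeartbeats 1000000 in
/-- Equal weight cubature for doubling measures on the closed upper half sphere. -/
theorem HalfDoubling.exists_cubature (d s : ℕ) (hd : 1 ≤ d) :
    ∃ K ε C : ℝ, 0 < K ∧ 0 < ε ∧ 0 < C ∧
    ∀ ω : Measure (EuclideanSpace ℝ (Fin (d + 1))), HalfDoubling s ω → ∀ n N : ℕ, 0 < n →
    (∀ x ∈ upSphere d, K ≤ N * ω.real (Metric.closedBall x (1 / n))) → ∀ η : ℝ, 0 < η →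
    (∀ x ∈ upSphere d, N * ω.real (Metric.closedBall x (10 * (ε / n))) * (C * η) ^ d ≤
      (ε / n) ^ d) →
    ∃ X : Fin N → EuclideanSpace ℝ (Fin (d + 1)), (∀ j, ‖X j‖ = 1) ∧
      (∀ j, 0 < X j (Fin.last d)) ∧ (∀ i j, i ≠ j → η / 2 ≤ dist (X i) (X j)) ∧
      ∀ P : MvPolynomial (Fin d) ℝ, P.totalDegree ≤ n →
        ∑ j, pEval P (projInit (X j)) = N * ∫ x, pEval P (projInit x) ∂ω := by
  classical
  obtain ⟨c, C₁, hc, hc1, hC₁, hnear⟩ := exists_nodes_of_near d s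
  set M : ℝ := 1 + 241 ^ (d + 1) with hM
  have hM1 : 1 ≤ M := by
    rw [hM]
    linarith [pow_pos (show (0 : ℝ) < 241 by norm_num) (d + 1)]
  set κ : ℝ := 2 * 8 ^ s with hκ
  have hκ0 : 0 < κ := by positivity
  set T : ℝ := (M + 2) * 240 with hT
  have hT0 : 0 < T := by positivity
  set ε : ℝ := min (c / 48) (1 / (C₁ * κ * T)) with hε
  have hε0 : 0 < ε := lt_min (by positivity) (by positivity)
  have hεc : ε ≤ c / 48 := min_le_left _ _
  have hεT : C₁ * κ * T * ε ≤ 1 := by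
    have := (le_div_iff₀ (by positivity)).1 (min_le_right (c / 48) (1 / (C₁ * κ * T)))
    rw [← hε] at this
    linarith
  clear_value ε
  refine ⟨(4 / ε) ^ s, ε, 8 * M, by positivity, hε0, by positivity, ?_⟩
  intro ω hω n N hn hK η hη hηd
  have := hω.prob
  have hn1 : (1 : ℝ) ≤ n := by exact_mod_cast hn
  have hn0 : (0 : ℝ) < n := by linarith
  set r : ℝ := ε / n with hr
  set R : ℝ := c / n with hR
  have hr0 : 0 < r := by positivity
  have hR0 : 0 < R := by positivity
  have hrn : r * n = ε := by rw [hr]; field_simp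
  have hrR : r ≤ R / 48 := by
    rw [hr, hR, div_div, mul_comm, ← div_div]
    gcongr
  have hrε : r ≤ ε := div_le_self hε0.le hn1
  have hrn' : r ≤ 1 / 4800 * (1 / n) := by
    rw [hr, div_eq_mul_one_div]
    gcongr
    linarith
  have hr1 : r ≤ 1 / 220 := by linarith
  have hinv : 1 / (n : ℝ) ≤ 1 := by rw [div_le_one hn0]; exact hn1
  have hinv0 : 0 < 1 / (n : ℝ) := by positivity
  have h20 : 1 / (20 * (n : ℝ)) = 1 / 20 * (1 / n) := by rw [one_div_mul_one_div]
  obtain ⟨V, hV⟩ := exists_isNet (d := d) (r := 1 / (20 * n)) (by positivity) (by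
    rw [h20]; linarith)
  obtain ⟨W, hW⟩ := exists_isNet (d := d) (r := R) hR0 (by
    have : R ≤ c := div_le_self hc.le hn1
    linarith)
  obtain ⟨Y, hY⟩ := exists_isNet (d := d) hr0 (by linarith)
  have hN1 : ∀ v ∈ Y, 1 ≤ N * ω.real (Metric.closedBall v (r / 2)) := fun v hv => by
    have hv' := hY.mem hr0.le hv
    have h1 := hω.mass_le hv' (r := r / 2) (R := 1 / n) (by positivity) (by linarith)
    have h2 := hK v hv'
    have h3 : 2 * (1 / (n : ℝ)) / (r / 2) = 4 / ε := by
      rw [hr]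
      field_simp
      norm_num
    rw [h3] at h1
    have h4 : (4 / ε) ^ s * 1 ≤ (4 / ε) ^ s * (N * ω.real (Metric.closedBall v (r / 2))) := by
      calc _ ≤ (N : ℝ) * ω.real (Metric.closedBall v (1 / n)) := by rw [mul_one]; exact h2
        _ ≤ N * ((4 / ε) ^ s * ω.real (Metric.closedBall v (r / 2))) := by gcongr
        _ = _ := by ring
    exact le_of_mul_le_mul_left h4 (by positivity)
  obtain ⟨a, m, hmN, ham, hma, hup, hlo, herr⟩ := exists_rounded_cells hω hY hr0 hr1 N hN1
  have ha0 : ∀ v ∈ Y, 0 ≤ a v := fun v hv => by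
    have h1 := hma v hv
    have h2 : (0 : ℝ) ≤ m v := Nat.cast_nonneg _
    by_contra! h
    nlinarith
  have hav : ∀ v ∈ Y, a v ≤ N * ω.real (Metric.closedBall v (10 * r)) := fun v hv => by
    simpa using hup {v} (by simpa using hv) (Metric.closedBall v (10 * r)) (by simp)
  obtain ⟨p, hp, -⟩ := hY.cover (EuclideanSpace.single (Fin.last d) 1) ⟨by simp, by simp⟩
  have hNpos : 0 < N := by
    by_contra! h
    have := hN1 p hp
    rw [Nat.le_zero.1 h] at this
    norm_num at this
  have hηr : η ≤ r := by
    have h1 := hηd p (hY.mem hr0.le hp)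
    have h2 : 1 ≤ N * ω.real (Metric.closedBall p (10 * r)) := (hN1 p hp).trans
      (mul_le_mul_of_nonneg_left (hω.real_mono (Metric.closedBall_subset_closedBall (by linarith)))
        (Nat.cast_nonneg _))
    have h3 : (8 * M * η) ^ d ≤ r ^ d :=
      (le_mul_of_one_le_left (by positivity) h2).trans h1
    have h4 := (pow_le_pow_iff_left₀ (by positivity) hr0.le (by omega)).1 h3
    nlinarith
  obtain ⟨X₀, Q, hX1, hX2, hX3, hQV, hXQ, hQsum⟩ := hY.exists_points_near hr0 (by linarith) hη hηr
    hmN (fun v hv => by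
      have h1 := hηd v (hY.mem hr0.le hv)
      refine le_trans ?_ h1
      calc (m v : ℝ) * (8 * η) ^ d
          ≤ M * (N * ω.real (Metric.closedBall v (10 * r))) * (8 * η) ^ d := by
            gcongr
            exact (hma v hv).trans (by gcongr; exact hav v hv)
        _ ≤ M ^ d * (N * ω.real (Metric.closedBall v (10 * r))) * (8 * η) ^ d := by
            gcongr
            exact le_self_pow₀ hM1 (by omega)
        _ = _ := by rw [mul_right_comm 8 M η, mul_pow _ M]; ring)
  let I : MvPolynomial (Fin d) ℝ →ₗ[ℝ] ℝ :=
    { toFun := fun P => N * ∫ x, pEval (liftPoly P) x ∂ω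
      map_add' := fun P P' => by
        have : ∀ x, pEval (liftPoly (P + P')) x =
            pEval (liftPoly P) x + pEval (liftPoly P') x := fun x => by
          simp [pEval, liftPoly]
        simp only [this]
        rw [integral_add (hω.integrable (continuous_pEval _)) (hω.integrable (continuous_pEval _)),
          mul_add]
      map_smul' := fun t P => by
        have : ∀ x, pEval (liftPoly (t • P)) x = t * pEval (liftPoly P) x := fun x => by
          simp [pEval, liftPoly]
        simp only [this]
        rw [integral_const_mul]
        simp only [RingHom.id_apply, smul_eq_mul]
        ring }
  obtain ⟨X, h1, h2, h3, h4⟩ := hnear ω hω n hn V W hV hW N κ (T * r * N) η hNpos hκ0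
    (by positivity) hη (by
      calc C₁ * κ * (T * r * N) * n = C₁ * κ * T * (r * n) * N := by ring
        _ ≤ 1 * N := by rw [hrn]; gcongr
        _ = N := one_mul _) I X₀ hX1 hX2 hX3 (fun y hy => by
      have hy' := hW.mem hR0.le hy
      set A := Y.filter fun v => dist v y ≤ R / 2 - r with hA
      have h1 := hω.mass_le hy' (r := R / 4) (R := R) (by positivity) (by linarith)
      have h2 : 2 * R / (R / 4) = 8 := by
        field_simp
        norm_num
      rw [h2] at h1
      have h3 := hlo A (Finset.filter_subset _ _) (Metric.closedBall y (R / 4))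
        (fun x hx v hv hxv => Finset.mem_filter.2 ⟨hv, by
          rw [Metric.mem_closedBall] at hx
          linarith [dist_triangle_left v y x]⟩)
      have h4 : ∑ v ∈ A, a v ≤ 2 * ∑ v ∈ A, (m v : ℝ) := by
        rw [Finset.mul_sum]
        exact Finset.sum_le_sum fun v hv => ham v (Finset.mem_filter.1 hv).1
      have h5 : ∑ v ∈ A, (m v : ℝ) ≤
          (Finset.univ.filter fun j => dist (X₀ j) y ≤ R / 2).card := by
        have h6 := hQsum fun v => if dist v y ≤ R / 2 - r then 1 else 0
        simp only [mul_ite, mul_one, mul_zero, ← Finset.sum_filter, Finset.sum_const,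
          nsmul_eq_mul, ← hA] at h6
        rw [← h6]
        norm_cast
        refine Finset.card_le_card fun j hj => ?_
        rw [Finset.mem_filter] at hj ⊢
        exact ⟨hj.1, by linarith [dist_triangle (X₀ j) (Q j) y, hXQ j, hj.2]⟩
      calc N * ω.real (Metric.closedBall y R)
          ≤ N * (8 ^ s * ω.real (Metric.closedBall y (R / 4))) := by gcongr
        _ = 8 ^ s * (N * ω.real (Metric.closedBall y (R / 4))) := by ring
        _ ≤ 8 ^ s * (2 * (Finset.univ.filter fun j => dist (X₀ j) y ≤ R / 2).card) :=
            mul_le_mul_of_nonneg_left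
              (h3.trans (h4.trans (mul_le_mul_of_nonneg_left h5 zero_le_two))) (by positivity)
        _ = _ := by rw [hκ]; ring) (fun P hP => by
      have hq : ∀ v, ∃ u, v ∈ Y → u ∈ V ∧ dist v u ≤ 10 * (1 / (20 * n)) := fun v => by
        by_cases hv : v ∈ Y
        · obtain ⟨u, hu, hvu⟩ := hV.cover v (hY.mem hr0.le hv)
          exact ⟨u, fun _ => ⟨hu, hvu⟩⟩
        · exact ⟨v, fun h => absurd h hv⟩
      choose q hq using hq
      set F := fun u => sphSup (angNorm (liftPoly P)) u (2 / n) with hF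
      have hF0 : ∀ u, 0 ≤ F u := fun u => sphSup_nonneg (angNorm_nonneg _) _ _
      have h2n : 2 / (n : ℝ) = 2 * (1 / n) := by ring
      have hD : ∀ v ∈ Y, ∀ x, ‖x‖ = 1 → dist x v ≤ 120 * r →
          |pEval (liftPoly P) x - pEval (liftPoly P) v| ≤ F (q v) * (2 * (120 * r)) :=
        fun v hv x hx hxv => by
          obtain ⟨h5, h6⟩ := hq v hv
          refine abs_pEval_sub_le (hY.norm_eq v hv) hx _ (by rwa [← dist_eq_norm]) (by linarith)
            fun z hz hzv => le_sphSup (continuous_angNorm _) hz ?_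
          rw [← dist_eq_norm] at hzv
          rw [h2n]
          rw [h20] at h6
          linarith [dist_triangle z v (q v)]
      have h5 := herr (pEval (liftPoly P)) (continuous_pEval _)
        (fun v => F (q v) * (2 * (120 * r))) hD
      have h6 : |∑ j, pEval (liftPoly P) (X₀ j) - ∑ j, pEval (liftPoly P) (Q j)| ≤
          M * ∑ v ∈ Y, a v * (F (q v) * (2 * (120 * r))) := by
        rw [← Finset.sum_sub_distrib]
        refine (Finset.abs_sum_le_sum_abs _ _).trans ?_
        refine (Finset.sum_le_sum fun j _ => hD (Q j) (hQV j) (X₀ j) (hX1 j)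
          ((hXQ j).trans (by linarith))).trans ?_
        rw [hQsum fun v => F (q v) * (2 * (120 * r)), Finset.mul_sum]
        refine Finset.sum_le_sum fun v hv => ?_
        rw [← mul_assoc M]
        have := hF0 (q v)
        exact mul_le_mul_of_nonneg_right (hma v hv) (by positivity)
      rw [hQsum (pEval (liftPoly P))] at h6
      have h7 : ∑ v ∈ Y, a v * F (q v) ≤ N * netNorm ω V n P := by
        rw [← Finset.sum_fiberwise_of_maps_to (g := q) (t := V) fun v hv => (hq v hv).1, netNorm,
          Finset.mul_sum]
        refine Finset.sum_le_sum fun u hu => ?_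
        rw [Finset.sum_congr rfl fun v hv => by rw [(Finset.mem_filter.1 hv).2],
          ← Finset.sum_mul, ← mul_assoc]
        refine mul_le_mul_of_nonneg_right ?_ (hF0 u)
        refine hup _ (Finset.filter_subset _ _) _ fun v hv x hx => ?_
        rw [Finset.mem_filter] at hv
        have h8 := (hq v hv.1).2
        rw [hv.2, h20] at h8
        rw [Metric.mem_closedBall] at hx ⊢
        linarith [dist_triangle x v u]
      have h8 : ∑ v ∈ Y, a v * (F (q v) * (2 * (120 * r))) =
          (240 * r) * ∑ v ∈ Y, a v * F (q v) := by
        rw [Finset.mul_sum]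
        exact Finset.sum_congr rfl fun v _ => by ring
      change |∑ j, pEval (liftPoly P) (X₀ j) - N * ∫ x, pEval (liftPoly P) x ∂ω| ≤ _
      calc _ ≤ |∑ j, pEval (liftPoly P) (X₀ j) - ∑ v ∈ Y, m v * pEval (liftPoly P) v| +
            |∑ v ∈ Y, m v * pEval (liftPoly P) v - N * ∫ x, pEval (liftPoly P) x ∂ω| :=
            abs_sub_le _ _ _
        _ ≤ (M + 2) * ((240 * r) * ∑ v ∈ Y, a v * F (q v)) := by
            rw [h8] at h5 h6
            linarith
        _ ≤ (M + 2) * ((240 * r) * (N * netNorm ω V n P)) := by gcongr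
        _ = _ := by rw [hT]; ring)
  refine ⟨X, h1, h2, h3, fun P hP => ?_⟩
  simp only [← pEval_liftPoly]
  exact h4 P hP

/-- The lift of the unit ball to the closed upper half sphere. -/
def ballLift (x : EuclideanSpace ℝ (Fin d)) : EuclideanSpace ℝ (Fin (d + 1)) :=
  WithLp.toLp 2 (Fin.snoc (fun i => x i) (Real.sqrt (1 - ‖x‖ ^ 2)) : Fin (d + 1) → ℝ)

@[simp] theorem ballLift_last (x : EuclideanSpace ℝ (Fin d)) :
    ballLift x (Fin.last d) = Real.sqrt (1 - ‖x‖ ^ 2) := by simp [ballLift]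

@[simp] theorem ballLift_castSucc (x : EuclideanSpace ℝ (Fin d)) (i : Fin d) :
    ballLift x i.castSucc = x i := by simp [ballLift]

theorem projInit_ballLift (x : EuclideanSpace ℝ (Fin d)) : projInit (ballLift x) = x := by
  ext i
  simp

theorem continuous_ballLift : Continuous (ballLift (d := d)) := by
  refine (PiLp.continuous_toLp 2 _).comp (continuous_pi fun i => ?_)
  refine Fin.lastCases ?_ (fun i => ?_) i
  · simp only [Fin.snoc_last]
    fun_prop
  · simp only [Fin.snoc_castSucc]
    fun_prop

theorem sq_norm_eq_projInit (x : EuclideanSpace ℝ (Fin (d + 1))) :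
    ‖x‖ ^ 2 = ‖projInit x‖ ^ 2 + x (Fin.last d) ^ 2 := by
  rw [EuclideanSpace.real_norm_sq_eq, EuclideanSpace.real_norm_sq_eq, Fin.sum_univ_castSucc]
  rfl

theorem norm_projInit_le (x : EuclideanSpace ℝ (Fin (d + 1))) : ‖projInit x‖ ≤ ‖x‖ :=
  le_of_sq_le_sq (by rw [sq_norm_eq_projInit x]; linarith [sq_nonneg (x (Fin.last d))])
    (norm_nonneg _)

theorem dist_projInit_le (x y : EuclideanSpace ℝ (Fin (d + 1))) :
    dist (projInit x) (projInit y) ≤ dist x y := by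
  rw [dist_eq_norm, dist_eq_norm]
  exact norm_projInit_le (x - y)

theorem ballLift_mem {x : EuclideanSpace ℝ (Fin d)} (hx : ‖x‖ ≤ 1) : ballLift x ∈ upSphere d := by
  refine ⟨?_, by rw [ballLift_last]; exact Real.sqrt_nonneg _⟩
  have h1 : ‖ballLift x‖ ^ 2 = 1 := by
    rw [sq_norm_eq_projInit, projInit_ballLift, ballLift_last,
      Real.sq_sqrt (by nlinarith [norm_nonneg x])]
    ring
  exact (pow_eq_one_iff_of_nonneg (norm_nonneg _) two_ne_zero).1 h1

theorem norm_projInit_le_one {x : EuclideanSpace ℝ (Fin (d + 1))} (hx : x ∈ upSphere d) :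
    ‖projInit x‖ ≤ 1 := (norm_projInit_le x).trans hx.1.le

theorem ballLift_projInit {x : EuclideanSpace ℝ (Fin (d + 1))} (hx : x ∈ upSphere d) :
    ballLift (projInit x) = x := by
  have h := sq_norm_eq_projInit x
  rw [hx.1] at h
  ext i
  refine Fin.lastCases ?_ (fun i => ?_) i
  · rw [ballLift_last, show 1 - ‖projInit x‖ ^ 2 = x (Fin.last d) ^ 2 by linarith,
      Real.sqrt_sq hx.2]
  · simp

theorem sq_dist_ballLift (x y : EuclideanSpace ℝ (Fin d)) : dist (ballLift x) (ballLift y) ^ 2 =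
    ‖x - y‖ ^ 2 + (Real.sqrt (1 - ‖x‖ ^ 2) - Real.sqrt (1 - ‖y‖ ^ 2)) ^ 2 := by
  rw [sq_dist_eq, EuclideanSpace.real_norm_sq_eq]
  simp

theorem dist_ballLift_le_rhoB (x y : EuclideanSpace ℝ (Fin d)) :
    dist (ballLift x) (ballLift y) ≤ rhoB x y := by
  have h0 := norm_nonneg (x - y)
  have h1 := abs_nonneg (Real.sqrt (1 - ‖x‖ ^ 2) - Real.sqrt (1 - ‖y‖ ^ 2))
  refine le_of_sq_le_sq ?_ (add_nonneg h0 h1)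
  rw [sq_dist_ballLift, rhoB, ← sq_abs (Real.sqrt (1 - ‖x‖ ^ 2) - _)]
  nlinarith

theorem rhoB_le_two_mul_dist_ballLift (x y : EuclideanSpace ℝ (Fin d)) :
    rhoB x y ≤ 2 * dist (ballLift x) (ballLift y) := by
  have h1 : ‖x - y‖ ≤ dist (ballLift x) (ballLift y) := by
    have := dist_projInit_le (ballLift x) (ballLift y)
    rwa [projInit_ballLift, projInit_ballLift, dist_eq_norm] at this
  have h2 : |Real.sqrt (1 - ‖x‖ ^ 2) - Real.sqrt (1 - ‖y‖ ^ 2)| ≤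
      dist (ballLift x) (ballLift y) := by
    refine le_of_sq_le_sq ?_ dist_nonneg
    rw [sq_dist_ballLift, sq_abs]
    linarith [sq_nonneg ‖x - y‖]
  rw [rhoB]
  linarith

theorem isClosed_upSphere : IsClosed (upSphere d) :=
  (isClosed_eq continuous_norm continuous_const).inter
    (isClosed_le continuous_const
      (by fun_prop : Continuous fun x : EuclideanSpace ℝ (Fin (d + 1)) => x (Fin.last d)))

/-- The surface measure of a small cap away from the equator `x i = 0`, in the ball chart. -/
theorem lintegral_inv_sqrt_le (i : Fin d) {S : Set (EuclideanSpace ℝ (Fin d))}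
    (hS : MeasurableSet S) (hS1 : ∀ x ∈ S, ‖x‖ < 1) (hpos : ∀ x ∈ S, ∀ y ∈ S, 0 < x i * y i)
    {X : EuclideanSpace ℝ (Fin (d + 1))} {ρ c : ℝ} (hρ : 0 ≤ ρ)
    (hX : ∀ x ∈ S, dist (ballLift x) X ≤ ρ) (hSc : ∀ x ∈ S, c ≤ |x i|) :
    ∫⁻ x in S, ENNReal.ofReal (c / Real.sqrt (1 - ‖x‖ ^ 2)) ≤
      ENNReal.ofReal (ρ ^ d) * volume (Metric.ball (0 : EuclideanSpace ℝ (Fin d)) 1) := by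
  classical
  set e : EuclideanSpace ℝ (Fin d) := EuclideanSpace.single i 1 with he
  let F : EuclideanSpace ℝ (Fin d) → EuclideanSpace ℝ (Fin d) := fun x =>
    x + (Real.sqrt (1 - ‖x‖ ^ 2) - x i) • e
  let ℓ : EuclideanSpace ℝ (Fin d) → EuclideanSpace ℝ (Fin d) →L[ℝ] ℝ := fun x =>
    (1 / (2 * Real.sqrt (1 - ‖x‖ ^ 2))) • -(2 • innerSL ℝ x) - EuclideanSpace.proj i
  let F' : EuclideanSpace ℝ (Fin d) → EuclideanSpace ℝ (Fin d) →L[ℝ] EuclideanSpace ℝ (Fin d) :=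
    fun x => ContinuousLinearMap.id ℝ _ + (ℓ x).smulRight e
  have hq : ∀ x ∈ S, 0 < 1 - ‖x‖ ^ 2 := fun x hx => by nlinarith [hS1 x hx, norm_nonneg x]
  have hF' : ∀ x ∈ S, HasFDerivWithinAt F (F' x) S x := fun x hx => by
    have h1 : HasFDerivAt (fun x : EuclideanSpace ℝ (Fin d) => 1 - ‖x‖ ^ 2)
        (-(2 • innerSL ℝ x)) x := ((hasStrictFDerivAt_norm_sq x).hasFDerivAt).const_sub 1
    have h2 := h1.sqrt (hq x hx).ne'
    have h3 := h2.sub (EuclideanSpace.proj (𝕜 := ℝ) i).hasFDerivAt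
    exact ((hasFDerivAt_id x).add (h3.smul_const e)).hasFDerivWithinAt
  have hdet : ∀ x ∈ S, (F' x).det = -(x i / Real.sqrt (1 - ‖x‖ ^ 2)) := fun x hx => by
    have h1 : (F' x : EuclideanSpace ℝ (Fin d) →ₗ[ℝ] EuclideanSpace ℝ (Fin d)) =
        LinearMap.transvection (ℓ x : EuclideanSpace ℝ (Fin d) →ₗ[ℝ] ℝ) e := by
      ext y : 1
      simp [F', LinearMap.transvection]
    rw [ContinuousLinearMap.det, h1, LinearMap.transvection.det]
    have h2 := Real.sqrt_pos.2 (hq x hx)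
    simp [ℓ, e, EuclideanSpace.inner_single_right]
    field_simp
  have hFi : ∀ x, F x i = Real.sqrt (1 - ‖x‖ ^ 2) := fun x => by simp [F, e]
  have hFj : ∀ x j, j ≠ i → F x j = x j := fun x j hj => by simp [F, e, hj]
  have hinj : InjOn F S := fun x hx y hy hxy => by
    have h1 : ∀ j, j ≠ i → x j = y j := fun j hj => by rw [← hFj x j hj, hxy, hFj y j hj]
    have h2 : Real.sqrt (1 - ‖x‖ ^ 2) = Real.sqrt (1 - ‖y‖ ^ 2) := by rw [← hFi, ← hFi, hxy]
    rw [Real.sqrt_inj (hq x hx).le (hq y hy).le, EuclideanSpace.real_norm_sq_eq,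
      EuclideanSpace.real_norm_sq_eq, ← Finset.add_sum_erase _ _ (Finset.mem_univ i),
      ← Finset.add_sum_erase _ _ (Finset.mem_univ i),
      Finset.sum_congr rfl fun j hj => by rw [h1 j (Finset.ne_of_mem_erase hj)]] at h2
    have h3 : x i ^ 2 = y i ^ 2 := by linarith
    ext j
    by_cases hj : j = i
    · subst hj
      rcases sq_eq_sq_iff_eq_or_eq_neg.1 h3 with h | h
      · exact h
      · have := hpos x hx y hy
        rw [h] at this
        nlinarith [sq_nonneg (y j)]
    · exact h1 j hj
  have himg : F '' S ⊆ Metric.closedBall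
      (projInit X + (X (Fin.last d) - projInit X i) • e) ρ := by
    rintro _ ⟨x, hx, rfl⟩
    rw [Metric.mem_closedBall]
    refine le_trans (le_of_sq_le_sq ?_ dist_nonneg) (hX x hx)
    rw [sq_dist_eq, dist_eq_norm, EuclideanSpace.real_norm_sq_eq,
      ← Finset.add_sum_erase _ _ (Finset.mem_univ i),
      ← Finset.add_sum_erase _ (fun j : Fin d => (ballLift x j.castSucc - X j.castSucc) ^ 2)
        (Finset.mem_univ i)]
    have h1 : (F x - (projInit X + (X (Fin.last d) - projInit X i) • e)) i =
        Real.sqrt (1 - ‖x‖ ^ 2) - X (Fin.last d) := by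
      rw [PiLp.sub_apply, hFi]
      simp [e]
    have h2 : ∀ j ∈ Finset.univ.erase i,
        (F x - (projInit X + (X (Fin.last d) - projInit X i) • e)) j ^ 2 =
        (ballLift x j.castSucc - X j.castSucc) ^ 2 := fun j hj => by
      rw [PiLp.sub_apply, hFj x j (Finset.ne_of_mem_erase hj)]
      simp [e, Finset.ne_of_mem_erase hj]
    rw [h1, Finset.sum_congr rfl h2, ballLift_last]
    linarith [sq_nonneg (ballLift x i.castSucc - X i.castSucc)]
  calc ∫⁻ x in S, ENNReal.ofReal (c / Real.sqrt (1 - ‖x‖ ^ 2))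
      ≤ ∫⁻ x in S, ENNReal.ofReal |(F' x).det| := by
        refine setLIntegral_mono' hS fun x hx => ENNReal.ofReal_le_ofReal ?_
        rw [hdet x hx, abs_neg, abs_div, abs_of_nonneg (Real.sqrt_nonneg _)]
        exact div_le_div_of_nonneg_right (hSc x hx) (Real.sqrt_nonneg _)
    _ = volume (F '' S) := lintegral_abs_det_fderiv_eq_addHaar_image volume hS hF' hinj
    _ ≤ _ := measure_mono himg
    _ = _ := by
        rw [Measure.addHaar_closedBall _ _ hρ, finrank_euclideanSpace_fin]

/-- The weighted measure on the ball, transported to the upper half sphere. -/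
def liftMeasure (w : EuclideanSpace ℝ (Fin d) → ℝ) : Measure (EuclideanSpace ℝ (Fin (d + 1))) :=
  ((ballVol d).withDensity fun x => ENNReal.ofReal (w x)).map ballLift

theorem ballVol_compl : ballVol d (Metric.closedBall 0 1)ᶜ = 0 := by
  rw [ballVol, Measure.restrict_apply Metric.isClosed_closedBall.measurableSet.compl,
    Set.compl_inter_self, measure_empty]

theorem ae_norm_le_one : ∀ᵐ x ∂ballVol d, ‖x‖ ≤ 1 := by
  filter_upwards [measure_eq_zero_iff_ae_notMem.1 (ballVol_compl (d := d))] with x hx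
  simpa using hx

theorem wMassB_mono {w : EuclideanSpace ℝ (Fin d) → ℝ} (hw : ∀ x, 0 ≤ w x)
    (hint : Integrable w (ballVol d))
    {A A' : Set (EuclideanSpace ℝ (Fin d))}
    (hAA' : ∀ x, ‖x‖ ≤ 1 → x ∈ A → x ∈ A') : wMassB w A ≤ wMassB w A' := by
  refine setIntegral_mono_set hint.integrableOn (ae_of_all _ hw) ?_
  filter_upwards [ae_norm_le_one] with x hx
  exact hAA' x hx

theorem liftMeasure_apply {w : EuclideanSpace ℝ (Fin d) → ℝ} (hw : ∀ x, 0 ≤ w x)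
    (hint : Integrable w (ballVol d))
    {S : Set (EuclideanSpace ℝ (Fin (d + 1)))} (hS : MeasurableSet S) :
    liftMeasure w S = ENNReal.ofReal (wMassB w (ballLift ⁻¹' S)) := by
  have hS' := continuous_ballLift.measurable hS
  rw [liftMeasure, Measure.map_apply continuous_ballLift.measurable hS,
    withDensity_apply _ hS', wMassB,
    ofReal_integral_eq_lintegral_ofReal hint.integrableOn (ae_of_all _ hw)]

theorem liftMeasure_real_apply {w : EuclideanSpace ℝ (Fin d) → ℝ} (hw : ∀ x, 0 ≤ w x)
    (hint : Integrable w (ballVol d))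
    {S : Set (EuclideanSpace ℝ (Fin (d + 1)))} (hS : MeasurableSet S) :
    (liftMeasure w).real S = wMassB w (ballLift ⁻¹' S) := by
  rw [measureReal_def, liftMeasure_apply hw hint hS, wMassB,
    ENNReal.toReal_ofReal (integral_nonneg hw)]

theorem integral_liftMeasure {w : EuclideanSpace ℝ (Fin d) → ℝ} (hw : ∀ x, 0 ≤ w x)
    (hint : Integrable w (ballVol d))
    {g : EuclideanSpace ℝ (Fin (d + 1)) → ℝ} (hg : Continuous g) :
    ∫ x, g x ∂liftMeasure w = ∫ x, g (ballLift x) * w x ∂ballVol d := by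
  rw [liftMeasure, integral_map continuous_ballLift.aemeasurable hg.aestronglyMeasurable,
    integral_withDensity_eq_integral_toReal_smul₀ hint.aemeasurable.ennreal_ofReal
      (ae_of_all _ fun _ => ENNReal.ofReal_lt_top)]
  refine integral_congr_ae (ae_of_all _ fun x => ?_)
  simp only [ENNReal.toReal_ofReal (hw x), smul_eq_mul]
  ring

theorem wMassB_ballRho_le {w : EuclideanSpace ℝ (Fin d) → ℝ} (hw : ∀ x, 0 ≤ w x)
    (hint : Integrable w (ballVol d))
    {x : EuclideanSpace ℝ (Fin d)} {r : ℝ} :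
    wMassB w (ballRho x r) ≤ (liftMeasure w).real (Metric.closedBall (ballLift x) r) := by
  rw [liftMeasure_real_apply hw hint Metric.isClosed_closedBall.measurableSet]
  refine wMassB_mono hw hint fun y _ hy => ?_
  rw [Set.mem_preimage, Metric.mem_closedBall, dist_comm]
  exact (dist_ballLift_le_rhoB x y).trans hy.2

theorem liftMeasure_closedBall_le {w : EuclideanSpace ℝ (Fin d) → ℝ} (hw : ∀ x, 0 ≤ w x)
    (hint : Integrable w (ballVol d))
    {x : EuclideanSpace ℝ (Fin d)} {r : ℝ} :
    (liftMeasure w).real (Metric.closedBall (ballLift x) r) ≤ wMassB w (ballRho x (2 * r)) := by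
  rw [liftMeasure_real_apply hw hint Metric.isClosed_closedBall.measurableSet]
  refine wMassB_mono hw hint fun y hy1 hy => ⟨hy1, ?_⟩
  rw [Set.mem_preimage, Metric.mem_closedBall, dist_comm] at hy
  linarith [rhoB_le_two_mul_dist_ballLift x y]

theorem halfDoubling_liftMeasure {w : EuclideanSpace ℝ (Fin d) → ℝ} (hw : ∀ x, 0 ≤ w x)
    (hint : Integrable w (ballVol d))
    (hmass : wMassB w (Metric.closedBall 0 1) = 1) {L : ℝ}
    (hL : ∀ x : EuclideanSpace ℝ (Fin d), ‖x‖ ≤ 1 → ∀ r : ℝ, 0 < r →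
      wMassB w (ballRho x (2 * r)) ≤ L * wMassB w (ballRho x r)) {s : ℕ}
    (hs : max L 1 ^ 2 ≤ 2 ^ s) : HalfDoubling s (liftMeasure w) := by
  refine ⟨⟨?_⟩, ?_, ?_⟩
  · rw [liftMeasure_apply hw hint MeasurableSet.univ, Set.preimage_univ, ENNReal.ofReal_eq_one]
    refine le_antisymm ?_ ?_ <;> rw [← hmass]
    · exact wMassB_mono hw hint fun x hx _ => by simpa using hx
    · exact wMassB_mono hw hint fun x hx _ => mem_univ x
  · rw [liftMeasure_apply hw hint isClosed_upSphere.measurableSet.compl, ENNReal.ofReal_eq_zero]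
    refine (wMassB_mono hw hint (A' := ∅) fun x hx hx' => absurd (ballLift_mem hx) hx').trans ?_
    simp [wMassB]
  · intro X hX r hr
    rw [← ballLift_projInit hX]
    have hx := norm_projInit_le_one hX
    generalize projInit X = x at hx
    have hpos : ∀ r, 0 ≤ wMassB w (ballRho x r) := fun r => integral_nonneg hw
    have h1 : ∀ r, 0 < r → wMassB w (ballRho x (2 * r)) ≤ max L 1 * wMassB w (ballRho x r) :=
      fun r hr => (hL x hx r hr).trans (mul_le_mul_of_nonneg_right (le_max_left _ _) (hpos r))
    have hm : 0 ≤ max L 1 := zero_le_one.trans (le_max_right _ _)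
    calc _ ≤ wMassB w (ballRho x (2 * (2 * r))) := liftMeasure_closedBall_le hw hint
      _ ≤ max L 1 * (max L 1 * wMassB w (ballRho x r)) :=
        (h1 _ (by positivity)).trans (mul_le_mul_of_nonneg_left (h1 r hr) hm)
      _ = max L 1 ^ 2 * wMassB w (ballRho x r) := by ring
      _ ≤ _ := mul_le_mul hs (wMassB_ballRho_le hw hint) (hpos r) (by positivity)

/-- Weights dominated by the Chebyshev weight give small mass to small caps. -/
theorem exists_liftMeasure_closedBall_le (d : ℕ) (B : ℝ) : ∃ B' : ℝ, 0 < B' ∧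
    ∀ w : EuclideanSpace ℝ (Fin d) → ℝ, (∀ x, 0 ≤ w x) → Integrable w (ballVol d) →
    wMassB w (Metric.closedBall 0 1) = 1 →
    (∀ᵐ x ∂(ballVol d), w x * Real.sqrt (1 - ‖x‖ ^ 2) ≤ B) →
    ∀ X ∈ upSphere d, ∀ ρ : ℝ, 0 < ρ →
      (liftMeasure w).real (Metric.closedBall X ρ) ≤ B' * ρ ^ d := by
  set c : ℝ := 1 / (2 * (d + 1)) with hc
  have hc0 : 0 < c := by positivity
  set v : ℝ := volume.real (Metric.ball (0 : EuclideanSpace ℝ (Fin d)) 1) with hv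
  have hv0 : 0 ≤ v := measureReal_nonneg
  have hvv : volume (Metric.ball (0 : EuclideanSpace ℝ (Fin d)) 1) = ENNReal.ofReal v :=
    (ENNReal.ofReal_toReal measure_ball_lt_top.ne).symm
  refine ⟨(1 / c) ^ d + max B 0 / c * v, by positivity, ?_⟩
  intro w hw hint hmass hB X hX ρ hρ
  have hB0 : 0 ≤ max B 0 := le_max_right _ _
  by_cases hρc : c ≤ ρ
  · have h1 : (liftMeasure w).real (Metric.closedBall X ρ) ≤ 1 := by
      rw [liftMeasure_real_apply hw hint Metric.isClosed_closedBall.measurableSet, ← hmass]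
      exact wMassB_mono hw hint fun x hx _ => by simpa using hx
    have h2 : 1 ≤ (1 / c) ^ d * ρ ^ d := by
      rw [← mul_pow]
      refine one_le_pow₀ ?_
      rwa [one_div_mul_eq_div, one_le_div hc0]
    rw [add_mul]
    have h3 : 0 ≤ max B 0 / c * v * ρ ^ d := by positivity
    linarith
  push Not at hρc
  have hk : ∃ k, 2 * c ≤ |X k| := by
    by_contra! h
    have h1 := EuclideanSpace.real_norm_sq_eq X
    rw [hX.1] at h1
    have h2 : ∑ k, X k ^ 2 < ∑ k : Fin (d + 1), (2 * c) ^ 2 := by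
      refine Finset.sum_lt_sum_of_nonempty Finset.univ_nonempty fun k _ => ?_
      rw [← sq_abs]
      exact pow_lt_pow_left₀ (h k) (abs_nonneg _) two_ne_zero
    rw [Finset.sum_const, Finset.card_univ, Fintype.card_fin, nsmul_eq_mul] at h2
    have h3 : 2 * c * (d + 1) = 1 := by rw [hc]; field_simp
    push_cast at h2
    have h4 : 2 * c ≤ 1 := by
      have : (0 : ℝ) ≤ d := Nat.cast_nonneg _
      nlinarith
    nlinarith
  obtain ⟨k, hk⟩ := hk
  set S : Set (EuclideanSpace ℝ (Fin d)) :=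
    ballLift ⁻¹' Metric.closedBall X ρ ∩ Metric.ball 0 1 with hS
  have hSm : MeasurableSet S :=
    (continuous_ballLift.measurable Metric.isClosed_closedBall.measurableSet).inter
      Metric.isOpen_ball.measurableSet
  have hS1 : ∀ x ∈ S, ‖x‖ < 1 := fun x hx => by simpa using hx.2
  have hSX : ∀ x ∈ S, dist (ballLift x) X ≤ ρ := fun x hx => hx.1
  have hSk : ∀ x ∈ S, |ballLift x k - X k| ≤ ρ := fun x hx => by
    have := PiLp.norm_apply_le (p := 2) (ballLift x - X) k
    rw [← dist_eq_norm] at this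
    exact this.trans (hSX x hx)
  have hmain : ∫⁻ x in S, ENNReal.ofReal (c / Real.sqrt (1 - ‖x‖ ^ 2)) ≤
      ENNReal.ofReal (ρ ^ d) * ENNReal.ofReal v := by
    rw [← hvv]
    revert hk hSk
    refine Fin.lastCases ?_ (fun i => ?_) k
    · intro hk hSk
      calc _ ≤ ∫⁻ x in S, 1 := by
            refine setLIntegral_mono' hSm fun x hx => ENNReal.ofReal_le_one.2 ?_
            have h1 := hSk x hx
            rw [ballLift_last, abs_le] at h1
            rw [abs_of_nonneg hX.2] at hk
            have h2 : c ≤ Real.sqrt (1 - ‖x‖ ^ 2) := by linarith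
            exact div_le_one_of_le₀ h2 (Real.sqrt_nonneg _)
        _ = volume S := setLIntegral_one S
        _ ≤ volume (Metric.closedBall (projInit X) ρ) := by
            refine measure_mono fun x hx => ?_
            rw [Metric.mem_closedBall, ← projInit_ballLift x]
            exact (dist_projInit_le _ _).trans (hSX x hx)
        _ = _ := by rw [Measure.addHaar_closedBall _ _ hρ.le, finrank_euclideanSpace_fin]
    · intro hk hSk
      simp only [ballLift_castSucc] at hSk
      refine lintegral_inv_sqrt_le i hSm hS1 (fun x hx y hy => ?_) hρ.le hSX fun x hx => ?_
      · have h1 := abs_le.1 (hSk x hx)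
        have h2 := abs_le.1 (hSk y hy)
        rcases le_abs.1 hk with h | h
        · exact mul_pos (by linarith) (by linarith)
        · exact mul_pos_of_neg_of_neg (by linarith) (by linarith)
      · have h1 := abs_sub_abs_le_abs_sub (X i.castSucc) (x i)
        rw [abs_sub_comm] at h1
        linarith [hSk x hx]
  have hle : liftMeasure w (Metric.closedBall X ρ) ≤
      ENNReal.ofReal (max B 0 / c * (ρ ^ d * v)) := by
    rw [liftMeasure, Measure.map_apply continuous_ballLift.measurable
      Metric.isClosed_closedBall.measurableSet, withDensity_apply _
      (continuous_ballLift.measurable Metric.isClosed_closedBall.measurableSet)]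
    have h1 : ballVol d = volume.restrict (Metric.ball 0 1) := by
      refine Measure.restrict_congr_set (Filter.EventuallyEq.symm ?_)
      refine Metric.ball_subset_closedBall.eventuallyLE.antisymm ?_
      have := Measure.addHaar_sphere_of_ne_zero volume (0 : EuclideanSpace ℝ (Fin d)) one_ne_zero
      filter_upwards [measure_eq_zero_iff_ae_notMem.1 this] with x hx hx'
      exact lt_of_le_of_ne hx' hx
    rw [h1] at hB ⊢
    rw [Measure.restrict_restrict
      (continuous_ballLift.measurable Metric.isClosed_closedBall.measurableSet), ← hS,
      ENNReal.ofReal_mul (by positivity), ENNReal.ofReal_mul (by positivity)]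
    refine le_trans ?_ (mul_le_mul_right hmain _)
    rw [← lintegral_const_mul' _ _ ENNReal.ofReal_ne_top]
    refine setLIntegral_mono_ae' hSm ?_
    filter_upwards [(ae_restrict_iff' Metric.isOpen_ball.measurableSet).1 hB] with x hx hxS
    have h2 := hx hxS.2
    have h3 := Real.sqrt_pos.2 (show 0 < 1 - ‖x‖ ^ 2 by nlinarith [hS1 x hxS, norm_nonneg x])
    rw [← ENNReal.ofReal_mul (by positivity)]
    refine ENNReal.ofReal_le_ofReal ?_
    rw [div_mul_div_cancel₀ hc0.ne', le_div_iff₀ h3]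
    exact h2.trans (le_max_left _ _)
  have h1 : (liftMeasure w).real (Metric.closedBall X ρ) ≤ max B 0 / c * (ρ ^ d * v) :=
    ENNReal.toReal_le_of_le_ofReal (by positivity) hle
  have h2 : 0 ≤ (1 / c) ^ d * ρ ^ d := by positivity
  calc _ ≤ max B 0 / c * (ρ ^ d * v) := h1
    _ ≤ _ := by linarith

/-- Nodes on the open half sphere project to the nodes of a cubature formula on the ball. -/
theorem exists_finset_of_nodes {w : EuclideanSpace ℝ (Fin d) → ℝ} (hw : ∀ x, 0 ≤ w x)
    (hint : Integrable w (ballVol d)) {n N : ℕ} (hN : 0 < N) {η : ℝ} (hη : 0 < η)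
    {X : Fin N → EuclideanSpace ℝ (Fin (d + 1))} (hX : ∀ j, ‖X j‖ = 1)
    (hpos : ∀ j, 0 < X j (Fin.last d)) (hsep : ∀ i j, i ≠ j → η ≤ dist (X i) (X j))
    (hP : ∀ P : MvPolynomial (Fin d) ℝ, P.totalDegree ≤ n →
      ∑ j, pEval P (projInit (X j)) = N * ∫ x, pEval P (projInit x) ∂liftMeasure w) :
    ∃ Z : Finset (EuclideanSpace ℝ (Fin d)), Z.card = N ∧ (∀ z ∈ Z, ‖z‖ < 1) ∧
      (∀ P : MvPolynomial (Fin d) ℝ, P.totalDegree ≤ n →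
        (∫ x, pEval P x * w x ∂(ballVol d)) = (1 / (N : ℝ)) * ∑ z ∈ Z, pEval P z) ∧
      ∀ z ∈ Z, ∀ z' ∈ Z, z ≠ z' → η ≤ rhoB z z' := by
  classical
  have hmem : ∀ j, X j ∈ upSphere d := fun j => ⟨hX j, (hpos j).le⟩
  have hinj : Function.Injective fun j => projInit (X j) := fun i j hij => by
    by_contra hne
    have h1 := hsep i j hne
    rw [← ballLift_projInit (hmem i), ← ballLift_projInit (hmem j), show projInit (X i) =
      projInit (X j) from hij, dist_self] at h1
    exact absurd h1 (not_le.2 hη)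
  have hN' : (N : ℝ) ≠ 0 := Nat.cast_ne_zero.2 hN.ne'
  refine ⟨Finset.univ.image fun j => projInit (X j), ?_, ?_, fun P hdeg => ?_, ?_⟩
  · rw [Finset.card_image_of_injective _ hinj, Finset.card_univ, Fintype.card_fin]
  · intro z hz
    obtain ⟨j, -, rfl⟩ := Finset.mem_image.1 hz
    have h1 := sq_norm_eq_projInit (X j)
    rw [hX j] at h1
    exact lt_of_pow_lt_pow_left₀ 2 zero_le_one (by nlinarith [pow_pos (hpos j) 2])
  · rw [Finset.sum_image fun i _ j _ h => hinj h, hP P hdeg]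
    simp only [← pEval_liftPoly]
    rw [integral_liftMeasure hw hint (continuous_pEval _)]
    simp only [pEval_liftPoly, projInit_ballLift]
    field_simp
  · intro z hz z' hz' hne
    obtain ⟨i, -, rfl⟩ := Finset.mem_image.1 hz
    obtain ⟨j, -, rfl⟩ := Finset.mem_image.1 hz'
    have h1 := dist_ballLift_le_rhoB (projInit (X i)) (projInit (X j))
    rw [ballLift_projInit (hmem i), ballLift_projInit (hmem j)] at h1
    exact (hsep i j fun h => hne (by rw [h])).trans h1

/-- Chebyshev-type cubature formulas for doubling weights on the unit
ball, with nodes in the open ball, and well-separated nodes in the bounded case. -/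
theorem ball_chebyshev_cubature (d : ℕ) (hd : 1 ≤ d) (L : ℝ) :
    ∃ K : ℝ, 0 < K ∧
      ∀ B : ℝ, ∃ cstar : ℝ, 0 < cstar ∧
        ∀ w : EuclideanSpace ℝ (Fin d) → ℝ,
          (∀ x, 0 ≤ w x) →
          Integrable w (ballVol d) →
          wMassB w (Metric.closedBall (0 : EuclideanSpace ℝ (Fin d)) 1) = 1 →
          (∀ x : EuclideanSpace ℝ (Fin d), ‖x‖ ≤ 1 → ∀ r : ℝ, 0 < r →
            wMassB w (ballRho x (2 * r)) ≤ L * wMassB w (ballRho x r)) →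
          ∀ n N : ℕ, 0 < n →
            (∀ x : EuclideanSpace ℝ (Fin d), ‖x‖ ≤ 1 →
              K ≤ (N : ℝ) * wMassB w (ballRho x (1 / (n : ℝ)))) →
            (∃ Z : Finset (EuclideanSpace ℝ (Fin d)), Z.card = N ∧
              (∀ z ∈ Z, ‖z‖ < 1) ∧
              ∀ P : MvPolynomial (Fin d) ℝ, P.totalDegree ≤ n →
                (∫ x, pEval P x * w x ∂(ballVol d))
                  = (1 / (N : ℝ)) * ∑ z ∈ Z, pEval P z) ∧
            ((∀ᵐ x ∂(ballVol d), w x * Real.sqrt (1 - ‖x‖ ^ 2) ≤ B) →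
              ∃ Z : Finset (EuclideanSpace ℝ (Fin d)), Z.card = N ∧
                (∀ z ∈ Z, ‖z‖ < 1) ∧
                (∀ P : MvPolynomial (Fin d) ℝ, P.totalDegree ≤ n →
                  (∫ x, pEval P x * w x ∂(ballVol d))
                    = (1 / (N : ℝ)) * ∑ z ∈ Z, pEval P z) ∧
                ∀ z ∈ Z, ∀ z' ∈ Z, z ≠ z' →
                  cstar * (N : ℝ) ^ (-(1 : ℝ) / (d : ℝ)) ≤ rhoB z z') := by
  obtain ⟨s, hs⟩ := pow_unbounded_of_one_lt (max L 1 ^ 2) (one_lt_two : (1 : ℝ) < 2)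
  obtain ⟨K, ε, C, hK, hε, hC, hcub⟩ := HalfDoubling.exists_cubature d s hd
  refine ⟨K, hK, fun B => ?_⟩
  obtain ⟨B', hB', hcap⟩ := exists_liftMeasure_closedBall_le d B
  set b : ℝ := max B' 1 with hb
  have hb1 : 1 ≤ b := le_max_right _ _
  have hb0 : 0 < b := by linarith
  refine ⟨1 / (10 * C * b) / 2, by positivity, fun w hw hint hmass hL n N hn hKN => ?_⟩
  have hω := halfDoubling_liftMeasure hw hint hmass hL hs.le
  have := hω.prob
  have hN : 0 < N := by
    rcases Nat.eq_zero_or_pos N with h | h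
    · have h1 := hKN 0 (by simp)
      rw [h, Nat.cast_zero, zero_mul] at h1
      exact absurd hK (not_lt.2 h1)
    · exact h
  have hn0 : (0 : ℝ) < n := Nat.cast_pos.2 hn
  have hN0 : (0 : ℝ) < N := Nat.cast_pos.2 hN
  have hN1 : (1 : ℝ) ≤ N := Nat.one_le_cast.2 hN
  have hKX : ∀ x ∈ upSphere d, K ≤ N * (liftMeasure w).real (Metric.closedBall x (1 / n)) := by
    intro x hx
    refine (hKN _ (norm_projInit_le_one hx)).trans ?_
    have h1 := wMassB_ballRho_le hw hint (x := projInit x) (r := 1 / (n : ℝ))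
    rw [ballLift_projInit hx] at h1
    exact mul_le_mul_of_nonneg_left h1 hN0.le
  have hcub' := hcub _ hω n N hn hKX
  constructor
  · obtain ⟨X, hX, hpos, hsep, hP⟩ := hcub' (ε / n / (C * N)) (by positivity) fun x _ => by
      have h1 : (liftMeasure w).real (Metric.closedBall x (10 * (ε / n))) ≤ 1 :=
        measureReal_le_one
      have h2 : C * (ε / n / (C * N)) = ε / n / N := by field_simp
      have h3 : (N : ℝ) ≤ (N : ℝ) ^ d := le_self_pow₀ hN1 (by omega)
      rw [h2, div_pow (ε / (n : ℝ))]
      calc _ ≤ (N : ℝ) ^ d * 1 * ((ε / n) ^ d / (N : ℝ) ^ d) := by gcongr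
        _ = _ := by field_simp
    obtain ⟨Z, h1, h2, h3, -⟩ := exists_finset_of_nodes hw hint hN (by positivity) hX hpos hsep hP
    exact ⟨Z, h1, h2, h3⟩
  · intro hBw
    have hpow : ((N : ℝ) ^ (-(1 : ℝ) / (d : ℝ))) ^ d = (N : ℝ)⁻¹ := by
      have hd0 : (d : ℝ) ≠ 0 := Nat.cast_ne_zero.2 (by omega)
      rw [← Real.rpow_natCast, ← Real.rpow_mul hN0.le, div_mul_cancel₀ _ hd0, Real.rpow_neg_one]
    have hNr : 0 < (N : ℝ) ^ (-(1 : ℝ) / (d : ℝ)) := Real.rpow_pos_of_pos hN0 _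
    obtain ⟨X, hX, hpos, hsep, hP⟩ := hcub'
      (1 / (10 * C * b) * (N : ℝ) ^ (-(1 : ℝ) / (d : ℝ))) (by positivity) fun x hx => by
        have h1 := hcap w hw hint hmass hBw x hx (10 * (ε / n)) (by positivity)
        have h2 : B' * (1 / b) ^ d ≤ 1 := by
          have h3 : b ≤ b ^ d := le_self_pow₀ hb1 (by omega)
          rw [one_div, inv_pow, ← div_eq_mul_inv, div_le_one (by positivity)]
          exact (le_max_left _ _).trans h3
        calc _ ≤ N * (B' * (10 * (ε / n)) ^ d) *
              (C * (1 / (10 * C * b) * (N : ℝ) ^ (-(1 : ℝ) / (d : ℝ)))) ^ d := by gcongr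
          _ = (N * ((N : ℝ) ^ (-(1 : ℝ) / (d : ℝ))) ^ d) *
              (B' * (10 * (ε / n) * (C * (1 / (10 * C * b)))) ^ d) := by
            simp only [mul_pow]
            ring
          _ = B' * (1 / b) ^ d * (ε / n) ^ d := by
            rw [hpow, mul_inv_cancel₀ hN0.ne', one_mul, mul_assoc B', ← mul_pow]
            congr 2
            field_simp
          _ ≤ _ := mul_le_of_le_one_left (by positivity) h2
    obtain ⟨Z, h1, h2, h3, h4⟩ := exists_finset_of_nodes hw hint hN (by positivity) hX hpos hsep hP
    refine ⟨Z, h1, h2, h3, fun z hz z' hz' hne => le_trans (le_of_eq ?_) (h4 z hz z' hz' hne)⟩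
    ring
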